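/- arXiv:2401.07979 — 2 statements merged into one kernel-verified Lean document; each statement's English description precedes it below -/
import Mathlib

section
/- Let n ≥ 1, 0 < λ ≤ Λ, κ ≥ 0, q ≥ 0, let F : Sym(n) → ℝ be (λ,Λ)-elliptic, let f : B₁ → ℝ be bounded and continuous, and let u : B₁ → ℝ be a bounded κ-grad viscosity solution of (|Du|−κ)₊^q F(D²u) = f in B₁. Then there exists a constant C > 0, depending only on n, λ, Λ, κ, ‖f‖_{L^∞(B₁)} and ‖u‖_{L^∞(B₁)} — in particular independent of q — such that |u(x) − u(y)| ≤ C|x−y| for all x, y ∈ B_{1/2}. -/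
open Metric Set Matrix MeasureTheory
open scoped RealInnerProductSpace

noncomputable section

abbrev Euc (n : ℕ) := EuclideanSpace ℝ (Fin n)

def EllMat (n : ℕ) (lam Lam : ℝ) : Set (Matrix (Fin n) (Fin n) ℝ) :=
  {A | A.IsSymm ∧ ∀ ξ : Fin n → ℝ,
      lam * (ξ ⬝ᵥ ξ) ≤ ξ ⬝ᵥ A.mulVec ξ ∧ ξ ⬝ᵥ A.mulVec ξ ≤ Lam * (ξ ⬝ᵥ ξ)}

/-- Pucci maximal operator `M⁺`. -/
def pucciSup (n : ℕ) (lam Lam : ℝ) (M : Matrix (Fin n) (Fin n) ℝ) : ℝ :=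
  sSup ((fun A => (A * M).trace) '' EllMat n lam Lam)

/-- Pucci minimal operator `M⁻`. -/
def pucciInf (n : ℕ) (lam Lam : ℝ) (M : Matrix (Fin n) (Fin n) ℝ) : ℝ :=
  sInf ((fun A => (A * M).trace) '' EllMat n lam Lam)

/-- `(λ,Λ)`-ellipticity of `F`. -/
def IsUniformlyElliptic (n : ℕ) (lam Lam : ℝ)
    (F : Matrix (Fin n) (Fin n) ℝ → ℝ) : Prop :=
  ∀ M N : Matrix (Fin n) (Fin n) ℝ, M.IsSymm → N.IsSymm →
    pucciInf n lam Lam (M - N) ≤ F M - F N ∧ F M - F N ≤ pucciSup n lam Lam (M - N)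

/-- Hessian matrix of `φ` at `x`. -/
def hess {n : ℕ} (φ : Euc n → ℝ) (x : Euc n) : Matrix (Fin n) (Fin n) ℝ :=
  fun i j => iteratedFDeriv ℝ 2 φ x ![EuclideanSpace.single i 1, EuclideanSpace.single j 1]

/-- `κ`-grad viscosity subsolution of `G(Du, D²u) = f` in `s`. -/
def GradSubSol {n : ℕ} (κ : ℝ) (G : Euc n → Matrix (Fin n) (Fin n) ℝ → ℝ)
    (f : Euc n → ℝ) (s : Set (Euc n)) (u : Euc n → ℝ) : Prop :=
  ∀ x₀ ∈ s, ∀ φ : Euc n → ℝ, ContDiff ℝ 2 φ →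
    IsLocalMax (fun x => u x - φ x) x₀ → κ < ‖gradient φ x₀‖ →
    f x₀ ≤ G (gradient φ x₀) (hess φ x₀)

/-- `κ`-grad viscosity supersolution of `G(Du, D²u) = f` in `s`. -/
def GradSupSol {n : ℕ} (κ : ℝ) (G : Euc n → Matrix (Fin n) (Fin n) ℝ → ℝ)
    (f : Euc n → ℝ) (s : Set (Euc n)) (u : Euc n → ℝ) : Prop :=
  ∀ x₀ ∈ s, ∀ φ : Euc n → ℝ, ContDiff ℝ 2 φ →
    IsLocalMin (fun x => u x - φ x) x₀ → κ < ‖gradient φ x₀‖ →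
    G (gradient φ x₀) (hess φ x₀) ≤ f x₀

/-- `κ`-grad viscosity solution. -/
def GradSol {n : ℕ} (κ : ℝ) (G : Euc n → Matrix (Fin n) (Fin n) ℝ → ℝ)
    (f : Euc n → ℝ) (s : Set (Euc n)) (u : Euc n → ℝ) : Prop :=
  GradSubSol κ G f s u ∧ GradSupSol κ G f s u

/-- Classical viscosity solution (no restriction on the slope of test functions). -/
def ViscSol {n : ℕ} (G : Euc n → Matrix (Fin n) (Fin n) ℝ → ℝ)
    (f : Euc n → ℝ) (s : Set (Euc n)) (u : Euc n → ℝ) : Prop :=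
  (∀ x₀ ∈ s, ∀ φ : Euc n → ℝ, ContDiff ℝ 2 φ →
    IsLocalMax (fun x => u x - φ x) x₀ → f x₀ ≤ G (gradient φ x₀) (hess φ x₀)) ∧
  (∀ x₀ ∈ s, ∀ φ : Euc n → ℝ, ContDiff ℝ 2 φ →
    IsLocalMin (fun x => u x - φ x) x₀ → G (gradient φ x₀) (hess φ x₀) ≤ f x₀)

/-- The operator `G(ξ, M) = (|ξ|-κ)₊^q F(M)`. -/
def mainG {n : ℕ} (κ q : ℝ) (F : Matrix (Fin n) (Fin n) ℝ → ℝ) :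
    Euc n → Matrix (Fin n) (Fin n) ℝ → ℝ :=
  fun ξ M => max (‖ξ‖ - κ) 0 ^ q * F M

/-- The set `Ω_u` of points of `s` that can be touched from above or below by a `C²`
function with slope larger than `κ`. -/
def omegaSet {n : ℕ} (κ : ℝ) (s : Set (Euc n)) (u : Euc n → ℝ) : Set (Euc n) :=
  {x ∈ s | ∃ φ : Euc n → ℝ, ContDiff ℝ 2 φ ∧
    (IsLocalMax (fun y => u y - φ y) x ∨ IsLocalMin (fun y => u y - φ y) x) ∧
    κ < ‖gradient φ x‖}

/-- Effective viscosity solution of `(|Du|-κ)₊^q F(D²u) = f` in `s`. -/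
def EffectiveSol {n : ℕ} (κ q : ℝ) (F : Matrix (Fin n) (Fin n) ℝ → ℝ)
    (f : Euc n → ℝ) (s : Set (Euc n)) (u : Euc n → ℝ) : Prop :=
  IsOpen (omegaSet κ s u) ∧ ViscSol (mainG κ q F) f (omegaSet κ s u) u


section ProxSubgradient

variable {E : Type*} [NormedAddCommGroup E] [InnerProductSpace ℝ E]

/-- `q` is a proximal subgradient of `w` at `z` with global quadratic constant `K`. -/
def ProxSubgrad (K : ℝ) (w : E → ℝ) (z q : E) : Prop :=
  ∀ z', w z + ⟪q, z' - z⟫ - K / 2 * ‖z' - z‖ ^ 2 ≤ w z'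

lemma ProxSubgrad.norm_sub_le {K : ℝ} {w : E → ℝ} {z q z' q' : E}
    (h : ProxSubgrad K w z q) (h' : ProxSubgrad K w z' q') :
    ‖z' - z‖ ≤ ‖(q' + (K + 1) • z') - (q + (K + 1) • z)‖ := by
  have h1 := h z'
  have h2 := h' z
  have e1 : ⟪q', z - z'⟫ = -⟪q', z' - z⟫ := by rw [← inner_neg_right, neg_sub]
  rw [norm_sub_rev z z', e1] at h2
  have e2 : (q' + (K + 1) • z') - (q + (K + 1) • z) = q' - q + (K + 1) • (z' - z) := by
    rw [smul_sub]; abel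
  have h3 := real_inner_le_norm ((q' + (K + 1) • z') - (q + (K + 1) • z)) (z' - z)
  rw [e2] at h3 ⊢
  have e3 : ⟪q' - q + (K + 1) • (z' - z), z' - z⟫
      = ⟪q', z' - z⟫ - ⟪q, z' - z⟫ + (K + 1) * ‖z' - z‖ ^ 2 := by
    rw [inner_add_left, inner_sub_left, real_inner_smul_left, real_inner_self_eq_norm_sq]
  rw [e3] at h3
  rcases (norm_nonneg (z' - z)).eq_or_lt with h0 | h0
  · rw [← h0]; positivity
  · by_contra hc
    push Not at hc
    nlinarith

lemma ProxSubgrad.eq_of_contact {K C r : ℝ} {w : E → ℝ} {z q p : E}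
    (h : ProxSubgrad K w z q) (hr : 0 < r)
    (hc : ∀ k, ‖k‖ < r → w (z + k) ≤ w z + ⟪p, k⟫ + C * ‖k‖ ^ 2) : q = p := by
  by_contra hne
  have hd : 0 < ‖q - p‖ := norm_pos_iff.2 (sub_ne_zero.2 hne)
  have key : ∀ t, 0 < t → t * ‖q - p‖ < r → 1 ≤ (|C| + |K|) * t := by
    intro t ht htr
    have hn : ‖t • (q - p)‖ = t * ‖q - p‖ := by rw [norm_smul, Real.norm_of_nonneg ht.le]
    have h1 := hc (t • (q - p)) (by rwa [hn])
    have h2 := h (z + t • (q - p))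
    rw [add_sub_cancel_left, hn] at h2
    rw [hn] at h1
    have e : ⟪q, t • (q - p)⟫ - ⟪p, t • (q - p)⟫ = t * ‖q - p‖ ^ 2 := by
      rw [← inner_sub_left, real_inner_smul_right, real_inner_self_eq_norm_sq]
    have h3 : t * ‖q - p‖ ^ 2 ≤ (C + K / 2) * (t * ‖q - p‖) ^ 2 := by linarith
    have h4 : C + K / 2 ≤ |C| + |K| := by
      have := le_abs_self C
      have := le_abs_self K
      have := abs_nonneg K
      linarith
    have h5 : t * ‖q - p‖ ^ 2 ≤ (|C| + |K|) * (t * ‖q - p‖) ^ 2 :=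
      h3.trans (by gcongr)
    have h6 : 0 < t * ‖q - p‖ ^ 2 := by positivity
    by_contra hlt
    push Not at hlt
    nlinarith
  set B := |C| + |K| with hB
  have hB0 : 0 ≤ B := by positivity
  have h1 := key (min (r / (2 * ‖q - p‖)) (1 / (2 * (B + 1)))) (by positivity) (by
    calc _ ≤ r / (2 * ‖q - p‖) * ‖q - p‖ := by gcongr; exact min_le_left _ _
      _ = r / 2 := by field_simp
      _ < r := by linarith)
  have h2 : B * min (r / (2 * ‖q - p‖)) (1 / (2 * (B + 1))) ≤ B * (1 / (2 * (B + 1))) := by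
    gcongr; exact min_le_right _ _
  have h3 : B * (1 / (2 * (B + 1))) < 1 := by
    rw [mul_one_div, div_lt_one (by positivity)]; linarith
  linarith

lemma ProxSubgrad.norm_sub_le_of_contact {K C r : ℝ} {w : E → ℝ} {z q z' q' : E}
    (h : ProxSubgrad K w z q) (h' : ProxSubgrad K w z' q') (hK : 0 ≤ K)
    (hc : ∀ k, ‖k‖ < r → w (z + k) ≤ w z + ⟪q, k⟫ + C * ‖k‖ ^ 2)
    (h0 : 0 < ‖z' - z‖) (hr : 2 * ‖z' - z‖ < r) :
    ‖q' - q‖ ≤ (4 * C + 5 * K) * ‖z' - z‖ := by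
  set s := ‖z' - z‖ with hs
  rcases (norm_nonneg (q' - q)).eq_or_lt with hd | hd
  · by_contra hcon
    rw [← hd] at hcon
    push Not at hcon
    have hk : ‖z' - z‖ < r := by linarith
    have h1 := hc (z' - z) hk
    have h2 := h z'
    rw [add_sub_cancel] at h1
    have : 0 < s ^ 2 := by positivity
    nlinarith
  set k : E := (2 * s / ‖q' - q‖) • (q' - q) with hkdef
  have hk : ‖k‖ = 2 * s := by
    rw [hkdef, norm_smul, Real.norm_of_nonneg (by positivity)]; field_simp
  have h1 := hc k (by rw [hk]; exact hr)
  have h2 := h' (z + k)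
  have h3 := h z'
  have e1 : z + k - z' = k - (z' - z) := by abel
  rw [e1] at h2
  have h4 : ‖k - (z' - z)‖ ≤ 3 * s := by
    calc _ ≤ ‖k‖ + ‖z' - z‖ := _root_.norm_sub_le _ _
      _ = 3 * s := by rw [hk, ← hs]; ring
  have h5 : K / 2 * ‖k - (z' - z)‖ ^ 2 ≤ K / 2 * (3 * s) ^ 2 := by gcongr
  have e2 : ⟪q', k⟫ - ⟪q, k⟫ = 2 * s * ‖q' - q‖ := by
    rw [← inner_sub_left, hkdef, real_inner_smul_right, real_inner_self_eq_norm_sq]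
    field_simp
  have e3 : ⟪q', z' - z⟫ - ⟪q, z' - z⟫ ≤ ‖q' - q‖ * s := by
    rw [← inner_sub_left]; exact real_inner_le_norm _ _
  rw [inner_sub_right] at h2
  rw [hk] at h1
  rw [← hs] at h3
  have h6 : ‖q' - q‖ * s ≤ (4 * C + 5 * K) * s * s := by nlinarith
  exact le_of_mul_le_mul_right h6 h0

lemma ProxSubgrad.exists_expansion [FiniteDimensional ℝ E] {K C r : ℝ} {w : E → ℝ} {z q : E}
    {D : Set E} {g : E → E} (hK : 0 ≤ K) (hr : 0 < r)
    (hw : ∀ z, ∃ q, ProxSubgrad K w z q)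
    (hg : ∀ z q, ProxSubgrad K w z q → q + (K + 1) • z ∈ D ∧ g (q + (K + 1) • z) = z)
    (h : ProxSubgrad K w z q)
    (hc : ∀ k, ‖k‖ < r → w (z + k) ≤ w z + ⟪q, k⟫ + C * ‖k‖ ^ 2)
    (hd : DifferentiableWithinAt ℝ g D (q + (K + 1) • z)) :
    ∃ M : E →L[ℝ] E, ∀ τ > 0, ∃ δ > 0, ∀ z' q', ProxSubgrad K w z' q' →
      0 < ‖z' - z‖ → ‖z' - z‖ < δ → ‖q' - q - M (z' - z)‖ ≤ τ * ‖z' - z‖ := by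
  obtain ⟨L, hL⟩ := hd
  set y₀ := q + (K + 1) • z with hy₀
  set B := 4 * |C| + 5 * K + (K + 1) with hB
  have hB0 : 0 < B := by positivity
  have hyB : ∀ z' q', ProxSubgrad K w z' q' → 0 < ‖z' - z‖ → 2 * ‖z' - z‖ < r →
      ‖(q' + (K + 1) • z') - y₀‖ ≤ B * ‖z' - z‖ := by
    intro z' q' h' h0 h1
    have h2 := h.norm_sub_le_of_contact h' hK hc h0 h1
    have e : (q' + (K + 1) • z') - y₀ = q' - q + (K + 1) • (z' - z) := by
      rw [hy₀, smul_sub]; abel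
    rw [e]
    calc _ ≤ ‖q' - q‖ + ‖(K + 1) • (z' - z)‖ := norm_add_le _ _
      _ ≤ (4 * C + 5 * K) * ‖z' - z‖ + (K + 1) * ‖z' - z‖ := by
        rw [norm_smul, Real.norm_of_nonneg (by positivity)]; gcongr
      _ ≤ (4 * |C| + 5 * K) * ‖z' - z‖ + (K + 1) * ‖z' - z‖ := by
        gcongr; exact le_abs_self C
      _ = _ := by ring
  have hexp : ∀ c > 0, ∃ δ > 0, ∀ z' q', ProxSubgrad K w z' q' → 0 < ‖z' - z‖ →
      ‖z' - z‖ < δ → ‖z' - z - L ((q' + (K + 1) • z') - y₀)‖ ≤ c * ‖z' - z‖ := by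
    intro c hcpos
    have h1 := (hasFDerivWithinAt_iff_isLittleO.1 hL).def (c := c / B) (by positivity)
    rw [(Metric.nhdsWithin_basis_ball).eventually_iff] at h1
    obtain ⟨ρ, hρ, h1⟩ := h1
    refine ⟨min (r / 2) (ρ / B), by positivity, fun z' q' h' h0 hlt => ?_⟩
    have h2 := hyB z' q' h' h0 (by have := hlt.trans_le (min_le_left _ _); linarith)
    obtain ⟨hD, hgz⟩ := hg z' q' h'
    have h3 : ‖z' - z‖ * B < ρ := (lt_div_iff₀ hB0).1 (hlt.trans_le (min_le_right _ _))
    have h4 := h1 (x := q' + (K + 1) • z') ⟨by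
      rw [mem_ball, dist_eq_norm]; linarith, hD⟩
    rw [hgz, (hg z q h).2] at h4
    calc _ ≤ c / B * ‖q' + (K + 1) • z' - y₀‖ := h4
      _ ≤ c / B * (B * ‖z' - z‖) := by gcongr
      _ = _ := by field_simp
  have hsurj : Function.Surjective L := by
    by_contra hns
    have h1 : LinearMap.range (L : E →ₗ[ℝ] E) ≠ ⊤ := fun h => hns (LinearMap.range_eq_top.1 h)
    have h2 : (LinearMap.range (L : E →ₗ[ℝ] E))ᗮ ≠ ⊥ := fun h =>
      h1 ((Submodule.orthogonal_eq_bot_iff).1 h)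
    obtain ⟨v, hv, hv0⟩ := (Submodule.ne_bot_iff _).1 h2
    obtain ⟨δ, hδ, h3⟩ := hexp (1 / 2) (by norm_num)
    have hvn : 0 < ‖v‖ := norm_pos_iff.2 hv0
    set t := δ / (2 * ‖v‖) with ht
    have ht0 : 0 < t := by positivity
    obtain ⟨q', hq'⟩ := hw (z + t • v)
    have e1 : ‖t • v‖ = δ / 2 := by
      rw [norm_smul, Real.norm_of_nonneg ht0.le, ht]; field_simp
    have h4 := h3 _ _ hq' (by rw [add_sub_cancel_left, e1]; positivity)
      (by rw [add_sub_cancel_left, e1]; linarith)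
    rw [add_sub_cancel_left, e1] at h4
    set y := L (q' + (K + 1) • (z + t • v) - y₀)
    have h5 : ⟪y, t • v⟫ = 0 := by
      rw [real_inner_smul_right, (Submodule.mem_orthogonal _ v).1 hv y ⟨_, rfl⟩, mul_zero]
    have h6 : ⟪t • v - y, t • v⟫ = (δ / 2) ^ 2 := by
      rw [inner_sub_left, h5, real_inner_self_eq_norm_sq, e1, sub_zero]
    have h7 := real_inner_le_norm (t • v - y) (t • v)
    rw [h6, e1] at h7
    nlinarith
  have hinj : Function.Injective L :=
    (LinearMap.injective_iff_surjective (f := (L : E →ₗ[ℝ] E))).2 hsurj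
  set Li : E →L[ℝ] E :=
    ((LinearEquiv.ofBijective (L : E →ₗ[ℝ] E) ⟨hinj, hsurj⟩).symm : E →ₗ[ℝ] E).toContinuousLinearMap
  have hLi : ∀ x, Li (L x) = x := fun x =>
    (LinearEquiv.ofBijective (L : E →ₗ[ℝ] E) ⟨hinj, hsurj⟩).symm_apply_apply x
  refine ⟨Li - (K + 1) • ContinuousLinearMap.id ℝ E, fun τ hτ => ?_⟩
  obtain ⟨δ, hδ, h1⟩ := hexp (τ / (‖Li‖ + 1)) (by positivity)
  refine ⟨δ, hδ, fun z' q' h' h0 hlt => ?_⟩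
  have h2 := h1 z' q' h' h0 hlt
  have e : q' - q - (Li - (K + 1) • ContinuousLinearMap.id ℝ E) (z' - z)
      = -Li (z' - z - L ((q' + (K + 1) • z') - y₀)) := by
    rw [map_sub Li (z' - z), hLi]
    simp only [_root_.sub_apply, _root_.smul_apply,
      ContinuousLinearMap.id_apply, hy₀, smul_sub]
    abel
  rw [e, norm_neg]
  calc _ ≤ ‖Li‖ * ‖z' - z - L ((q' + (K + 1) • z') - y₀)‖ := Li.le_opNorm _
    _ ≤ (‖Li‖ + 1) * (τ / (‖Li‖ + 1) * ‖z' - z‖) := by gcongr; linarith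
    _ = _ := by field_simp

lemma abs_sub_le_of_increments {γ : ℝ → ℝ} {A B : ℝ}
    (h : ∀ s t, 0 ≤ s → s ≤ t → t ≤ 1 → |γ t - γ s| ≤ A * (t - s) + B * (t - s) ^ 2) :
    |γ 1 - γ 0| ≤ A := by
  have key : ∀ N : ℕ, 0 < N → |γ 1 - γ 0| ≤ A + B / N := by
    intro N hN
    have hN' : (0 : ℝ) < N := by exact_mod_cast hN
    have ind : ∀ k : ℕ, k ≤ N → |γ (k / N) - γ 0| ≤ k * (A / N + B / N ^ 2) := by
      intro k
      induction k with
      | zero => intro _; simp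
      | succ k ih =>
        intro hk
        have hk' : ((k + 1 : ℕ) : ℝ) ≤ N := by exact_mod_cast hk
        have h1 := h (k / N) ((k + 1 : ℕ) / N) (by positivity) (by gcongr; simp)
          ((div_le_one hN').2 hk')
        have h2 := ih (by omega)
        have e : ((k + 1 : ℕ) : ℝ) / N - k / N = 1 / N := by push_cast; ring
        rw [e] at h1
        calc _ ≤ |γ ((k + 1 : ℕ) / N) - γ (k / N)| + |γ (k / N) - γ 0| := abs_sub_le _ _ _
          _ ≤ (A * (1 / N) + B * (1 / N) ^ 2) + k * (A / N + B / N ^ 2) := add_le_add h1 h2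
          _ = _ := by push_cast; ring
    have h1 := ind N le_rfl
    rw [div_self hN'.ne'] at h1
    calc _ ≤ _ := h1
      _ = _ := by field_simp
  have hlim : Filter.Tendsto (fun N : ℕ => A + B / N) Filter.atTop (nhds (A + 0)) :=
    tendsto_const_nhds.add (tendsto_const_div_atTop_nhds_zero_nat B)
  rw [add_zero] at hlim
  exact ge_of_tendsto hlim ((Filter.eventually_gt_atTop 0).mono key)

/-- Second order expansion of `w` at `z` with linear part `q` and Hessian `M`. -/
def HasTaylor₂ (w : E → ℝ) (z q : E) (M : E →L[ℝ] E) : Prop :=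
  ∀ τ > 0, ∃ δ > 0, ∀ h, ‖h‖ < δ →
    |w (z + h) - w z - ⟪q, h⟫ - 1 / 2 * ⟪M h, h⟫| ≤ τ * ‖h‖ ^ 2

lemma ProxSubgrad.hasTaylor₂ {K : ℝ} {w : E → ℝ} {z q : E} {M : E →L[ℝ] E}
    (hw : ∀ z, ∃ q, ProxSubgrad K w z q) (h : ProxSubgrad K w z q)
    (hM : ∀ τ > 0, ∃ δ > 0, ∀ z' q', ProxSubgrad K w z' q' →
      0 < ‖z' - z‖ → ‖z' - z‖ < δ → ‖q' - q - M (z' - z)‖ ≤ τ * ‖z' - z‖) :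
    HasTaylor₂ w z q M := by
  intro τ hτ
  obtain ⟨δ, hδ, hM⟩ := hM τ hτ
  refine ⟨δ, hδ, fun k hk => ?_⟩
  set m := ⟪M k, k⟫ with hm
  have hsel : ∀ t : ℝ, 0 ≤ t → t ≤ 1 → ∃ p, ProxSubgrad K w (z + t • k) p ∧
      |⟪p, k⟫ - ⟪q, k⟫ - t * m| ≤ τ * ‖k‖ ^ 2 := by
    intro t ht0 ht1
    by_cases h0 : t • k = 0
    · refine ⟨q, by simpa [h0] using h, ?_⟩
      have : t * m = 0 := by
        rcases smul_eq_zero.1 h0 with h0 | h0 <;> simp [hm, h0]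
      rw [this]; simp; positivity
    · obtain ⟨p, hp⟩ := hw (z + t • k)
      refine ⟨p, hp, ?_⟩
      have hn : ‖t • k‖ ≤ ‖k‖ := by
        rw [norm_smul, Real.norm_of_nonneg ht0]
        exact mul_le_of_le_one_left (norm_nonneg _) ht1
      have h1 := hM _ _ hp (by rw [add_sub_cancel_left]; exact norm_pos_iff.2 h0)
        (by rw [add_sub_cancel_left]; exact hn.trans_lt hk)
      rw [add_sub_cancel_left] at h1
      have e : ⟪p, k⟫ - ⟪q, k⟫ - t * m = ⟪p - q - M (t • k), k⟫ := by
        rw [inner_sub_left, inner_sub_left, map_smul, real_inner_smul_left]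
      rw [e]
      calc _ ≤ ‖p - q - M (t • k)‖ * ‖k‖ := abs_real_inner_le_norm _ _
        _ ≤ τ * ‖k‖ * ‖k‖ := by
          gcongr; exact h1.trans (by gcongr)
        _ = _ := by ring
  set γ : ℝ → ℝ := fun t => w (z + t • k) - t * ⟪q, k⟫ - t ^ 2 / 2 * m with hγ
  have hinc : ∀ s t, 0 ≤ s → s ≤ t → t ≤ 1 → |γ t - γ s| ≤
      (τ * ‖k‖ ^ 2) * (t - s) + (|m| / 2 + |K| / 2 * ‖k‖ ^ 2) * (t - s) ^ 2 := by
    intro s t hs hst ht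
    obtain ⟨p, hp, hpb⟩ := hsel t (hs.trans hst) ht
    obtain ⟨p', hp', hpb'⟩ := hsel s hs (hst.trans ht)
    have h1 := hp (z + s • k)
    have h2 := hp' (z + t • k)
    have e1 : z + s • k - (z + t • k) = (s - t) • k := by rw [sub_smul]; abel
    have e2 : z + t • k - (z + s • k) = (t - s) • k := by rw [sub_smul]; abel
    rw [e1, real_inner_smul_right, norm_smul, mul_pow, Real.norm_eq_abs, sq_abs] at h1
    rw [e2, real_inner_smul_right, norm_smul, mul_pow, Real.norm_eq_abs, sq_abs] at h2
    have hKa : K / 2 * ((t - s) ^ 2 * ‖k‖ ^ 2) ≤ |K| / 2 * ((t - s) ^ 2 * ‖k‖ ^ 2) := by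
      gcongr; exact le_abs_self K
    have hm1 : m * (t - s) ^ 2 ≤ |m| * (t - s) ^ 2 := by gcongr; exact le_abs_self m
    have hm2 : -m * (t - s) ^ 2 ≤ |m| * (t - s) ^ 2 := by gcongr; exact neg_le_abs m
    have hts : 0 ≤ t - s := sub_nonneg.2 hst
    have hb1 := mul_le_mul_of_nonneg_right (abs_le.1 hpb).2 hts
    have hb2 := mul_le_mul_of_nonneg_right (abs_le.1 hpb').1 hts
    rw [abs_le]
    simp only [hγ]
    constructor
    · nlinarith
    · nlinarith
  have h1 := abs_sub_le_of_increments hinc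
  simp only [hγ, one_smul, zero_smul, add_zero] at h1
  convert h1 using 2
  ring

/-- Jensen's lemma combined with Alexandrov's theorem: near a local maximum, a semiconvex function
is touched from above by paraboloids of small opening and slope at a point where it has a second
order expansion. -/
theorem exists_hasTaylor₂_of_isLocalMax [FiniteDimensional ℝ E] {K : ℝ} {w : E → ℝ}
    (hK : 0 ≤ K) (hw : ∀ z, ∃ q, ProxSubgrad K w z q) (hcont : Continuous w) {z₀ : E}
    (hmax : IsLocalMax w z₀) {η : ℝ} (hη : 0 < η) :
    ∃ z p, ∃ M : E →L[ℝ] E, ‖z - z₀‖ < η ∧ ‖p‖ < η ∧ HasTaylor₂ w z p M ∧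
      ∃ δ > 0, ∀ h, ‖h‖ < δ → w (z + h) ≤ w z + ⟪p, h⟫ + η * ‖h‖ ^ 2 := by
  obtain ⟨r₀, hr₀, hmax⟩ := Metric.eventually_nhds_iff.1 hmax
  obtain ⟨r, hr, hrr₀, hrη, hr4⟩ : ∃ r > 0, r < r₀ ∧ r < η ∧ r ≤ 1 / 4 :=
    ⟨min (r₀ / 2) (min (η / 2) (1 / 4)), by positivity,
      (min_le_left _ _).trans_lt (by linarith),
      ((min_le_right _ _).trans (min_le_left _ _)).trans_lt (by linarith),
      (min_le_right _ _).trans (min_le_right _ _)⟩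
  have hcontact : ∀ p : E, ‖p‖ < η * r → ∃ z, ‖z - z₀‖ < r ∧ ∀ k, ‖k‖ < r - ‖z - z₀‖ →
      w (z + k) ≤ w z + ⟪p + (2 * η) • (z - z₀), k⟫ + η * ‖k‖ ^ 2 := by
    intro p hp
    set G : E → ℝ := fun z => w z - η * ‖z - z₀‖ ^ 2 - ⟪p, z - z₀⟫ with hG
    have hGc : Continuous G := by fun_prop
    obtain ⟨z, hzmem, hz⟩ := (isCompact_closedBall z₀ r).exists_isMaxOn
      ⟨z₀, mem_closedBall_self hr.le⟩ hGc.continuousOn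
    have hzr : ‖z - z₀‖ ≤ r := by rwa [mem_closedBall, dist_eq_norm] at hzmem
    have h1 : G z₀ ≤ G z := hz (mem_closedBall_self hr.le)
    have h2 : w z ≤ w z₀ := hmax (by rw [dist_eq_norm]; linarith)
    simp only [hG, sub_self, norm_zero, inner_zero_right] at h1
    have h3 := (abs_le.1 (abs_real_inner_le_norm p (z - z₀))).1
    have hlt : ‖z - z₀‖ < r := by
      refine lt_of_le_of_ne hzr fun he => ?_
      rw [he] at h1 h3
      nlinarith
    refine ⟨z, hlt, fun k hk => ?_⟩
    have h4 : G (z + k) ≤ G z := hz (by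
      rw [mem_closedBall, dist_eq_norm]
      have e : z + k - z₀ = (z - z₀) + k := by abel
      rw [e]
      linarith [norm_add_le (z - z₀) k])
    simp only [hG] at h4
    have e : z + k - z₀ = (z - z₀) + k := by abel
    rw [e, norm_add_sq_real, inner_add_right] at h4
    rw [inner_add_left, real_inner_smul_left]
    linarith
  set D : Set E := {y | ∃ z q, ProxSubgrad K w z q ∧ y = q + (K + 1) • z} with hD
  have hex : ∀ y : E, ∃ z, y ∈ D → ∃ q, ProxSubgrad K w z q ∧ y = q + (K + 1) • z := by
    intro y
    by_cases hy : y ∈ D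
    · obtain ⟨z, q, h⟩ := hy
      exact ⟨z, fun _ => ⟨q, h⟩⟩
    · exact ⟨0, fun h => absurd h hy⟩
  choose g hg using hex
  have hglip : LipschitzOnWith 1 g D := by
    refine LipschitzOnWith.of_dist_le_mul fun y hy y' hy' => ?_
    obtain ⟨q, hq, e⟩ := hg y hy
    obtain ⟨q', hq', e'⟩ := hg y' hy'
    rw [dist_eq_norm, dist_eq_norm, NNReal.coe_one, one_mul]
    have := hq'.norm_sub_le hq
    rwa [← e, ← e'] at this
  have hgD : ∀ z q, ProxSubgrad K w z q → q + (K + 1) • z ∈ D ∧ g (q + (K + 1) • z) = z := by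
    intro z q h
    have hmem : q + (K + 1) • z ∈ D := ⟨z, q, h, rfl⟩
    refine ⟨hmem, ?_⟩
    obtain ⟨q', hq', e⟩ := hg _ hmem
    have := h.norm_sub_le hq'
    rw [← e, sub_self, norm_zero] at this
    exact sub_eq_zero.1 (norm_le_zero_iff.1 this)
  obtain ⟨p, hp, z, hz, hzc, q, hq, hdiff⟩ : ∃ p : E, ‖p‖ < min (η * r) (η / 2) ∧
      ∃ z, ‖z - z₀‖ < r ∧ (∀ k, ‖k‖ < r - ‖z - z₀‖ →
        w (z + k) ≤ w z + ⟪p + (2 * η) • (z - z₀), k⟫ + η * ‖k‖ ^ 2) ∧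
      ∃ q, ProxSubgrad K w z q ∧ DifferentiableWithinAt ℝ g D (q + (K + 1) • z) := by
    by_contra hcon
    push Not at hcon
    borelize E
    set d := Module.finrank ℝ E
    set N : Set E := {y | ¬ (y ∈ D → DifferentiableWithinAt ℝ g D y)} with hN
    have hNnull : Measure.hausdorffMeasure (d : ℝ) N = 0 :=
      hglip.ae_differentiableWithinAt_of_mem (μ := Measure.hausdorffMeasure (d : ℝ))
    have hND : N ⊆ D := fun y hy => by
      simp only [hN, mem_ofPred_eq, Classical.not_imp] at hy; exact hy.1
    set T : E → E := fun y => y - (K + 1) • g y - (2 * η) • (g y - z₀) with hT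
    have hTlip : LipschitzOnWith (Real.toNNReal (1 + (K + 1) + 2 * η)) T N := by
      refine LipschitzOnWith.of_dist_le_mul fun y hy y' hy' => ?_
      have h1 := (hglip.mono hND).dist_le_mul y hy y' hy'
      rw [Real.coe_toNNReal _ (by positivity)]
      rw [NNReal.coe_one, one_mul, dist_eq_norm, dist_eq_norm] at h1
      rw [dist_eq_norm, dist_eq_norm]
      have e : T y - T y' = (y - y') - (K + 1) • (g y - g y') - (2 * η) • (g y - g y') := by
        simp only [hT, smul_sub]; abel
      rw [e]
      calc _ ≤ ‖y - y'‖ + ‖(K + 1) • (g y - g y')‖ + ‖(2 * η) • (g y - g y')‖ :=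
            (_root_.norm_sub_le _ _).trans (by gcongr; exact _root_.norm_sub_le _ _)
        _ = ‖y - y'‖ + (K + 1) * ‖g y - g y'‖ + (2 * η) * ‖g y - g y'‖ := by
            rw [norm_smul, norm_smul, Real.norm_of_nonneg (by positivity),
              Real.norm_of_nonneg (by positivity)]
        _ ≤ ‖y - y'‖ + (K + 1) * ‖y - y'‖ + (2 * η) * ‖y - y'‖ := by gcongr
        _ = _ := by ring
    have hTnull : Measure.hausdorffMeasure (d : ℝ) (T '' N) = 0 := by
      have := hTlip.hausdorffMeasure_image_le (d := d) (by positivity)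
      rw [hNnull, mul_zero] at this
      exact le_antisymm this bot_le
    have hsub : ball (0 : E) (min (η * r) (η / 2)) ⊆ T '' N := by
      intro p hp
      rw [mem_ball_zero_iff] at hp
      obtain ⟨z, hz, hzc⟩ := hcontact p (hp.trans_le (min_le_left _ _))
      obtain ⟨q, hq⟩ := hw z
      have hnd := hcon p hp z hz hzc q hq
      have hqe := hq.eq_of_contact (sub_pos.2 hz) hzc
      obtain ⟨hmem, hgz⟩ := hgD z q hq
      refine ⟨q + (K + 1) • z, by simp only [hN, mem_ofPred_eq, Classical.not_imp]; exact ⟨hmem, hnd⟩,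
        ?_⟩
      simp only [hT, hgz]
      rw [hqe]
      abel
    have hpos : 0 < Measure.hausdorffMeasure (d : ℝ) (ball (0 : E) (min (η * r) (η / 2))) :=
      measure_ball_pos _ _ (by positivity)
    exact (hpos.trans_le ((measure_mono hsub).trans hTnull.le)).ne rfl
  have hqe := hq.eq_of_contact (sub_pos.2 hz) hzc
  rw [← hqe] at hzc
  obtain ⟨M, hM⟩ := hq.exists_expansion hK (sub_pos.2 hz) hw hgD hzc hdiff
  refine ⟨z, q, M, hz.trans hrη, ?_, hq.hasTaylor₂ hw hM, r - ‖z - z₀‖, sub_pos.2 hz, hzc⟩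
  rw [hqe]
  calc _ ≤ ‖p‖ + ‖(2 * η) • (z - z₀)‖ := norm_add_le _ _
    _ = ‖p‖ + 2 * η * ‖z - z₀‖ := by rw [norm_smul, Real.norm_of_nonneg (by positivity)]
    _ ≤ ‖p‖ + 2 * η * (1 / 4) := by gcongr; linarith
    _ < η / 2 + 2 * η * (1 / 4) := by gcongr; exact hp.trans_le (min_le_right _ _)
    _ = η := by ring

lemma exists_supConvolution {K : Set E} (hK : IsCompact K) (hKne : K.Nonempty) {u : E → ℝ}
    (hu : ContinuousOn u K) {a : ℝ} (ha : 0 ≤ a) :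
    ∃ (A : E → ℝ) (ζ : E → E), Continuous A ∧ (∀ x, ζ x ∈ K) ∧
      (∀ x, A x = u (ζ x) - a * ‖x - ζ x‖ ^ 2) ∧
      (∀ x, ∀ z ∈ K, u z - a * ‖x - z‖ ^ 2 ≤ A x) ∧
      ∀ x, ProxSubgrad (2 * a) A x ((2 * a) • (ζ x - x)) := by
  have hex : ∀ x : E, ∃ z ∈ K, ∀ z' ∈ K, u z' - a * ‖x - z'‖ ^ 2 ≤ u z - a * ‖x - z‖ ^ 2 := by
    intro x
    exact hK.exists_isMaxOn (f := fun z => u z - a * ‖x - z‖ ^ 2) hKne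
      (hu.sub (Continuous.continuousOn (by fun_prop)))
  choose ζ hζ hmax using hex
  set A : E → ℝ := fun x => u (ζ x) - a * ‖x - ζ x‖ ^ 2 with hA
  have hprox : ∀ x, ProxSubgrad (2 * a) A x ((2 * a) • (ζ x - x)) := by
    intro x x'
    refine le_trans (le_of_eq ?_) (hmax x' (ζ x) (hζ x))
    have e : x' - ζ x = (x' - x) - (ζ x - x) := by abel
    rw [e, norm_sub_sq_real (x' - x) (ζ x - x), real_inner_smul_left, real_inner_comm]
    simp only [hA]
    rw [norm_sub_rev x (ζ x)]
    ring
  refine ⟨A, ζ, ?_, hζ, fun _ => rfl, hmax, hprox⟩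
  obtain ⟨R, hR⟩ := hK.isBounded.exists_norm_le
  have hone : ∀ x x' : E, A x - A x' ≤ 2 * a * (R + ‖x‖) * ‖x' - x‖ + a * ‖x' - x‖ ^ 2 := by
    intro x x'
    have h1 := hprox x x'
    have h2 : -⟪(2 * a) • (ζ x - x), x' - x⟫ ≤ 2 * a * (R + ‖x‖) * ‖x' - x‖ := by
      calc _ ≤ |⟪(2 * a) • (ζ x - x), x' - x⟫| := neg_le_abs _
        _ ≤ ‖(2 * a) • (ζ x - x)‖ * ‖x' - x‖ := abs_real_inner_le_norm _ _
        _ ≤ _ := by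
          rw [norm_smul, Real.norm_of_nonneg (by positivity)]
          gcongr
          exact (_root_.norm_sub_le _ _).trans (by gcongr; exact hR _ (hζ x))
    linarith
  refine continuous_iff_continuousAt.2 fun x => ?_
  rw [ContinuousAt, tendsto_iff_norm_sub_tendsto_zero]
  set b : E → ℝ := fun x' => 2 * a * (R + (‖x‖ + ‖x'‖)) * ‖x' - x‖ + a * ‖x' - x‖ ^ 2 with hb
  have hbc : Continuous b := by fun_prop
  have hb0 : Filter.Tendsto b (nhds x) (nhds 0) := by
    have := hbc.tendsto x
    simpa [hb] using this
  refine squeeze_zero (fun _ => norm_nonneg _) (fun x' => ?_) hb0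
  rw [Real.norm_eq_abs, abs_sub_le_iff]
  have h1 := hone x x'
  have h2 := hone x' x
  rw [norm_sub_rev x x'] at h2
  have h3 : 2 * a * (R + ‖x‖) * ‖x' - x‖ ≤ 2 * a * (R + (‖x‖ + ‖x'‖)) * ‖x' - x‖ := by
    gcongr; linarith [norm_nonneg x']
  have h4 : 2 * a * (R + ‖x'‖) * ‖x' - x‖ ≤ 2 * a * (R + (‖x‖ + ‖x'‖)) * ‖x' - x‖ := by
    gcongr; linarith [norm_nonneg x]
  simp only [hb]
  constructor <;> linarith

set_option maxHeartbeats 1000000 in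
/-- Theorem on sums for semiconvex functions. -/
theorem exists_hasTaylor₂_of_isLocalMax_sum [FiniteDimensional ℝ E] {a : ℝ} (ha : 0 ≤ a)
    {A B : E → ℝ} (hAc : Continuous A) (hBc : Continuous B)
    (hA : ∀ x, ∃ q, ProxSubgrad a A x q) (hB : ∀ x, ∃ q, ProxSubgrad a B x q)
    {S : WithLp 2 (E × E) →L[ℝ] WithLp 2 (E × E)} (hS : ∀ v w, ⟪S v, w⟫ = ⟪v, S w⟫)
    {b z₀ : WithLp 2 (E × E)}
    (hmax : IsLocalMax (fun z : WithLp 2 (E × E) => A z.fst + B z.snd - ⟪b, z - z₀⟫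
      - 1 / 2 * ⟪S (z - z₀), z - z₀⟫) z₀) {η : ℝ} (hη : 0 < η) :
    ∃ x y p₁ p₂, ∃ T₁ T₂ : E →L[ℝ] E, ‖x - z₀.fst‖ < η ∧ ‖y - z₀.snd‖ < η ∧
      ‖p₁ - b.fst‖ < η ∧ ‖p₂ - b.snd‖ < η ∧ HasTaylor₂ A x p₁ T₁ ∧ HasTaylor₂ B y p₂ T₂ ∧
      ∀ h k, ⟪T₁ h, h⟫ + ⟪T₂ k, k⟫ ≤
        ⟪S (WithLp.toLp 2 (h, k)), WithLp.toLp 2 (h, k)⟫ + η * (‖h‖ ^ 2 + ‖k‖ ^ 2) := by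
  set w : WithLp 2 (E × E) → ℝ := fun z => A z.fst + B z.snd - ⟪b, z - z₀⟫
      - 1 / 2 * ⟪S (z - z₀), z - z₀⟫ with hw
  have hexpand : ∀ z v, w (z + v) - w z = (A (z.fst + v.fst) - A z.fst) +
      (B (z.snd + v.snd) - B z.snd) - ⟪b + S (z - z₀), v⟫ - 1 / 2 * ⟪S v, v⟫ := by
    intro z v
    have e : z + v - z₀ = (z - z₀) + v := by abel
    have e2 : ⟪S v, z - z₀⟫ = ⟪S (z - z₀), v⟫ := by rw [hS, real_inner_comm]
    simp only [hw, e, map_add, inner_add_left, inner_add_right, e2, WithLp.add_fst, WithLp.add_snd]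
    ring
  have hnsq : ∀ v : WithLp 2 (E × E), ‖v‖ ^ 2 = ‖v.fst‖ ^ 2 + ‖v.snd‖ ^ 2 := fun v =>
    WithLp.prod_norm_sq_eq_of_L2 v
  have hfst : ∀ v : WithLp 2 (E × E), ‖v.fst‖ ≤ ‖v‖ := fun v =>
    abs_le_of_sq_le_sq' (by rw [hnsq]; nlinarith [sq_nonneg ‖v.snd‖]) (norm_nonneg _) |>.2
  have hsnd : ∀ v : WithLp 2 (E × E), ‖v.snd‖ ≤ ‖v‖ := fun v =>
    abs_le_of_sq_le_sq' (by rw [hnsq]; nlinarith [sq_nonneg ‖v.fst‖]) (norm_nonneg _) |>.2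
  have hprox : ∀ z, ∃ q, ProxSubgrad (a + ‖S‖) w z q := by
    intro z
    obtain ⟨q₁, h₁⟩ := hA z.fst
    obtain ⟨q₂, h₂⟩ := hB z.snd
    refine ⟨WithLp.toLp 2 (q₁, q₂) - (b + S (z - z₀)), fun z' => ?_⟩
    have h3 := hexpand z (z' - z)
    have h1 := h₁ z'.fst
    have h2 := h₂ z'.snd
    have h4 : ⟪S (z' - z), z' - z⟫ ≤ ‖S‖ * ‖z' - z‖ ^ 2 := by
      calc _ ≤ ‖S (z' - z)‖ * ‖z' - z‖ := real_inner_le_norm _ _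
        _ ≤ ‖S‖ * ‖z' - z‖ * ‖z' - z‖ := by gcongr; exact S.le_opNorm _
        _ = _ := by ring
    simp only [WithLp.sub_fst, WithLp.sub_snd, add_sub_cancel] at h3
    rw [inner_sub_left, WithLp.prod_inner_apply]
    have h5 : ‖z' - z‖ ^ 2 = ‖z'.fst - z.fst‖ ^ 2 + ‖z'.snd - z.snd‖ ^ 2 := hnsq (z' - z)
    rw [h5] at h4 ⊢
    have e₁ : (z' - z).ofLp.1 = z'.fst - z.fst := rfl
    have e₂ : (z' - z).ofLp.2 = z'.snd - z.snd := rfl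
    rw [e₁, e₂]
    linarith
  have hwc : Continuous w := by
    have h1 : Continuous fun z : WithLp 2 (E × E) => z.fst := (WithLp.fstL 2 ℝ E E).continuous
    have h2 : Continuous fun z : WithLp 2 (E × E) => z.snd := (WithLp.sndL 2 ℝ E E).continuous
    have h3 := hAc.comp h1
    have h4 := hBc.comp h2
    simp only [Function.comp_def] at h3 h4
    fun_prop
  set η' := η / (4 * (1 + ‖S‖)) with hη'
  have hη'0 : 0 < η' := by positivity
  have hη'4 : 4 * η' * (1 + ‖S‖) = η := by rw [hη']; field_simp
  have hSn := norm_nonneg S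
  have hη'S : 0 ≤ η' * ‖S‖ := by positivity
  obtain ⟨z, p, M, hz, hp, hM, δ, hδ, hc⟩ :=
    exists_hasTaylor₂_of_isLocalMax (by positivity) hprox hwc hmax hη'0
  set P := p + (b + S (z - z₀)) with hP
  have hPb : ‖P - b‖ < η := by
    have e : P - b = p + S (z - z₀) := by rw [hP]; abel
    rw [e]
    calc _ ≤ ‖p‖ + ‖S (z - z₀)‖ := norm_add_le _ _
      _ ≤ ‖p‖ + ‖S‖ * ‖z - z₀‖ := by gcongr; exact S.le_opNorm _
      _ ≤ η' + ‖S‖ * η' := by gcongr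
      _ < η := by nlinarith
  set ι := ((WithLp.prodContinuousLinearEquiv 2 ℝ E E).symm : E × E →L[ℝ] WithLp 2 (E × E)) with hι
  set T₁ : E →L[ℝ] E := WithLp.fstL 2 ℝ E E ∘L (M + S) ∘L ι ∘L ContinuousLinearMap.inl ℝ E E
  set T₂ : E →L[ℝ] E := WithLp.sndL 2 ℝ E E ∘L (M + S) ∘L ι ∘L ContinuousLinearMap.inr ℝ E E
  have hT₁ : ∀ h, ⟪T₁ h, h⟫ = ⟪M (WithLp.toLp 2 (h, 0)), WithLp.toLp 2 (h, 0)⟫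
      + ⟪S (WithLp.toLp 2 (h, 0)), WithLp.toLp 2 (h, 0)⟫ := by
    intro h
    rw [← inner_add_left, WithLp.prod_inner_apply]
    simp [T₁, hι]
  have hT₂ : ∀ h, ⟪T₂ h, h⟫ = ⟪M (WithLp.toLp 2 (0, h)), WithLp.toLp 2 (0, h)⟫
      + ⟪S (WithLp.toLp 2 (0, h)), WithLp.toLp 2 (0, h)⟫ := by
    intro h
    rw [← inner_add_left, WithLp.prod_inner_apply]
    simp [T₂, hι]
  have hTA : HasTaylor₂ A z.fst P.fst T₁ := by
    intro τ hτ
    obtain ⟨δ, hδ, h1⟩ := hM τ hτ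
    refine ⟨δ, hδ, fun h hh => ?_⟩
    have hn : ‖WithLp.toLp 2 (h, (0 : E))‖ = ‖h‖ := WithLp.norm_toLp_fst 2 E E h
    have h2 := h1 (WithLp.toLp 2 (h, 0)) (by rwa [hn])
    rw [hn, hexpand] at h2
    have e : ⟪P.fst, h⟫ = ⟪p, WithLp.toLp 2 (h, (0 : E))⟫
        + ⟪b + S (z - z₀), WithLp.toLp 2 (h, (0 : E))⟫ := by
      rw [← inner_add_left, ← hP, WithLp.prod_inner_apply]; simp
    have e₁ : (WithLp.toLp 2 (h, (0 : E))).fst = h := rfl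
    have e₂ : (WithLp.toLp 2 (h, (0 : E))).snd = 0 := rfl
    rw [e₁, e₂, add_zero, sub_self, add_zero] at h2
    rw [hT₁, e]
    refine le_trans (le_of_eq (congrArg _ ?_)) h2
    ring
  have hTB : HasTaylor₂ B z.snd P.snd T₂ := by
    intro τ hτ
    obtain ⟨δ, hδ, h1⟩ := hM τ hτ
    refine ⟨δ, hδ, fun h hh => ?_⟩
    have hn : ‖WithLp.toLp 2 ((0 : E), h)‖ = ‖h‖ := WithLp.norm_toLp_snd 2 E E h
    have h2 := h1 (WithLp.toLp 2 (0, h)) (by rwa [hn])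
    rw [hn, hexpand] at h2
    have e : ⟪P.snd, h⟫ = ⟪p, WithLp.toLp 2 ((0 : E), h)⟫
        + ⟪b + S (z - z₀), WithLp.toLp 2 ((0 : E), h)⟫ := by
      rw [← inner_add_left, ← hP, WithLp.prod_inner_apply]; simp
    have e₁ : (WithLp.toLp 2 ((0 : E), h)).fst = 0 := rfl
    have e₂ : (WithLp.toLp 2 ((0 : E), h)).snd = h := rfl
    rw [e₁, e₂, add_zero, sub_self, zero_add] at h2
    rw [hT₂, e]
    refine le_trans (le_of_eq (congrArg _ ?_)) h2
    ring
  have hη'le : η' < η := by nlinarith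
  refine ⟨z.fst, z.snd, P.fst, P.snd, T₁, T₂, (hfst (z - z₀)).trans_lt (hz.trans hη'le),
    (hsnd (z - z₀)).trans_lt (hz.trans hη'le), (hfst (P - b)).trans_lt hPb,
    (hsnd (P - b)).trans_lt hPb, hTA, hTB, fun h k => ?_⟩
  obtain ⟨δ₁, hδ₁, h1⟩ := hTA η' hη'0
  obtain ⟨δ₂, hδ₂, h2⟩ := hTB η' hη'0
  set v : WithLp 2 (E × E) := WithLp.toLp 2 (h, k) with hv
  obtain ⟨t, ht0, htδ, htδ₁, htδ₂⟩ : ∃ t > 0, t * ‖v‖ < δ ∧ t * ‖v‖ < δ₁ ∧ t * ‖v‖ < δ₂ := by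
    have hρ0 : 0 < min δ (min δ₁ δ₂) := by positivity
    have htv : min δ (min δ₁ δ₂) / (‖v‖ + 1) * ‖v‖ < min δ (min δ₁ δ₂) := by
      rw [div_mul_eq_mul_div, div_lt_iff₀ (by positivity)]; nlinarith
    exact ⟨min δ (min δ₁ δ₂) / (‖v‖ + 1), by positivity, htv.trans_le (min_le_left _ _),
      htv.trans_le ((min_le_right _ _).trans (min_le_left _ _)),
      htv.trans_le ((min_le_right _ _).trans (min_le_right _ _))⟩
  have hnt : ∀ x : E, ‖t • x‖ = t * ‖x‖ := fun x => by
    rw [norm_smul, Real.norm_of_nonneg ht0.le]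
  have hntv : ‖t • v‖ = t * ‖v‖ := by rw [norm_smul, Real.norm_of_nonneg ht0.le]
  have h3 := h1 (t • h) (by
    rw [hnt]
    calc t * ‖h‖ ≤ t * ‖v‖ := by gcongr; exact hfst v
      _ < δ₁ := htδ₁)
  have h4 := h2 (t • k) (by
    rw [hnt]
    calc t * ‖k‖ ≤ t * ‖v‖ := by gcongr; exact hsnd v
      _ < δ₂ := htδ₂)
  have h5 := hc (t • v) (by rwa [hntv])
  have h6 := hexpand z (t • v)
  have e : ⟪P, t • v⟫ = ⟪P.fst, t • h⟫ + ⟪P.snd, t • k⟫ := by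
    rw [WithLp.prod_inner_apply]; rfl
  have e' : ⟪P, t • v⟫ = ⟪p, t • v⟫ + ⟪b + S (z - z₀), t • v⟫ := by rw [hP, inner_add_left]
  have e1 : (t • v).fst = t • h := rfl
  have e2 : (t • v).snd = t • k := rfl
  rw [e1, e2] at h6
  have h3' := (abs_le.1 h3).1
  have h4' := (abs_le.1 h4).1
  have hvn := hnsq v
  have e3 : v.fst = h := rfl
  have e4 : v.snd = k := rfl
  rw [e3, e4] at hvn
  rw [hnt] at h3' h4'
  rw [hntv] at h5
  simp only [map_smul, real_inner_smul_left, real_inner_smul_right] at h3' h4' h5 h6 e e'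
  have hfin : t ^ 2 * (⟪T₁ h, h⟫ + ⟪T₂ k, k⟫) ≤
      t ^ 2 * (⟪S v, v⟫ + 4 * η' * (‖h‖ ^ 2 + ‖k‖ ^ 2)) := by
    have hq : (t * ‖v‖) ^ 2 = t ^ 2 * (‖h‖ ^ 2 + ‖k‖ ^ 2) := by rw [mul_pow, hvn]
    rw [hq] at h5
    linear_combination 2 * h3' + 2 * h4' + 2 * h5 - 2 * h6 + 2 * e - 2 * e'
  have hfin' := le_of_mul_le_mul_left hfin (by positivity)
  refine hfin'.trans ?_
  gcongr
  nlinarith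

end ProxSubgradient

lemma pucciSup_le {n : ℕ} {lam Lam μ N : ℝ} (hlam : 0 ≤ lam) (hle : lam ≤ Lam) (hμ : 0 ≤ μ)
    {D : Matrix (Fin n) (Fin n) ℝ} (hD : D.IsSymm)
    (hDμ : ∀ ξ : Fin n → ℝ, ξ ⬝ᵥ D.mulVec ξ ≤ μ * (ξ ⬝ᵥ ξ))
    {e : Fin n → ℝ} (he : e ⬝ᵥ e = 1) (heN : e ⬝ᵥ D.mulVec e ≤ -N) :
    pucciSup n lam Lam D ≤ μ * (n * Lam) - lam * (N + μ) := by
  have hne : (EllMat n lam Lam).Nonempty := by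
    refine ⟨lam • 1, by simp [Matrix.IsSymm], fun ξ => ?_⟩
    have h0 : 0 ≤ ξ ⬝ᵥ ξ := by simpa using dotProduct_star_self_nonneg ξ
    simp only [Matrix.smul_mulVec, Matrix.one_mulVec, dotProduct_smul, smul_eq_mul]
    exact ⟨le_rfl, mul_le_mul_of_nonneg_right hle h0⟩
  refine csSup_le (hne.image _) ?_
  rintro _ ⟨A, ⟨-, hA⟩, rfl⟩
  have hP : (μ • (1 : Matrix (Fin n) (Fin n) ℝ) - D).PosSemidef := by
    refine PosSemidef.of_dotProduct_mulVec_nonneg ?_ fun ξ => ?_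
    · rw [Matrix.IsHermitian, conjTranspose_eq_transpose_of_trivial, transpose_sub,
        transpose_smul, transpose_one, hD.eq]
    · have := hDμ ξ
      simp only [Matrix.sub_mulVec, Matrix.smul_mulVec, Matrix.one_mulVec, star_trivial,
        dotProduct_sub, dotProduct_smul, smul_eq_mul]
      linarith
  obtain ⟨m, v, hv⟩ := posSemidef_iff_eq_sum_vecMulVec.1 hP
  simp only [star_trivial] at hv
  have htr : (A * (μ • 1 - D)).trace = ∑ k, v k ⬝ᵥ A.mulVec (v k) := by
    rw [hv, Matrix.mul_sum, trace_sum]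
    refine Finset.sum_congr rfl fun k _ => ?_
    rw [mul_vecMulVec, trace_vecMulVec, dotProduct_comm]
  have h1 : lam * ∑ k, v k ⬝ᵥ v k ≤ (A * (μ • 1 - D)).trace := by
    rw [htr, Finset.mul_sum]
    exact Finset.sum_le_sum fun k _ => (hA (v k)).1
  have h2 : e ⬝ᵥ (μ • (1 : Matrix (Fin n) (Fin n) ℝ) - D).mulVec e ≤ ∑ k, v k ⬝ᵥ v k := by
    rw [hv, sum_mulVec, dotProduct_sum]
    refine Finset.sum_le_sum fun k _ => ?_
    have h := Finset.sum_mul_sq_le_sq_mul_sq Finset.univ (v k) e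
    simp only [dotProduct, ← sq] at he
    rw [he, mul_one] at h
    rw [vecMulVec_mulVec, dotProduct_smul, dotProduct_comm e, op_smul_eq_mul, ← sq]
    simpa only [dotProduct, ← sq] using h
  have h3 : e ⬝ᵥ (μ • (1 : Matrix (Fin n) (Fin n) ℝ) - D).mulVec e
      = μ - e ⬝ᵥ D.mulVec e := by
    simp [Matrix.sub_mulVec, Matrix.smul_mulVec, he]
  have h4 : A.trace ≤ n * Lam := by
    have hi : ∀ i ∈ Finset.univ, A i i ≤ Lam := fun i _ => by
      simpa using (hA (Pi.single i 1)).2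
    simpa [Matrix.trace] using Finset.sum_le_sum hi
  have h5 : (A * (μ • 1 - D)).trace = μ * A.trace - (A * D).trace := by
    simp [mul_sub]
  have h6 := mul_le_mul_of_nonneg_left h4 hμ
  have h7 : lam * (N + μ) ≤ lam * ∑ k, v k ⬝ᵥ v k := by
    gcongr; linarith
  show (A * D).trace ≤ _
  linarith

section TestFunction

variable {n : ℕ}

/-- The matrix of the quadratic form `h ↦ ⟪T h, h⟫`. -/
def symMat (T : Euc n →L[ℝ] Euc n) : Matrix (Fin n) (Fin n) ℝ := fun i j =>
  (⟪T (EuclideanSpace.single i 1), EuclideanSpace.single j 1⟫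
    + ⟪T (EuclideanSpace.single j 1), EuclideanSpace.single i 1⟫) / 2

lemma symMat_isSymm (T : Euc n →L[ℝ] Euc n) : (symMat T).IsSymm := by
  ext i j; simp [symMat, add_comm]

lemma symMat_add (S T : Euc n →L[ℝ] Euc n) : symMat (S + T) = symMat S + symMat T := by
  ext i j; simp [symMat, inner_add_left]; ring

lemma symMat_neg (T : Euc n →L[ℝ] Euc n) : symMat (-T) = -symMat T := by
  ext i j; simp [symMat]; ring

lemma dotProduct_symMat_mulVec (T : Euc n →L[ℝ] Euc n) (ξ : Fin n → ℝ) :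
    ξ ⬝ᵥ (symMat T).mulVec ξ = ⟪T (WithLp.toLp 2 ξ), WithLp.toLp 2 ξ⟫ := by
  have hξ : WithLp.toLp 2 ξ = ∑ i, ξ i • (EuclideanSpace.single i 1 : Euc n) := by
    ext j; simp [Pi.single_apply]
  have h : ⟪T (WithLp.toLp 2 ξ), WithLp.toLp 2 ξ⟫ = ∑ i, ∑ j, ξ i * (ξ j *
      ⟪T (EuclideanSpace.single i 1), EuclideanSpace.single j 1⟫) := by
    simp_rw [hξ, map_sum, sum_inner, inner_sum, map_smul, real_inner_smul_left,
      real_inner_smul_right]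
  have h' := h
  rw [Finset.sum_comm] at h'
  have h2 : ξ ⬝ᵥ (symMat T).mulVec ξ = (⟪T (WithLp.toLp 2 ξ), WithLp.toLp 2 ξ⟫
      + ⟪T (WithLp.toLp 2 ξ), WithLp.toLp 2 ξ⟫) / 2 := by
    nth_rw 1 [h]
    rw [h', ← Finset.sum_add_distrib, Finset.sum_div]
    refine Finset.sum_congr rfl fun i _ => ?_
    rw [← Finset.sum_add_distrib, Finset.sum_div, mulVec, dotProduct, Finset.mul_sum]
    refine Finset.sum_congr rfl fun j _ => ?_
    rw [symMat]; ring
  rw [h2]; ring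

lemma exists_testFunction (P x₀ : Euc n) (T : Euc n →L[ℝ] Euc n) :
    ∃ φ : Euc n → ℝ, (∀ h, φ (x₀ + h) = ⟪P, h⟫ + 1 / 2 * ⟪T h, h⟫) ∧ ContDiff ℝ 2 φ ∧
      gradient φ x₀ = P ∧ hess φ x₀ = symMat T := by
  set Q : Euc n →L[ℝ] Euc n →L[ℝ] ℝ := (innerSL ℝ).comp T with hQ
  set R : Euc n →L[ℝ] Euc n →L[ℝ] ℝ := (1 / 2 : ℝ) • (Q + Q.flip) with hR
  have hRa : ∀ v w, R v w = (⟪T v, w⟫ + ⟪T w, v⟫) / 2 := fun v w => by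
    change (1 / 2 : ℝ) * (⟪T v, w⟫ + ⟪T w, v⟫) = _; ring
  set φ : Euc n → ℝ := fun x => ⟪P, x - x₀⟫ + 1 / 2 * ⟪T (x - x₀), x - x₀⟫ with hφ
  have hd : ∀ x, HasFDerivAt φ (innerSL ℝ P + R (x - x₀)) x := by
    intro x
    have h1 : HasFDerivAt (fun x => x - x₀) (ContinuousLinearMap.id ℝ (Euc n)) x :=
      (hasFDerivAt_id x).sub_const x₀
    have h2 := (innerSL ℝ P).hasFDerivAt.comp x h1
    have h3 := ((T.hasFDerivAt.comp x h1).inner ℝ h1).const_mul (1 / 2 : ℝ)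
    refine (h2.add h3).congr_fderiv ?_
    ext v
    simp [hRa, real_inner_comm, inner_sub_left, inner_sub_right]
    ring
  have hfd : fderiv ℝ φ = fun x => innerSL ℝ P + R (x - x₀) := funext fun x => (hd x).fderiv
  refine ⟨φ, fun h => by simp [hφ], ?_, ?_, ?_⟩
  · have h1 : ContDiff ℝ 2 fun x => x - x₀ := contDiff_id.sub contDiff_const
    exact (contDiff_const.inner ℝ h1).add
      (contDiff_const.mul ((T.contDiff.comp h1).inner ℝ h1))
  · refine HasGradientAt.gradient ?_
    rw [hasGradientAt_iff_hasFDerivAt]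
    refine (hd x₀).congr_fderiv ?_
    ext v; simp
  · ext i j
    have h2 : HasFDerivAt (fun x => innerSL ℝ P + R (x - x₀)) R x₀ := by
      have h1 : HasFDerivAt (fun x => x - x₀) (ContinuousLinearMap.id ℝ (Euc n)) x₀ :=
        (hasFDerivAt_id x₀).sub_const x₀
      exact (R.hasFDerivAt.comp x₀ h1).const_add _
    rw [hess, iteratedFDeriv_two_apply, hfd, h2.fderiv]
    simp [hRa, symMat]

end TestFunction

section QuadraticMajorant

variable {E : Type*} [NormedAddCommGroup E] [InnerProductSpace ℝ E]

lemma norm_add_le_quadratic {d h : E} (hd : d ≠ 0) (hh : ‖h‖ ≤ ‖d‖ / 2) :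
    ‖d + h‖ ≤ ‖d‖ + ⟪‖d‖⁻¹ • d, h⟫ + (‖h‖ ^ 2 - ⟪‖d‖⁻¹ • d, h⟫ ^ 2) / ‖d‖ := by
  have hs : 0 < ‖d‖ := norm_pos_iff.2 hd
  have he : ‖‖d‖⁻¹ • d‖ = 1 := by
    rw [norm_smul, norm_inv, norm_norm, inv_mul_cancel₀ hs.ne']
  have hdh : ⟪d, h⟫ = ‖d‖ * ⟪‖d‖⁻¹ • d, h⟫ := by
    rw [real_inner_smul_left, mul_inv_cancel_left₀ hs.ne']
  have ht : |⟪‖d‖⁻¹ • d, h⟫| ≤ ‖h‖ := by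
    simpa [he] using abs_real_inner_le_norm (‖d‖⁻¹ • d) h
  have hsq : ‖d + h‖ ^ 2 = ‖d‖ ^ 2 + 2 * (‖d‖ * ⟪‖d‖⁻¹ • d, h⟫) + ‖h‖ ^ 2 := by
    rw [norm_add_sq_real, hdh]
  generalize ⟪‖d‖⁻¹ • d, h⟫ = t at *
  have hr : 0 ≤ ‖h‖ ^ 2 - t ^ 2 := by nlinarith [sq_abs t, abs_nonneg t]
  have hst : ‖d‖ / 2 ≤ ‖d‖ + t := by linarith [neg_abs_le t]
  have hq : 0 ≤ (‖h‖ ^ 2 - t ^ 2) / ‖d‖ := by positivity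
  have hqe : (‖h‖ ^ 2 - t ^ 2) / ‖d‖ * ‖d‖ = ‖h‖ ^ 2 - t ^ 2 := div_mul_cancel₀ _ hs.ne'
  refine le_of_sq_le_sq ?_ (by linarith)
  rw [hsq]
  nlinarith [mul_le_mul_of_nonneg_left hst hq]

lemma exists_quadratic_majorant [CompleteSpace E] {L ρ : ℝ} (hL : 0 ≤ L) (x₁ y₁ : E)
    {z₀ : WithLp 2 (E × E)} (hne : z₀.fst ≠ z₀.snd) :
    ∃ (e : E) (S : WithLp 2 (E × E) →L[ℝ] WithLp 2 (E × E)) (b : WithLp 2 (E × E)),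
      ‖e‖ = 1 ∧ (∀ v w, ⟪S v, w⟫ = ⟪v, S w⟫) ∧
      b.fst = (L * (1 - ‖z₀.fst - z₀.snd‖ / 4)) • e + ρ • (z₀.fst - x₁) ∧
      b.snd = -(L * (1 - ‖z₀.fst - z₀.snd‖ / 4)) • e + ρ • (z₀.snd - y₁) ∧
      (∀ k, ⟪S (WithLp.toLp 2 (k, k)), WithLp.toLp 2 (k, k)⟫ = 2 * ρ * ‖k‖ ^ 2) ∧
      ⟪S (WithLp.toLp 2 (e, -e)), WithLp.toLp 2 (e, -e)⟫ = 2 * ρ - L ∧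
      ∀ᶠ z in nhds z₀, L * (‖z.fst - z.snd‖ - ‖z.fst - z.snd‖ ^ 2 / 8)
          + ρ / 2 * (‖z.fst - x₁‖ ^ 2 + ‖z.snd - y₁‖ ^ 2)
        ≤ L * (‖z₀.fst - z₀.snd‖ - ‖z₀.fst - z₀.snd‖ ^ 2 / 8)
          + ρ / 2 * (‖z₀.fst - x₁‖ ^ 2 + ‖z₀.snd - y₁‖ ^ 2)
          + ⟪b, z - z₀⟫ + 1 / 2 * ⟪S (z - z₀), z - z₀⟫ := by
  set d := z₀.fst - z₀.snd with hd
  have hd0 : d ≠ 0 := sub_ne_zero.2 hne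
  have hs : 0 < ‖d‖ := norm_pos_iff.2 hd0
  set e := ‖d‖⁻¹ • d with he
  have he1 : ‖e‖ = 1 := by rw [he, norm_smul, norm_inv, norm_norm, inv_mul_cancel₀ hs.ne']
  have hee : ⟪e, e⟫ = 1 := by rw [real_inner_self_eq_norm_sq, he1, one_pow]
  have hin : ∀ v w : WithLp 2 (E × E), ⟪v, w⟫ = ⟪v.fst, w.fst⟫ + ⟪v.snd, w.snd⟫ :=
    fun v w => WithLp.prod_inner_apply v w
  have hfst : ∀ v w : E, (WithLp.toLp 2 (v, w)).fst = v := fun _ _ => rfl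
  have hsnd : ∀ v w : E, (WithLp.toLp 2 (v, w)).snd = w := fun _ _ => rfl
  set D : WithLp 2 (E × E) →L[ℝ] E := WithLp.fstL 2 ℝ E E - WithLp.sndL 2 ℝ E E with hD
  have hDa : ∀ v, D v = v.fst - v.snd := fun v => rfl
  set Z : E →L[ℝ] E := (L * (2 / ‖d‖ - 1 / 4)) • ContinuousLinearMap.id ℝ E
    - (2 * L / ‖d‖) • (innerSL ℝ e).smulRight e with hZ
  have hZa : ∀ v w, ⟪Z v, w⟫ = L * (2 / ‖d‖ - 1 / 4) * ⟪v, w⟫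
      - 2 * L / ‖d‖ * (⟪e, v⟫ * ⟪e, w⟫) := fun v w => by
    simp [hZ, inner_sub_left, real_inner_smul_left]
  set S : WithLp 2 (E × E) →L[ℝ] WithLp 2 (E × E) :=
    (ContinuousLinearMap.adjoint D).comp (Z.comp D) + ρ • ContinuousLinearMap.id ℝ _ with hS
  have hSa : ∀ v w, ⟪S v, w⟫ = ⟪Z (v.fst - v.snd), w.fst - w.snd⟫ + ρ * ⟪v, w⟫ := fun v w => by
    rw [← hDa, ← hDa, hS, _root_.add_apply, inner_add_left, ContinuousLinearMap.comp_apply,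
      ContinuousLinearMap.adjoint_inner_left, _root_.smul_apply, real_inner_smul_left]
    rfl
  refine ⟨e, S, WithLp.toLp 2 ((L * (1 - ‖d‖ / 4)) • e + ρ • (z₀.fst - x₁),
    -(L * (1 - ‖d‖ / 4)) • e + ρ • (z₀.snd - y₁)), he1, fun v w => ?_, rfl, rfl,
    fun k => ?_, ?_, ?_⟩
  · rw [real_inner_comm (S w) v, hSa, hSa, hZa, hZa, real_inner_comm w v,
      real_inner_comm (w.fst - w.snd)]
    ring
  · rw [hSa, hin]
    simp only [hfst, hsnd, sub_self, map_zero, inner_zero_left, real_inner_self_eq_norm_sq]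
    ring
  · rw [hSa, hin]
    simp only [hfst, hsnd, sub_neg_eq_add, ← two_smul ℝ e, map_smul, real_inner_smul_left,
      real_inner_smul_right, inner_neg_left, inner_neg_right, hZa, hee]
    field_simp
    ring
  · have hcont : Continuous fun z : WithLp 2 (E × E) => ‖D (z - z₀)‖ := by fun_prop
    have hev : ∀ᶠ z in nhds z₀, ‖D (z - z₀)‖ < ‖d‖ / 2 :=
      hcont.continuousAt.eventually_lt continuousAt_const (by simpa using hs)
    filter_upwards [hev] with z hz
    obtain ⟨h, rfl⟩ : ∃ h, z = z₀ + h := ⟨z - z₀, by abel⟩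
    rw [add_sub_cancel_left, hDa] at hz
    have h1 := mul_le_mul_of_nonneg_left (norm_add_le_quadratic hd0 hz.le) hL
    have e1 : (z₀ + h).fst - (z₀ + h).snd = d + (h.fst - h.snd) := by
      simp [hd]; abel
    have e2 : ‖d + (h.fst - h.snd)‖ ^ 2
        = ‖d‖ ^ 2 + 2 * (‖d‖ * ⟪e, h.fst - h.snd⟫) + ‖h.fst - h.snd‖ ^ 2 := by
      rw [norm_add_sq_real, he, real_inner_smul_left, mul_inv_cancel_left₀ hs.ne']
    have e3 : ‖(z₀ + h).fst - x₁‖ ^ 2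
        = ‖z₀.fst - x₁‖ ^ 2 + 2 * ⟪z₀.fst - x₁, h.fst⟫ + ‖h.fst‖ ^ 2 := by
      rw [← norm_add_sq_real, WithLp.add_fst, add_sub_right_comm]
    have e4 : ‖(z₀ + h).snd - y₁‖ ^ 2
        = ‖z₀.snd - y₁‖ ^ 2 + 2 * ⟪z₀.snd - y₁, h.snd⟫ + ‖h.snd‖ ^ 2 := by
      rw [← norm_add_sq_real, WithLp.add_snd, add_sub_right_comm]
    have eb : ⟪WithLp.toLp 2 ((L * (1 - ‖d‖ / 4)) • e + ρ • (z₀.fst - x₁),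
        -(L * (1 - ‖d‖ / 4)) • e + ρ • (z₀.snd - y₁)), h⟫
        = L * (1 - ‖d‖ / 4) * (⟪e, h.fst⟫ - ⟪e, h.snd⟫)
          + ρ * (⟪z₀.fst - x₁, h.fst⟫ + ⟪z₀.snd - y₁, h.snd⟫) := by
      change ⟪(L * (1 - ‖d‖ / 4)) • e + ρ • (z₀.fst - x₁), h.fst⟫
        + ⟪-(L * (1 - ‖d‖ / 4)) • e + ρ • (z₀.snd - y₁), h.snd⟫ = _
      simp only [inner_add_left, real_inner_smul_left]
      ring
    rw [e1, e3, e4, e2, add_sub_cancel_left, eb, hSa, hZa, hin]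
    simp only [real_inner_self_eq_norm_sq]
    rw [← he] at h1
    have e5 : ⟪e, h.fst - h.snd⟫ = ⟪e, h.fst⟫ - ⟪e, h.snd⟫ := inner_sub_right _ _ _
    have e6 : (‖h.fst - h.snd‖ ^ 2 - ⟪e, h.fst - h.snd⟫ ^ 2) / ‖d‖
      = ‖h.fst - h.snd‖ ^ 2 * (1 / ‖d‖) - ⟪e, h.fst - h.snd⟫ ^ 2 * (1 / ‖d‖) := by ring
    rw [e6] at h1
    have e7 : ∀ x : ℝ, x / ‖d‖ = x * (1 / ‖d‖) := fun x => by ring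
    rw [e7 2, e7 (2 * L)]
    linear_combination h1 + L * (1 - ‖d‖ / 4) * e5

end QuadraticMajorant

lemma isLocalMax_sub_of_hasTaylor₂ {E : Type*} [NormedAddCommGroup E] [InnerProductSpace ℝ E]
    {K : Set E} {u A φ : E → ℝ} {a δ : ℝ} {x z P : E} {T : E →L[ℝ] E} (hzK : K ∈ nhds z)
    (hz : A x = u z - a * ‖x - z‖ ^ 2)
    (hA : ∀ x, ∀ z ∈ K, u z - a * ‖x - z‖ ^ 2 ≤ A x) (hT : HasTaylor₂ A x P T) (hδ : 0 < δ)
    (hφ : ∀ h, φ (z + h) = ⟪P, h⟫ + 1 / 2 * ⟪(T + δ • ContinuousLinearMap.id ℝ E) h, h⟫) :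
    IsLocalMax (fun x => u x - φ x) z := by
  obtain ⟨r, hr, h1⟩ := hT (δ / 2) (by positivity)
  filter_upwards [hzK, Metric.ball_mem_nhds z hr] with y hyK hy
  obtain ⟨h, rfl⟩ : ∃ h, y = z + h := ⟨y - z, by abel⟩
  rw [mem_ball_iff_norm, add_sub_cancel_left] at hy
  have h2 := (abs_le.1 (h1 h hy)).2
  have h3 := hA (x + h) (z + h) hyK
  rw [add_sub_add_right_eq_sub] at h3
  have h4 := hφ 0
  simp only [add_zero, inner_zero_right, mul_zero] at h4
  have h5 : φ (z + h) = ⟪P, h⟫ + 1 / 2 * (⟪T h, h⟫ + δ * ‖h‖ ^ 2) := by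
    rw [hφ, _root_.add_apply, inner_add_left, _root_.smul_apply, real_inner_smul_left,
      ContinuousLinearMap.id_apply, real_inner_self_eq_norm_sq]
  rw [h4, h5]
  linarith

section ViscosityInequalities

variable {n : ℕ} {κ q Mf a δ : ℝ} {F : Matrix (Fin n) (Fin n) ℝ → ℝ} {f u A : Euc n → ℝ}
  {K s : Set (Euc n)} {x z P : Euc n} {T : Euc n →L[ℝ] Euc n}

lemma one_le_slope_rpow (hq : 0 ≤ q) (hP : κ + 1 ≤ ‖P‖) : 1 ≤ max (‖P‖ - κ) 0 ^ q :=
  Real.one_le_rpow ((le_sub_iff_add_le'.2 hP).trans (le_max_left _ _)) hq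

lemma GradSubSol.neg_le (hu : GradSubSol κ (mainG κ q F) f s u) (hq : 0 ≤ q)
    (hf : ∀ x ∈ s, |f x| ≤ Mf) (hzs : z ∈ s) (hzK : K ∈ nhds z)
    (hz : A x = u z - a * ‖x - z‖ ^ 2) (hA : ∀ x, ∀ z ∈ K, u z - a * ‖x - z‖ ^ 2 ≤ A x)
    (hT : HasTaylor₂ A x P T) (hδ : 0 < δ) (hP : κ + 1 ≤ ‖P‖) :
    -Mf ≤ F (symMat (T + δ • ContinuousLinearMap.id ℝ (Euc n))) := by
  obtain ⟨φ, hφ, hφC, hφg, hφh⟩ :=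
    exists_testFunction P z (T + δ • ContinuousLinearMap.id ℝ (Euc n))
  have h1 := hu z hzs φ hφC (isLocalMax_sub_of_hasTaylor₂ hzK hz hA hT hδ hφ)
    (by rw [hφg]; linarith)
  rw [hφg, hφh, mainG] at h1
  have h2 := one_le_slope_rpow hq hP
  have h3 := abs_le.1 (hf z hzs)
  by_contra! h4
  nlinarith

lemma GradSupSol.le (hu : GradSupSol κ (mainG κ q F) f s u) (hq : 0 ≤ q)
    (hf : ∀ x ∈ s, |f x| ≤ Mf) (hzs : z ∈ s) (hzK : K ∈ nhds z)
    (hz : A x = -u z - a * ‖x - z‖ ^ 2) (hA : ∀ x, ∀ z ∈ K, -u z - a * ‖x - z‖ ^ 2 ≤ A x)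
    (hT : HasTaylor₂ A x P T) (hδ : 0 < δ) (hP : κ + 1 ≤ ‖P‖) :
    F (-symMat (T + δ • ContinuousLinearMap.id ℝ (Euc n))) ≤ Mf := by
  obtain ⟨φ, hφ, hφC, hφg, hφh⟩ :=
    exists_testFunction (-P) z (-(T + δ • ContinuousLinearMap.id ℝ (Euc n)))
  have hmax := isLocalMax_sub_of_hasTaylor₂ (u := fun z => -u z) (φ := fun z => -φ z)
    hzK hz hA hT hδ (fun h => by
      rw [hφ, _root_.neg_apply, inner_neg_left, inner_neg_left]; ring)
  have hmin : IsLocalMin (fun x => u x - φ x) z := by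
    filter_upwards [hmax] with y hy
    linarith
  have h1 := hu z hzs φ hφC hmin (by rw [hφg, norm_neg]; linarith)
  rw [hφg, hφh, mainG, norm_neg, symMat_neg] at h1
  have h2 := one_le_slope_rpow hq hP
  have h3 := abs_le.1 (hf z hzs)
  by_contra! h4
  nlinarith

end ViscosityInequalities

section Doubling

variable {n : ℕ}

/-- `A` is the sup-convolution of `u` over the ball of radius `7 / 8`, the supremum being attained
at `ζ x`, which lies in the open ball whenever `x` is in the ball of radius `3 / 4`. -/
structure IsSupConvolution (a : ℝ) (u A : Euc n → ℝ) (ζ : Euc n → Euc n) : Prop where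
  continuous : Continuous A
  eq : ∀ x, A x = u (ζ x) - a * ‖x - ζ x‖ ^ 2
  le : ∀ x, ∀ z ∈ closedBall (0 : Euc n) (7 / 8), u z - a * ‖x - z‖ ^ 2 ≤ A x
  proxSubgrad : ∀ x, ∃ q, ProxSubgrad (2 * a) A x q
  mem_ball : ∀ x ∈ closedBall (0 : Euc n) (3 / 4), ζ x ∈ ball 0 (7 / 8)

lemma exists_isSupConvolution {u : Euc n → ℝ} {M r : ℝ} (hu : ContinuousOn u (ball 0 1))
    (hM : ∀ x ∈ ball (0 : Euc n) 1, |u x| ≤ M) (hr : 0 < r) (hr' : r ≤ 1 / 8) :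
    ∃ A ζ, IsSupConvolution ((2 * M + 1) / r ^ 2) u A ζ ∧
      ∀ x ∈ closedBall (0 : Euc n) (3 / 4), ‖x - ζ x‖ < r ∧ u x ≤ A x ∧ A x ≤ u (ζ x) := by
  have hM0 : 0 ≤ M := (abs_nonneg _).trans (hM 0 (mem_ball_self one_pos))
  have ha : 0 ≤ (2 * M + 1) / r ^ 2 := by positivity
  have hsub : closedBall (0 : Euc n) (7 / 8) ⊆ ball 0 1 := closedBall_subset_ball (by norm_num)
  obtain ⟨A, ζ, hAc, hζ, hAe, hAl, hAp⟩ := exists_supConvolution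
    (isCompact_closedBall (0 : Euc n) (7 / 8)) ⟨0, mem_closedBall_self (by norm_num)⟩ (hu.mono hsub) ha
  have hnear : ∀ x ∈ closedBall (0 : Euc n) (3 / 4),
      ‖x - ζ x‖ < r ∧ u x ≤ A x ∧ A x ≤ u (ζ x) := by
    intro x hx
    have hx' : x ∈ closedBall (0 : Euc n) (7 / 8) := closedBall_subset_closedBall (by norm_num) hx
    have h1 : u x ≤ A x := by simpa using hAl x x hx'
    have h2 := hAe x
    have h3 := (abs_le.1 (hM x (hsub hx'))).1
    have h4 := (abs_le.1 (hM (ζ x) (hsub (hζ x)))).2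
    refine ⟨?_, h1, by rw [h2]; linarith [mul_nonneg ha (sq_nonneg ‖x - ζ x‖)]⟩
    refine lt_of_pow_lt_pow_left₀ 2 hr.le ?_
    have h5 : (2 * M + 1) / r ^ 2 * r ^ 2 = 2 * M + 1 := div_mul_cancel₀ _ (by positivity)
    exact lt_of_mul_lt_mul_left (by rw [h5]; linarith) ha
  refine ⟨A, ζ, ⟨hAc, hAe, hAl, fun x => ⟨_, hAp x⟩, fun x hx => ?_⟩, hnear⟩
  have h1 := (hnear x hx).1
  rw [mem_closedBall_zero_iff] at hx
  rw [mem_ball_zero_iff]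
  have h2 : ‖ζ x‖ ≤ ‖x‖ + ‖x - ζ x‖ := by
    simpa using _root_.norm_sub_le x (x - ζ x)
  linarith

lemma exists_doubling_max {u : Euc n → ℝ} {M L : ℝ} (hu : ContinuousOn u (ball 0 1))
    (hM : ∀ x ∈ ball (0 : Euc n) 1, |u x| ≤ M) (hL : 0 ≤ L) {x₁ y₁ : Euc n}
    (hx₁ : x₁ ∈ ball (0 : Euc n) (1 / 2)) (hy₁ : y₁ ∈ ball (0 : Euc n) (1 / 2))
    (hlt : L * ‖x₁ - y₁‖ < u x₁ - u y₁) :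
    ∃ a ≥ 0, ∃ A B ζ ξ, IsSupConvolution a u A ζ ∧ IsSupConvolution a (fun x => -u x) B ξ ∧
      ∃ z : WithLp 2 (Euc n × Euc n), ‖z.fst - x₁‖ < 1 / 4 ∧ ‖z.snd - y₁‖ < 1 / 4 ∧
        z.fst ≠ z.snd ∧ IsLocalMax (fun w : WithLp 2 (Euc n × Euc n) => A w.fst + B w.snd
          - (L * (‖w.fst - w.snd‖ - ‖w.fst - w.snd‖ ^ 2 / 8)
            + (64 * M + 1) / 2 * (‖w.fst - x₁‖ ^ 2 + ‖w.snd - y₁‖ ^ 2))) z := by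
  have hM0 : 0 ≤ M := (abs_nonneg _).trans (hM 0 (mem_ball_self one_pos))
  set θ := u x₁ - u y₁ - L * (‖x₁ - y₁‖ - ‖x₁ - y₁‖ ^ 2 / 8) with hθ
  have hθ0 : 0 < θ := by
    have : 0 ≤ L * ‖x₁ - y₁‖ ^ 2 := by positivity
    rw [hθ]; linarith
  have hsub : closedBall (0 : Euc n) (7 / 8) ⊆ ball 0 1 := closedBall_subset_ball (by norm_num)
  obtain ⟨σ, hσ, hunif⟩ := Metric.uniformContinuousOn_iff.1
    ((isCompact_closedBall (0 : Euc n) (7 / 8)).uniformContinuousOn_of_continuous (hu.mono hsub))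
    θ hθ0
  set r := min (1 / 8) (σ / 2) with hr
  have hr0 : 0 < r := by positivity
  obtain ⟨A, ζ, hA, hAn⟩ := exists_isSupConvolution hu hM hr0 (min_le_left _ _)
  obtain ⟨B, ξ, hB, hBn⟩ := exists_isSupConvolution (u := fun x => -u x) hu.neg
    (by simpa using hM) hr0 (min_le_left _ _)
  refine ⟨_, by positivity, A, B, ζ, ξ, hA, hB, ?_⟩
  set G : WithLp 2 (Euc n × Euc n) → ℝ := fun w => A w.fst + B w.snd
    - (L * (‖w.fst - w.snd‖ - ‖w.fst - w.snd‖ ^ 2 / 8)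
      + (64 * M + 1) / 2 * (‖w.fst - x₁‖ ^ 2 + ‖w.snd - y₁‖ ^ 2)) with hG
  have hcf : Continuous fun w : WithLp 2 (Euc n × Euc n) => w.fst :=
    (WithLp.fstL 2 ℝ (Euc n) (Euc n)).continuous
  have hcs : Continuous fun w : WithLp 2 (Euc n × Euc n) => w.snd :=
    (WithLp.sndL 2 ℝ (Euc n) (Euc n)).continuous
  have hGc : Continuous fun p : Euc n × Euc n => G (WithLp.toLp 2 p) := by
    have h1 := hA.continuous
    have h2 := hB.continuous
    change Continuous fun p : Euc n × Euc n => A p.1 + B p.2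
      - (L * (‖p.1 - p.2‖ - ‖p.1 - p.2‖ ^ 2 / 8)
        + (64 * M + 1) / 2 * (‖p.1 - x₁‖ ^ 2 + ‖p.2 - y₁‖ ^ 2))
    fun_prop
  obtain ⟨⟨x, y⟩, ⟨hx, hy⟩, hmax⟩ := ((isCompact_closedBall (0 : Euc n) (3 / 4)).prod
    (isCompact_closedBall (0 : Euc n) (3 / 4))).exists_isMaxOn
    ⟨(0, 0), mem_closedBall_self (by norm_num), mem_closedBall_self (by norm_num)⟩
    hGc.continuousOn
  have hball : ball (0 : Euc n) (1 / 2) ⊆ closedBall 0 (3 / 4) :=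
    ball_subset_closedBall.trans (closedBall_subset_closedBall (by norm_num))
  have hmax' : ∀ x' ∈ closedBall (0 : Euc n) (3 / 4), ∀ y' ∈ closedBall (0 : Euc n) (3 / 4),
      G (WithLp.toLp 2 (x', y')) ≤ G (WithLp.toLp 2 (x, y)) := fun x' hx' y' hy' =>
    hmax (show (x', y') ∈ _ from ⟨hx', hy'⟩)
  have hGe : ∀ x y, G (WithLp.toLp 2 (x, y)) = A x + B y
    - (L * (‖x - y‖ - ‖x - y‖ ^ 2 / 8)
      + (64 * M + 1) / 2 * (‖x - x₁‖ ^ 2 + ‖y - y₁‖ ^ 2)) := fun _ _ => rfl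
  have hval : θ ≤ G (WithLp.toLp 2 (x, y)) := by
    refine le_trans ?_ (hmax' x₁ (hball hx₁) y₁ (hball hy₁))
    have h1 := (hAn x₁ (hball hx₁)).2.1
    have h2 := (hBn y₁ (hball hy₁)).2.1
    rw [hGe, sub_self, sub_self, norm_zero]
    linarith
  rw [hGe] at hval
  have hζx := hsub (ball_subset_closedBall (hA.mem_ball x hx))
  have hξy := hsub (ball_subset_closedBall (hB.mem_ball y hy))
  have hAx := (hAn x hx).2.2.trans (abs_le.1 (hM _ hζx)).2
  have hBy := (hBn y hy).2.2.trans (neg_le.1 (abs_le.1 (hM _ hξy)).1)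
  have hx' := mem_closedBall_zero_iff.1 hx
  have hy' := mem_closedBall_zero_iff.1 hy
  have hxy : ‖x - y‖ ≤ 3 / 2 := (_root_.norm_sub_le x y).trans (by linarith)
  have hφ0 : 0 ≤ L * (‖x - y‖ - ‖x - y‖ ^ 2 / 8) :=
    mul_nonneg hL (by nlinarith [norm_nonneg (x - y)])
  have hpen : (64 * M + 1) / 2 * (‖x - x₁‖ ^ 2 + ‖y - y₁‖ ^ 2) < 2 * M := by linarith
  have hclose : ∀ s t : ℝ, (64 * M + 1) / 2 * (s ^ 2 + t ^ 2) < 2 * M → s < 1 / 4 := by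
    intro s t h
    by_contra! hs
    nlinarith [mul_nonneg hM0 (sq_nonneg t), sq_nonneg t,
      mul_le_mul_of_nonneg_left (mul_self_le_mul_self (by norm_num) hs) hM0]
  have hxx₁ := hclose _ _ hpen
  have hyy₁ := hclose ‖y - y₁‖ ‖x - x₁‖ (by linarith)
  refine ⟨WithLp.toLp 2 (x, y), hxx₁, hyy₁, fun hne => ?_, ?_⟩
  · replace hne : x = y := hne
    subst hne
    have h1 := hunif _ (ball_subset_closedBall (hA.mem_ball x hx)) _
      (ball_subset_closedBall (hB.mem_ball x hx)) (by
        rw [dist_eq_norm, ← sub_sub_sub_cancel_left (ξ x) (ζ x) x]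
        have h1 := (hAn x hx).1
        have h2 := (hBn x hx).1
        have h3 := min_le_right (1 / 8) (σ / 2)
        refine (_root_.norm_sub_le _ _).trans_lt ?_
        linarith)
    rw [Real.dist_eq] at h1
    have h2 := (abs_lt.1 h1).2
    have h3 := (hAn x hx).2.2
    have h4 := (hBn x hx).2.2
    have h5 : 0 ≤ (64 * M + 1) / 2 * (‖x - x₁‖ ^ 2 + ‖x - y₁‖ ^ 2) := by positivity
    linarith
  · have hlt' : ∀ v v₁ : Euc n, v₁ ∈ ball (0 : Euc n) (1 / 2) → ‖v - v₁‖ < 1 / 4 →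
        ‖v‖ < 3 / 4 := fun v v₁ h h' => by
      rw [mem_ball_zero_iff] at h
      linarith [norm_le_norm_add_norm_sub' v v₁]
    filter_upwards [hcf.norm.continuousAt.eventually_lt continuousAt_const (hlt' x x₁ hx₁ hxx₁),
      hcs.norm.continuousAt.eventually_lt continuousAt_const (hlt' y y₁ hy₁ hyy₁)] with w h1 h2
    exact hmax' w.fst (mem_closedBall_zero_iff.2 h1.le) w.snd (mem_closedBall_zero_iff.2 h2.le)

end Doubling

lemma sub_le_of_gradSol {n : ℕ} {lam Lam κ q Mf M L : ℝ} (hlam : 0 < lam) (hlamLam : lam ≤ Lam)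
    (hq : 0 ≤ q) {F : Matrix (Fin n) (Fin n) ℝ → ℝ} (hF : IsUniformlyElliptic n lam Lam F)
    {f u : Euc n → ℝ} (hf : ∀ x ∈ ball (0 : Euc n) 1, |f x| ≤ Mf)
    (hu : ContinuousOn u (ball 0 1)) (hM : ∀ x ∈ ball (0 : Euc n) 1, |u x| ≤ M)
    (hsol : GradSol κ (mainG κ q F) f (ball 0 1) u) (hL0 : 0 ≤ L)
    (hL : κ + 2 + (64 * M + 1) / 4 ≤ 5 / 8 * L)
    (hL' : (2 * (64 * M + 1) + 4) * (n * Lam) + 2 * Mf < lam * L)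
    {x₁ y₁ : Euc n} (hx₁ : x₁ ∈ ball (0 : Euc n) (1 / 2)) (hy₁ : y₁ ∈ ball (0 : Euc n) (1 / 2)) :
    u x₁ - u y₁ ≤ L * ‖x₁ - y₁‖ := by
  have hM0 : 0 ≤ M := (abs_nonneg _).trans (hM 0 (mem_ball_self one_pos))
  by_contra! hlt
  obtain ⟨a, ha, A, B, ζ, ξ, hA, hB, z, hzx, hzy, hne, hmax⟩ :=
    exists_doubling_max hu hM hL0 hx₁ hy₁ hlt
  set ρ := 64 * M + 1 with hρ
  have hρ0 : 0 < ρ := by positivity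
  obtain ⟨e, S, b, he, hS, hb₁, hb₂, hSd, hSe, hmaj⟩ :=
    exists_quadratic_majorant (ρ := ρ) hL0 x₁ y₁ hne
  have hmax' : IsLocalMax (fun w : WithLp 2 (Euc n × Euc n) => A w.fst + B w.snd
      - ⟪b, w - z⟫ - 1 / 2 * ⟪S (w - z), w - z⟫) z := by
    filter_upwards [hmax, hmaj] with w h1 h2
    rw [sub_self, inner_zero_right, inner_zero_right]
    linarith
  rw [mem_ball_zero_iff] at hx₁ hy₁
  have hz₁ : ‖z.fst‖ < 3 / 4 := by linarith [norm_le_norm_add_norm_sub' z.fst x₁]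
  have hz₂ : ‖z.snd‖ < 3 / 4 := by linarith [norm_le_norm_add_norm_sub' z.snd y₁]
  obtain ⟨η, hη, hη1, hη₁, hη₂⟩ : ∃ η > 0, η ≤ 1 ∧ η ≤ 3 / 4 - ‖z.fst‖ ∧ η ≤ 3 / 4 - ‖z.snd‖ :=
    ⟨min 1 (min (3 / 4 - ‖z.fst‖) (3 / 4 - ‖z.snd‖)),
      lt_min one_pos (lt_min (sub_pos.2 hz₁) (sub_pos.2 hz₂)), min_le_left _ _,
      (min_le_right _ _).trans (min_le_left _ _), (min_le_right _ _).trans (min_le_right _ _)⟩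
  obtain ⟨x, y, P₁, P₂, T₁, T₂, hx, hy, hP₁, hP₂, hT₁, hT₂, hT⟩ :=
    exists_hasTaylor₂_of_isLocalMax_sum (mul_nonneg zero_le_two ha) hA.continuous hB.continuous
      hA.proxSubgrad hB.proxSubgrad hS hmax' hη
  have hxb : x ∈ closedBall (0 : Euc n) (3 / 4) := by
    rw [mem_closedBall_zero_iff]; linarith [norm_le_norm_add_norm_sub' x z.fst]
  have hyb : y ∈ closedBall (0 : Euc n) (3 / 4) := by
    rw [mem_closedBall_zero_iff]; linarith [norm_le_norm_add_norm_sub' y z.snd]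
  have hsub : ball (0 : Euc n) (7 / 8) ⊆ ball 0 1 := ball_subset_ball (by norm_num)
  have hnhds : ∀ v ∈ ball (0 : Euc n) (7 / 8), closedBall (0 : Euc n) (7 / 8) ∈ nhds v :=
    fun v hv => closedBall_mem_nhds_of_mem hv
  have hxy : ‖z.fst - z.snd‖ ≤ 3 / 2 := (_root_.norm_sub_le _ _).trans (by linarith)
  have hslope : ∀ (c : ℝ) (v P b' : Euc n), |c| = L * (1 - ‖z.fst - z.snd‖ / 4) →
      ‖v‖ < 1 / 4 → b' = c • e + ρ • v → ‖P - b'‖ < η → κ + 1 ≤ ‖P‖ := by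
    intro c v P b' hc hv hb' hP
    have h1 : ‖c • e‖ ≤ ‖b'‖ + ‖ρ • v‖ := by
      simpa [hb'] using _root_.norm_sub_le b' (ρ • v)
    rw [norm_smul, norm_smul, he, mul_one, Real.norm_eq_abs, hc, Real.norm_of_nonneg hρ0.le] at h1
    have h2 := norm_le_norm_add_norm_sub P b'
    nlinarith
  have hc0 : 0 ≤ L * (1 - ‖z.fst - z.snd‖ / 4) := mul_nonneg hL0 (by linarith)
  have hX := hsol.1.neg_le hq hf (hsub (hA.mem_ball x hxb)) (hnhds _ (hA.mem_ball x hxb)) (hA.eq x)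
    hA.le hT₁ one_pos (hslope _ _ _ _ (abs_of_nonneg hc0) hzx hb₁ hP₁)
  have hY := hsol.2.le hq hf (hsub (hB.mem_ball y hyb)) (hnhds _ (hB.mem_ball y hyb)) (hB.eq y)
    hB.le hT₂ one_pos
    (hslope _ _ _ _ ((abs_neg _).trans (abs_of_nonneg hc0)) hzy hb₂ hP₂)
  set X := T₁ + (1 : ℝ) • ContinuousLinearMap.id ℝ (Euc n) with hXdef
  set Y := T₂ + (1 : ℝ) • ContinuousLinearMap.id ℝ (Euc n) with hYdef
  have hXY : ∀ v : Euc n, ⟪(X + Y) v, v⟫ = ⟪T₁ v, v⟫ + ⟪T₂ v, v⟫ + 2 * ‖v‖ ^ 2 := fun v => by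
    simp only [hXdef, hYdef, _root_.add_apply, one_smul, ContinuousLinearMap.id_apply,
      inner_add_left, real_inner_self_eq_norm_sq]
    ring
  have hnorm : ∀ k : Fin n → ℝ, k ⬝ᵥ k = ‖(WithLp.toLp 2 k : Euc n)‖ ^ 2 := fun k => by
    rw [EuclideanSpace.real_norm_sq_eq]
    simp [dotProduct, sq]
  have h1 := (hF (symMat X) (-symMat Y) (symMat_isSymm X) (symMat_isSymm Y).neg).2
  rw [sub_neg_eq_add, ← symMat_add] at h1
  have h2 : pucciSup n lam Lam (symMat (X + Y))
      ≤ (2 * ρ + 4) * (n * Lam) - lam * (L - (2 * ρ + 4) + (2 * ρ + 4)) := by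
    refine pucciSup_le hlam.le hlamLam (by positivity) (symMat_isSymm _) (fun k => ?_)
      (e := e.ofLp) (by rw [hnorm]; simp [he]) ?_
    · rw [dotProduct_symMat_mulVec, hnorm, hXY]
      have h3 := hT (WithLp.toLp 2 k) (WithLp.toLp 2 k)
      rw [hSd] at h3
      nlinarith [sq_nonneg ‖(WithLp.toLp 2 k : Euc n)‖]
    · rw [dotProduct_symMat_mulVec, WithLp.toLp_ofLp, hXY, he]
      have h3 := hT e (-e)
      rw [hSe, map_neg, inner_neg_neg, norm_neg, he] at h3
      linarith
  linarith

/-- Theorem 3.1, uniform Lipschitz estimate: the Lipschitz constant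
depends only on `n, λ, Λ, κ`, the sup-bounds of `f` and `u`, and is independent of `q`. -/
theorem lipschitz_estimate
    (n : ℕ) (hn : 1 ≤ n) (lam Lam κ Mf Mu : ℝ)
    (hlam : 0 < lam) (hlamLam : lam ≤ Lam) (hκ : 0 ≤ κ) :
    ∃ C > 0, ∀ q : ℝ, 0 ≤ q →
      ∀ F : Matrix (Fin n) (Fin n) ℝ → ℝ, IsUniformlyElliptic n lam Lam F →
      ∀ f u : Euc n → ℝ,
        ContinuousOn f (ball 0 1) → (∀ x ∈ ball (0 : Euc n) 1, |f x| ≤ Mf) →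
        ContinuousOn u (ball 0 1) → (∀ x ∈ ball (0 : Euc n) 1, |u x| ≤ Mu) →
        GradSol κ (mainG κ q F) f (ball 0 1) u →
        ∀ x ∈ ball (0 : Euc n) (1/2), ∀ y ∈ ball (0 : Euc n) (1/2),
          |u x - u y| ≤ C * ‖x - y‖ := by
  have hLam : 0 < Lam := hlam.trans_le hlamLam
  set m := (2 * (64 * |Mu| + 1) + 4) * (n * Lam) + 2 * |Mf| with hm
  have hm0 : 0 ≤ m := by positivity
  refine ⟨(m + 1) / lam + 2 * (κ + 3 + (64 * |Mu| + 1)), by positivity, ?_⟩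
  intro q hq F hF f u _ hf hu hM hsol x hx y hy
  have h0 : 0 ≤ (m + 1) / lam := by positivity
  have h1 : lam * ((m + 1) / lam) = m + 1 := mul_div_cancel₀ _ hlam.ne'
  have h2 : 0 ≤ lam * (2 * (κ + 3 + (64 * |Mu| + 1))) := by positivity
  have key : ∀ v ∈ ball (0 : Euc n) (1 / 2), ∀ w ∈ ball (0 : Euc n) (1 / 2), u v - u w
      ≤ ((m + 1) / lam + 2 * (κ + 3 + (64 * |Mu| + 1))) * ‖v - w‖ := fun v hv w hw =>
    sub_le_of_gradSol hlam hlamLam hq hF (fun z hz => (hf z hz).trans (le_abs_self Mf)) hu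
      (fun z hz => (hM z hz).trans (le_abs_self Mu)) hsol (by positivity)
      (by linarith [abs_nonneg Mu]) (by rw [mul_add]; linarith) hv hw
  refine abs_sub_le_iff.2 ⟨key x hx y hy, ?_⟩
  rw [norm_sub_rev]
  exact key y hy x hx

end
end

section
/- Let u be a κ-grad viscosity solution of (|Du|−κ)₊^q F(D²u) = f in B₁, with F (λ,Λ)-elliptic and f bounded. Let L, K > 0, let ϕ ∈ C²((0,∞)) be nonnegative, and set Φ(x,y) := Lϕ(|x−y|) + K(|x|²+|y|²). Suppose (x̄,ȳ) ∈ B₁×B₁ with x̄ ≠ ȳ is an interior local maximum point of (x,y) ↦ u(x) − u(y) − Φ(x,y), and suppose |D_xΦ(x̄,ȳ)| > κ and |D_yΦ(x̄,ȳ)| > κ. Then −4ϕ''(|x̄−ȳ|)L ≤ 4n(Λ/λ)K + (1/λ)‖f‖_{L^∞(B₁)}[(|D_xΦ(x̄,ȳ)|−κ)^{−q} + (|D_yΦ(x̄,ȳ)|−κ)^{−q}]. -/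
open Metric Set Matrix MeasureTheory
open scoped RealInnerProductSpace

noncomputable section

section SecondOrderContact

open scoped Pointwise

variable {E : Type*} [NormedAddCommGroup E] [InnerProductSpace ℝ E]

/-- The slopes of planes touching a semiconvex function from above depend on the contact point
in a Lipschitz way. -/
theorem norm_contact_slope_sub_le {g : E → ℝ} {C : ℝ} (hC : 0 ≤ C) {a b p q : E}
    (ha : ∀ z, g a + ⟪p, z - a⟫ - C * ‖z - a‖ ^ 2 ≤ g z)
    (ha' : ∀ z, g z ≤ g a + ⟪p, z - a⟫)
    (hb' : ∀ z, g z ≤ g b + ⟪q, z - b⟫) :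
    ‖p - q‖ ≤ 4 * C * ‖a - b‖ := by
  have key : ∀ h : E, ⟪p - q, h⟫ ≤ C * (‖a - b‖ + ‖h‖) ^ 2 := by
    intro h
    have h1 := ha (b + h)
    have h2 := hb' (b + h)
    have h3 := ha' b
    have h4 : ‖b + h - a‖ ≤ ‖a - b‖ + ‖h‖ := by
      calc ‖b + h - a‖ = ‖h - (a - b)‖ := by congr 1; abel
        _ ≤ ‖h‖ + ‖a - b‖ := norm_sub_le _ _
        _ = _ := add_comm _ _
    have h5 : ‖b + h - a‖ ^ 2 ≤ (‖a - b‖ + ‖h‖) ^ 2 := by gcongr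
    have h6 : b + h - a = (b - a) + h := by abel
    rw [h6, inner_add_right, ← h6] at h1
    rw [add_sub_cancel_left] at h2
    rw [inner_sub_left]
    nlinarith [mul_le_mul_of_nonneg_left h5 hC]
  by_cases hpq : p - q = 0
  · rw [hpq, norm_zero]; positivity
  have hpos : 0 < ‖p - q‖ := norm_pos_iff.2 hpq
  have scaled : ∀ t : ℝ, 0 ≤ t → t * ‖p - q‖ ≤ C * (‖a - b‖ + t) ^ 2 := by
    intro t ht
    have := key ((t / ‖p - q‖) • (p - q))
    rw [real_inner_smul_right, real_inner_self_eq_norm_sq, norm_smul, Real.norm_eq_abs,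
      abs_of_nonneg (by positivity), div_mul_cancel₀ _ hpos.ne'] at this
    calc t * ‖p - q‖ = t / ‖p - q‖ * ‖p - q‖ ^ 2 := by field_simp
      _ ≤ _ := this
  by_cases hab : ‖a - b‖ = 0
  · rw [hab] at scaled ⊢
    by_contra! hcon
    rw [mul_zero] at hcon
    have := scaled (‖p - q‖ / (2 * (C + 1))) (by positivity)
    have h1 : ‖p - q‖ ≤ C * (‖p - q‖ / (2 * (C + 1))) := by
      have h2 : 0 < ‖p - q‖ / (2 * (C + 1)) := by positivity
      refine le_of_mul_le_mul_left ?_ h2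
      nlinarith
    have h2 : C * (‖p - q‖ / (2 * (C + 1))) < ‖p - q‖ := by
      rw [mul_div_assoc', div_lt_iff₀ (by positivity)]
      nlinarith
    linarith
  · have hab' : 0 < ‖a - b‖ := lt_of_le_of_ne (norm_nonneg _) (Ne.symm hab)
    have := scaled ‖a - b‖ hab'.le
    refine le_of_mul_le_mul_left ?_ hab'
    nlinarith

/-- Near a density point, a set meets every ball of radius comparable to the distance. -/
theorem eventually_exists_mem_near_of_density_one [FiniteDimensional ℝ E] [MeasurableSpace E]
    [BorelSpace E] (μ : Measure E) [μ.IsAddHaarMeasure] {S : Set E} {x : E}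
    (h : Filter.Tendsto (fun r => μ (S ∩ closedBall x r) / μ (closedBall x r))
      (nhdsWithin 0 (Ioi 0)) (nhds 1)) {η : ℝ} (hη : 0 < η) :
    ∀ᶠ r in nhdsWithin (0 : ℝ) (Ioi 0), ∀ y : E, ‖y‖ ≤ r → ∃ a ∈ S, ‖a - (x + y)‖ ≤ η * r := by
  obtain ⟨t, -, htfin, htcov⟩ := (isCompact_closedBall (0 : E) 1).finite_cover_balls
    (half_pos hη)
  have hall : ∀ᶠ r in nhdsWithin (0 : ℝ) (Ioi 0), ∀ c ∈ t,
      (S ∩ ({x} + r • closedBall c (η / 2))).Nonempty := by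
    rw [Filter.eventually_all_finite htfin]
    intro c _
    exact Measure.eventually_nonempty_inter_smul_of_density_one μ S x h _ measurableSet_closedBall
      (measure_closedBall_pos μ c (half_pos hη)).ne'
  filter_upwards [hall, self_mem_nhdsWithin] with r hr hr0 y hy
  have hr0 : 0 < r := hr0
  have hy1 : r⁻¹ • y ∈ closedBall (0 : E) 1 := by
    rw [mem_closedBall_zero_iff, norm_smul, norm_inv, Real.norm_of_nonneg hr0.le,
      inv_mul_le_iff₀ hr0, mul_one]
    exact hy
  obtain ⟨c, hct, hc⟩ := mem_iUnion₂.1 (htcov hy1)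
  obtain ⟨a, haS, ha⟩ := hr c hct
  rw [Set.singleton_add] at ha
  obtain ⟨w, ⟨b, hb, rfl⟩, rfl⟩ := ha
  refine ⟨_, haS, ?_⟩
  have : x + r • b - (x + y) = r • (b - r⁻¹ • y) := by
    rw [smul_sub, smul_inv_smul₀ hr0.ne']; abel
  simp only [] at this ⊢
  rw [this, norm_smul, Real.norm_of_nonneg hr0.le, mul_comm]
  gcongr
  rw [mem_ball, dist_eq_norm] at hc
  rw [mem_closedBall, dist_eq_norm] at hb
  calc ‖b - r⁻¹ • y‖ = ‖(b - c) - (r⁻¹ • y - c)‖ := by congr 1; abel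
    _ ≤ ‖b - c‖ + ‖r⁻¹ • y - c‖ := norm_sub_le _ _
    _ ≤ η := by linarith

theorem abs_increment_sub_contact_slope_le {g : E → ℝ} {C : ℝ} {a p : E}
    (hlow : ∀ z, g a + ⟪p, z - a⟫ - C * ‖z - a‖ ^ 2 ≤ g z)
    (hup : ∀ z, g z ≤ g a + ⟪p, z - a⟫) (hC : 0 ≤ C) (y h : E) {r : ℝ}
    (hy : ‖y - a‖ ≤ r) (hyh : ‖y + h - a‖ ≤ r) :
    |g (y + h) - g y - ⟪p, h⟫| ≤ C * r ^ 2 := by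
  have l0 := hlow y
  have l1 := hlow (y + h)
  have u0 := hup y
  have u1 := hup (y + h)
  have hs : ⟪p, y + h - a⟫ = ⟪p, y - a⟫ + ⟪p, h⟫ := by
    rw [← inner_add_right]; congr 1; abel
  have q0 : C * ‖y - a‖ ^ 2 ≤ C * r ^ 2 := by gcongr
  have q1 : C * ‖y + h - a‖ ^ 2 ≤ C * r ^ 2 := by gcongr
  rw [hs] at l1 u1
  rw [abs_le]
  constructor <;> linarith

/-- A semiconvex function has a second order expansion at every density point of the set of its
contact points with planes from above at which the contact slope is differentiable. -/
theorem second_order_expansion_of_contact {g : E → ℝ} {C : ℝ} (hC : 0 ≤ C) {S : Set E}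
    {P : E → E} {x : E} (D : E →L[ℝ] E)
    (hlow : ∀ a ∈ S, ∀ z, g a + ⟪P a, z - a⟫ - C * ‖z - a‖ ^ 2 ≤ g z)
    (hup : ∀ a ∈ S, ∀ z, g z ≤ g a + ⟪P a, z - a⟫)
    (hD : HasFDerivWithinAt P D S x)
    (hdense : ∀ η : ℝ, 0 < η → ∀ᶠ r in nhdsWithin (0 : ℝ) (Ioi 0),
      ∀ y : E, ‖y‖ ≤ r → ∃ a ∈ S, ‖a - (x + y)‖ ≤ η * r)
    {ε : ℝ} (hε : 0 < ε) :
    ∀ᶠ h in nhds (0 : E),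
      |g (x + h) - g x - ⟪P x, h⟫ - 1 / 2 * ⟪D h, h⟫| ≤ ε * ‖h‖ ^ 2 := by
  set M := ‖D‖ with hM
  have hM0 : 0 ≤ M := norm_nonneg _
  obtain ⟨N, hN⟩ := exists_nat_gt (max 1 ((4 * C + 2 * M) / (ε / 2)))
  have hN1 : (1 : ℝ) < N := (le_max_left _ _).trans_lt hN
  have hN2 : (4 * C + 2 * M) / (ε / 2) < N := (le_max_right _ _).trans_lt hN
  set τ : ℝ := 1 / N with hτ
  have hN0 : (0 : ℝ) < N := by linarith
  have hτ0 : 0 < τ := by positivity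
  have hτ1 : τ ≤ 1 := by rw [hτ, div_le_one hN0]; exact hN1.le
  have hNτ : N * τ = 1 := by rw [hτ]; field_simp
  have hτN : (4 * C + 2 * M) * τ ≤ ε / 2 := by
    rw [div_lt_iff₀ (by positivity)] at hN2
    nlinarith
  have hDev : ∀ᶠ a in nhdsWithin x S, ‖P a - P x - D (a - x)‖ ≤ ε / 4 * ‖a - x‖ :=
    hD.isLittleO.def (by positivity)
  obtain ⟨ρ, hρ0, hρ⟩ := Metric.mem_nhdsWithin_iff.1 hDev
  have hden := hdense τ hτ0
  obtain ⟨σ, hσ0, hσ⟩ := Metric.mem_nhdsWithin_iff.1 hden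
  filter_upwards [Metric.ball_mem_nhds (0 : E) (show 0 < min σ (ρ / 2) by positivity)] with h hh
  rw [mem_ball_zero_iff, lt_min_iff] at hh
  by_cases hh0 : h = 0
  · simp [hh0]
  set r := ‖h‖ with hr
  have hr0 : 0 < r := norm_pos_iff.2 hh0
  have hnear : ∀ y : E, ‖y‖ ≤ r → ∃ a ∈ S, ‖a - (x + y)‖ ≤ τ * r :=
    hσ ⟨by rw [mem_ball_zero_iff, Real.norm_of_nonneg hr0.le]; exact hh.1, hr0⟩
  have step : ∀ k : ℕ, (k : ℝ) * τ ≤ 1 →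
      |g (x + ((k + 1 : ℝ) * τ) • h) - g (x + ((k : ℝ) * τ) • h) - τ * ⟪P x, h⟫
        - k * τ ^ 2 * ⟪D h, h⟫|
        ≤ (4 * C * τ + ε / 2 + M * τ) * r ^ 2 * τ := by
    intro k hk
    have hyk : ‖((k : ℝ) * τ) • h‖ ≤ r := by
      rw [norm_smul, Real.norm_of_nonneg (by positivity)]
      nlinarith
    obtain ⟨a, haS, ha⟩ := hnear _ hyk
    have hax : ‖a - x‖ ≤ 2 * r := by
      calc ‖a - x‖ = ‖(a - (x + ((k : ℝ) * τ) • h)) + ((k : ℝ) * τ) • h‖ := by congr 1; abel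
        _ ≤ τ * r + r := (norm_add_le _ _).trans (add_le_add ha hyk)
        _ ≤ 2 * r := by nlinarith
    have hPa : ‖P a - P x - D (a - x)‖ ≤ ε / 4 * (2 * r) := by
      have : ‖P a - P x - D (a - x)‖ ≤ ε / 4 * ‖a - x‖ := by
        refine hρ ⟨?_, haS⟩
        rw [mem_ball, dist_eq_norm]
        linarith
      exact this.trans (by gcongr)
    set y0 := x + ((k : ℝ) * τ) • h with hy0
    set y1 := x + ((k + 1 : ℝ) * τ) • h with hy1
    have hy10 : y1 = y0 + τ • h := by
      rw [hy0, hy1, add_mul, add_smul, one_mul]; abel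
    have hn0 : ‖y0 - a‖ ≤ τ * r := by rw [norm_sub_rev]; exact ha
    have hn1 : ‖y0 + τ • h - a‖ ≤ 2 * (τ * r) := by
      rw [show y0 + τ • h - a = (y0 - a) + τ • h by abel]
      refine (norm_add_le _ _).trans ?_
      rw [norm_smul, Real.norm_of_nonneg hτ0.le]
      linarith
    have hinc := abs_increment_sub_contact_slope_le (hlow a haS) (hup a haS) hC y0 (τ • h)
      (hn0.trans (by linarith [norm_nonneg (y0 - a)])) hn1
    rw [← hy10, real_inner_smul_right] at hinc
    have hsplit : ⟪P a, h⟫ = ⟪P x, h⟫ + k * τ * ⟪D h, h⟫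
        + ⟪P a - P x - D (a - x), h⟫ + ⟪D (a - y0), h⟫ := by
      have : D (a - x) = D (a - y0) + (k * τ) • D h := by
        rw [← map_smul, ← map_add]; congr 1; rw [hy0]; abel
      rw [inner_sub_left, inner_sub_left, this, inner_add_left, real_inner_smul_left]
      ring
    have e1 : |⟪P a - P x - D (a - x), h⟫| ≤ ε / 2 * r ^ 2 := by
      refine (abs_real_inner_le_norm _ _).trans ?_
      rw [← hr]
      nlinarith
    have e2 : |⟪D (a - y0), h⟫| ≤ M * τ * r ^ 2 := by
      refine (abs_real_inner_le_norm _ _).trans ?_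
      rw [← hr]
      have : ‖D (a - y0)‖ ≤ M * (τ * r) := (D.le_opNorm _).trans (by gcongr)
      nlinarith
    have hsum : g y1 - g y0 - τ * ⟪P x, h⟫ - k * τ ^ 2 * ⟪D h, h⟫
        = (g y1 - g y0 - τ * ⟪P a, h⟫) + τ * ⟪P a - P x - D (a - x), h⟫
          + τ * ⟪D (a - y0), h⟫ := by
      rw [hsplit]; ring
    rw [hsum]
    refine (abs_add_three _ _ _).trans ?_
    rw [abs_mul, abs_mul, abs_of_pos hτ0]
    calc _ ≤ C * (2 * (τ * r)) ^ 2 + τ * (ε / 2 * r ^ 2) + τ * (M * τ * r ^ 2) := by gcongr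
      _ = _ := by ring
  have chain : ∀ k : ℕ, (k : ℝ) * τ ≤ 1 →
      |g (x + ((k : ℝ) * τ) • h) - g x - k * τ * ⟪P x, h⟫
        - k * (k - 1) / 2 * τ ^ 2 * ⟪D h, h⟫|
        ≤ k * ((4 * C * τ + ε / 2 + M * τ) * r ^ 2 * τ) := by
    intro k
    induction k with
    | zero => intro _; simp
    | succ k ih =>
      intro hk
      push_cast at hk ⊢
      have hk' : (k : ℝ) * τ ≤ 1 := by nlinarith
      have hsum : ∀ A B G c d : ℝ,
          A - G - (k + 1) * τ * c - (k + 1) * ((k : ℝ) + 1 - 1) / 2 * τ ^ 2 * d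
            = (B - G - k * τ * c - k * (k - 1) / 2 * τ ^ 2 * d)
              + (A - B - τ * c - k * τ ^ 2 * d) := by
        intros; ring
      rw [hsum _ (g (x + ((k : ℝ) * τ) • h))]
      exact ((abs_add_le _ _).trans (add_le_add (ih hk') (step k hk'))).trans_eq (by ring)
  have fin := chain N hNτ.le
  rw [hNτ, one_smul, one_mul] at fin
  have hco : (N : ℝ) * (N - 1) / 2 * τ ^ 2 = 1 / 2 - τ / 2 := by
    have : (N : ℝ) * (N - 1) / 2 * τ ^ 2 = (N * τ) ^ 2 / 2 - (N * τ) * τ / 2 := by ring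
    rw [this, hNτ]; ring
  have hbd : (N : ℝ) * ((4 * C * τ + ε / 2 + M * τ) * r ^ 2 * τ)
      = (4 * C * τ + ε / 2 + M * τ) * r ^ 2 := by
    have : (N : ℝ) * ((4 * C * τ + ε / 2 + M * τ) * r ^ 2 * τ)
      = (N * τ) * ((4 * C * τ + ε / 2 + M * τ) * r ^ 2) := by ring
    rw [this, hNτ, one_mul]
  rw [hco, hbd] at fin
  have hDh : |⟪D h, h⟫| ≤ M * r ^ 2 := by
    refine (abs_real_inner_le_norm _ _).trans ?_
    have := D.le_opNorm h
    rw [← hr] at this ⊢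
    nlinarith
  have hsum : g (x + h) - g x - ⟪P x, h⟫ - 1 / 2 * ⟪D h, h⟫
      = (g (x + h) - g x - ⟪P x, h⟫ - (1 / 2 - τ / 2) * ⟪D h, h⟫)
        + -(τ / 2) * ⟪D h, h⟫ := by ring
  rw [hsum]
  refine (abs_add_le _ _).trans ?_
  rw [abs_mul (-(τ / 2)), abs_neg, abs_of_pos (half_pos hτ0)]
  have s2 := mul_le_mul_of_nonneg_left hDh (half_pos hτ0).le
  have s3 := mul_le_mul_of_nonneg_right hτN (sq_nonneg r)
  have s4 : 0 ≤ M * τ * r ^ 2 := by positivity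
  linarith

end SecondOrderContact

section ExistsContact

variable {E : Type*} [NormedAddCommGroup E] [InnerProductSpace ℝ E]

theorem eq_zero_of_forall_inner_le_mul_sq {w : E} {C : ℝ} (h : ∀ z, ⟪w, z⟫ ≤ C * ‖z‖ ^ 2) :
    w = 0 := by
  by_contra hw
  have hpos : 0 < ‖w‖ ^ 2 := by positivity
  have hC : 0 < |C| + 1 := by positivity
  have h1 := h ((1 / (|C| + 1)) • w)
  rw [real_inner_smul_right, real_inner_self_eq_norm_sq, norm_smul,
    Real.norm_of_nonneg (by positivity), mul_pow] at h1
  have h2 : C * ((1 / (|C| + 1)) ^ 2 * ‖w‖ ^ 2)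
      = C / (|C| + 1) * (1 / (|C| + 1) * ‖w‖ ^ 2) := by field_simp
  have h3 : C / (|C| + 1) < 1 := by
    rw [div_lt_one hC]; linarith [le_abs_self C]
  have h4 : 0 < 1 / (|C| + 1) * ‖w‖ ^ 2 := by positivity
  rw [h2] at h1
  nlinarith

/-- A function with quadratic support from below at every point is continuous. -/
theorem continuous_of_forall_quadratic_support [FiniteDimensional ℝ E] {g : E → ℝ} {C : ℝ}
    (hsub : ∀ a, ∃ s : E, ∀ z, g a + ⟪s, z - a⟫ - C * ‖z - a‖ ^ 2 ≤ g z) : Continuous g := by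
  have hconv : ConvexOn ℝ univ (fun z => g z + C * ‖z‖ ^ 2) := by
    have hsupp : ∀ a, ∃ s : E, ∀ z, g a + C * ‖a‖ ^ 2 + ⟪s, z - a⟫ ≤ g z + C * ‖z‖ ^ 2 := by
      intro a
      obtain ⟨s, hs⟩ := hsub a
      refine ⟨s + (2 * C) • a, fun z => ?_⟩
      have h1 := hs z
      have h2 : ‖z‖ ^ 2 = ‖z - a‖ ^ 2 + 2 * ⟪a, z - a⟫ + ‖a‖ ^ 2 := by
        have := norm_add_sq_real (z - a) a
        rw [sub_add_cancel, real_inner_comm] at this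
        exact this
      rw [inner_add_left, real_inner_smul_left, h2]
      linarith
    refine ⟨convex_univ, fun x _ y _ a b ha hb hab => ?_⟩
    obtain ⟨s, hs⟩ := hsupp (a • x + b • y)
    have h1 := mul_le_mul_of_nonneg_left (hs x) ha
    have h2 := mul_le_mul_of_nonneg_left (hs y) hb
    have h3 : a * ⟪s, x - (a • x + b • y)⟫ + b * ⟪s, y - (a • x + b • y)⟫ = 0 := by
      rw [← real_inner_smul_right, ← real_inner_smul_right, ← inner_add_right]
      have : a • (x - (a • x + b • y)) + b • (y - (a • x + b • y)) = 0 := by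
        obtain rfl : b = 1 - a := by linarith
        module
      rw [this, inner_zero_right]
    simp only [smul_eq_mul]
    set c := g (a • x + b • y) + C * ‖a • x + b • y‖ ^ 2
    have h4 : c = a * c + b * c := by rw [← add_mul, hab, one_mul]
    rw [h4]
    linarith
  have hc : Continuous (fun z => g z + C * ‖z‖ ^ 2) := by
    rw [← continuousOn_univ, ← hconv.locallyLipschitzOn_iff_continuousOn isOpen_univ]
    exact hconv.locallyLipschitzOn isOpen_univ
  have : g = fun z => (g z + C * ‖z‖ ^ 2) - C * ‖z‖ ^ 2 := by ext z; ring
  rw [this]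
  fun_prop

/-- Near a strict maximum point, a semiconvex function is touched from above by planes of
arbitrarily small slope at points where it has a second order expansion. -/
theorem exists_contact_with_second_order_expansion [FiniteDimensional ℝ E] {g : E → ℝ} {C δ : ℝ}
    (hC : 0 ≤ C) (hδ : 0 < δ) (h0 : 0 ≤ g 0) (hneg : ∀ z, g z ≤ -δ * ‖z‖ ^ 2)
    (hsub : ∀ a, ∃ s : E, ∀ z, g a + ⟪s, z - a⟫ - C * ‖z - a‖ ^ 2 ≤ g z)
    {ε : ℝ} (hε : 0 < ε) :
    ∃ (x p : E) (D : E →L[ℝ] E), ‖x‖ < ε ∧ ‖p‖ < ε ∧ (∀ z, g z ≤ g x + ⟪p, z - x⟫) ∧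
      ∀ η : ℝ, 0 < η → ∀ᶠ h in nhds (0 : E),
        |g (x + h) - g x - ⟪p, h⟫ - 1 / 2 * ⟪D h, h⟫| ≤ η * ‖h‖ ^ 2 := by
  borelize E
  set ρ := min ε (δ * ε) with hρ
  have hρ0 : 0 < ρ := by positivity
  have hcont := continuous_of_forall_quadratic_support hsub
  have hloc : ∀ x p : E, ‖p‖ < ρ → (∀ z, g z ≤ g x + ⟪p, z - x⟫) → ‖x‖ < ε := by
    intro x p hp hx
    have h1 := hx 0
    have h2 := hneg x
    rw [zero_sub, inner_neg_right] at h1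
    have h3 := (abs_le.1 (abs_real_inner_le_norm p x)).1
    have h4 : ‖p‖ < δ * ε := hp.trans_le (min_le_right _ _)
    by_contra! hcon
    have h5 : 0 < ‖x‖ := hε.trans_le hcon
    nlinarith [mul_pos h5 (sub_pos.2 h4), mul_nonneg hδ.le (mul_nonneg h5.le (sub_nonneg.2 hcon))]
  have hex : ∀ p : E, ‖p‖ < ρ → ∃ x, ∀ z, g z ≤ g x + ⟪p, z - x⟫ := by
    intro p hp
    obtain ⟨x, hxB, hx⟩ := (isCompact_closedBall (0 : E) ε).exists_isMaxOn
      ⟨0, by simp [hε.le]⟩ (f := fun z => g z - ⟪p, z⟫) (by fun_prop)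
    refine ⟨x, fun z => ?_⟩
    suffices g z - ⟪p, z⟫ ≤ g x - ⟪p, x⟫ by rw [inner_sub_right]; linarith
    by_cases hz : z ∈ closedBall (0 : E) ε
    · exact hx hz
    · have h1 : g 0 - ⟪p, 0⟫ ≤ g x - ⟪p, x⟫ := hx (by simp [hε.le])
      rw [inner_zero_right, sub_zero] at h1
      rw [mem_closedBall_zero_iff, not_le] at hz
      have h2 := hneg z
      have h3 := (abs_le.1 (abs_real_inner_le_norm p z)).1
      have h4 : ‖p‖ < δ * ε := hp.trans_le (min_le_right _ _)
      have h5 : 0 < ‖z‖ := hε.trans hz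
      nlinarith [mul_pos h5 (sub_pos.2 h4), mul_pos hδ (mul_pos h5 (sub_pos.2 hz))]
  set S : Set E := {x | ∃ p : E, ‖p‖ < ρ ∧ ∀ z, g z ≤ g x + ⟪p, z - x⟫} with hS
  choose! P hPρ hPup using fun x (hx : x ∈ S) => hx
  have hlow' : ∀ x p : E, (∀ z, g z ≤ g x + ⟪p, z - x⟫) →
      ∀ z, g x + ⟪p, z - x⟫ - C * ‖z - x‖ ^ 2 ≤ g z := by
    intro x p hp
    obtain ⟨s, hs⟩ := hsub x
    have : s - p = 0 := by
      refine eq_zero_of_forall_inner_le_mul_sq (C := C) fun h => ?_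
      have h1 := hs (x + h)
      have h2 := hp (x + h)
      rw [add_sub_cancel_left] at h1 h2
      rw [inner_sub_left]
      linarith
    rwa [← sub_eq_zero.1 this]
  have hPlow : ∀ a ∈ S, ∀ z, g a + ⟪P a, z - a⟫ - C * ‖z - a‖ ^ 2 ≤ g z :=
    fun a ha => hlow' a (P a) (hPup a ha)
  have hlip : LipschitzOnWith (4 * C).toNNReal P S := by
    refine LipschitzOnWith.of_dist_le_mul fun a ha b hb => ?_
    rw [dist_eq_norm, dist_eq_norm, Real.coe_toNNReal _ (by positivity)]
    exact norm_contact_slope_sub_le hC (hPlow a ha) (hPup a ha) (hPup b hb)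
  have himage : ball (0 : E) ρ ⊆ P '' S := by
    intro p hp
    rw [mem_ball_zero_iff] at hp
    obtain ⟨x, hx⟩ := hex p hp
    have hxS : x ∈ S := ⟨p, hp, hx⟩
    refine ⟨x, hxS, ?_⟩
    have := norm_contact_slope_sub_le hC (hPlow x hxS) (hPup x hxS) hx
    rw [sub_self, norm_zero, mul_zero] at this
    exact sub_eq_zero.1 (norm_le_zero_iff.1 this)
  let μ : Measure E := μH[Module.finrank ℝ E]
  have hμ : μ.IsAddHaarMeasure := isAddHaarMeasure_hausdorffMeasure
  have hSpos : μ S ≠ 0 := by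
    intro hzero
    have h1 : μ (P '' S) ≤ _ := hlip.hausdorffMeasure_image_le (Nat.cast_nonneg _)
    have h2 : μ (P '' S) = 0 := by
      refine le_antisymm (h1.trans ?_) zero_le
      change _ * μ S ≤ 0
      rw [hzero, mul_zero]
    exact (measure_ball_pos μ (0 : E) hρ0).ne' (measure_mono_null himage h2)
  have hdiff := hlip.ae_differentiableWithinAt_of_mem (μ := μ)
  have hdens := ae_imp_of_ae_restrict (Besicovitch.ae_tendsto_measure_inter_div μ S)
  obtain ⟨x, hxS, hxd, hxt⟩ : ∃ x ∈ S, DifferentiableWithinAt ℝ P S x ∧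
      Filter.Tendsto (fun r => μ (S ∩ closedBall x r) / μ (closedBall x r))
        (nhdsWithin 0 (Ioi 0)) (nhds 1) := by
    by_contra! hcon
    refine hSpos (measure_mono_null ?_ (hdiff.and hdens))
    intro x hx hgood
    exact hcon x hx (hgood.1 hx) (hgood.2 hx)
  exact ⟨x, P x, fderivWithin ℝ P S x, hloc x (P x) (hPρ x hxS) (hPup x hxS),
    (hPρ x hxS).trans_le (min_le_left _ _), hPup x hxS,
    fun η hη => second_order_expansion_of_contact hC _ hPlow hPup hxd.hasFDerivWithinAt
      (fun η' hη' => eventually_exists_mem_near_of_density_one μ hxt hη') hη⟩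

end ExistsContact

section TheoremOnSums

variable {H : Type*} [NormedAddCommGroup H] [InnerProductSpace ℝ H]

/-- `Uhat` is the sup-convolution of the restriction of `U` to the closed ball of radius `r`, with
maximizers `m`. -/
structure IsSupConvolution_s1 (U : H → ℝ) (r C : ℝ) (Uhat : H → ℝ) (m : H → H) : Prop where
  mem : ∀ x, m x ∈ closedBall (0 : H) r
  eq : ∀ x, Uhat x = U (m x) - C * ‖m x - x‖ ^ 2
  le : ∀ x, ∀ z ∈ closedBall (0 : H) r, U z - C * ‖z - x‖ ^ 2 ≤ Uhat x

theorem exists_isSupConvolution_s1 [FiniteDimensional ℝ H] {U : H → ℝ} {r : ℝ} (hr : 0 ≤ r)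
    (hU : ContinuousOn U (closedBall 0 r)) (C : ℝ) :
    ∃ Uhat m, IsSupConvolution_s1 U r C Uhat m := by
  have h : ∀ x, ∃ z ∈ closedBall (0 : H) r,
      IsMaxOn (fun z => U z - C * ‖z - x‖ ^ 2) (closedBall (0 : H) r) z := fun x =>
    (isCompact_closedBall (0 : H) r).exists_isMaxOn ⟨0, by simp [hr]⟩
      (hU.sub (Continuous.continuousOn (by fun_prop)))
  choose m hm hmax using h
  exact ⟨fun x => U (m x) - C * ‖m x - x‖ ^ 2, m, hm, fun _ => rfl, fun x z hz => hmax x hz⟩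

theorem IsSupConvolution_s1.support {U Uhat : H → ℝ} {r C : ℝ} {m : H → H}
    (h : IsSupConvolution_s1 U r C Uhat m) (a z : H) :
    Uhat a + ⟪(2 * C) • (m a - a), z - a⟫ - C * ‖z - a‖ ^ 2 ≤ Uhat z := by
  have h1 := h.le z (m a) (h.mem a)
  have h2 : ‖m a - z‖ ^ 2 = ‖m a - a‖ ^ 2 - 2 * ⟪m a - a, z - a⟫ + ‖z - a‖ ^ 2 := by
    rw [← norm_sub_sq_real]; congr 2; abel
  rw [h2] at h1
  rw [h.eq a, real_inner_smul_left]
  linarith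

/-- A paraboloid touching a sup-convolution from above yields, after translation, a paraboloid
with the same slope and Hessian touching the original function from above. -/
theorem IsSupConvolution_s1.isLocalMax {U Uhat : H → ℝ} {r C : ℝ} {m : H → H}
    (h : IsSupConvolution_s1 U r C Uhat m) {x p : H} {X : H →L[ℝ] H} (hx : ‖m x‖ < r)
    (htouch : ∀ᶠ z in nhds (0 : H), Uhat (x + z) ≤ Uhat x + ⟪p, z⟫ + 1 / 2 * ⟪X z, z⟫) :
    IsLocalMax (fun z => U z - (⟪p, z - m x⟫ + 1 / 2 * ⟪X (z - m x), z - m x⟫)) (m x) := by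
  have ht : Filter.Tendsto (fun z => z - m x) (nhds (m x)) (nhds 0) := by
    have : Continuous fun z : H => z - m x := by fun_prop
    simpa using this.tendsto (m x)
  filter_upwards [ht.eventually htouch, isOpen_ball.mem_nhds (mem_ball_zero_iff.2 hx)] with z hz hzr
  have h1 := h.le (x + (z - m x)) z (ball_subset_closedBall hzr)
  rw [show z - (x + (z - m x)) = m x - x by abel] at h1
  rw [h.eq x] at hz
  simp only [sub_self, map_zero, inner_zero_right, mul_zero, add_zero, sub_zero]
  linarith

theorem nonpos_of_sq_homogeneous {c : H → ℝ} (hc : ∀ (t : ℝ) z, c (t • z) = t ^ 2 * c z)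
    (h : ∀ η : ℝ, 0 < η → ∀ᶠ z in nhds (0 : H), c z ≤ η * ‖z‖ ^ 2) (z : H) : c z ≤ 0 := by
  by_contra! hz
  set η := c z / (2 * (‖z‖ ^ 2 + 1)) with hη
  have hη0 : 0 < η := by positivity
  have ht : Filter.Tendsto (fun t : ℝ => t • z) (nhdsWithin 0 (Ioi 0)) (nhds 0) := by
    have : Continuous fun t : ℝ => t • z := by fun_prop
    simpa using (this.tendsto 0).mono_left nhdsWithin_le_nhds
  obtain ⟨t, h1, ht0⟩ := ((ht.eventually (h η hη0)).and self_mem_nhdsWithin).exists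
  have ht0 : 0 < t := ht0
  rw [hc, norm_smul, mul_pow, Real.norm_eq_abs, sq_abs] at h1
  have h2 : c z ≤ η * ‖z‖ ^ 2 := by
    refine le_of_mul_le_mul_left ?_ (pow_pos ht0 2)
    linarith
  have h3 : η * (2 * (‖z‖ ^ 2 + 1)) = c z := by rw [hη]; field_simp
  nlinarith [sq_nonneg ‖z‖]

/-- The restriction of a quadratic form along a linear map is given by a symmetric operator. -/
theorem exists_symmetric_pullback [CompleteSpace H] {E : Type*} [NormedAddCommGroup E]
    [InnerProductSpace ℝ E] [CompleteSpace E] (B : E →L[ℝ] E) (J : H →L[ℝ] E) (c : ℝ) :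
    ∃ X : H →L[ℝ] H, (∀ h k, ⟪X h, k⟫ = ⟪h, X k⟫) ∧
      ∀ h, ⟪X h, h⟫ = ⟪B (J h), J h⟫ + c * ‖h‖ ^ 2 := by
  let A : H →L[ℝ] H := (ContinuousLinearMap.adjoint J) ∘L B ∘L J
  refine ⟨(1 / 2 : ℝ) • (A + ContinuousLinearMap.adjoint A) + c • ContinuousLinearMap.id ℝ H,
    fun h k => ?_, fun h => ?_⟩
  · simp only [_root_.add_apply, _root_.smul_apply,
      ContinuousLinearMap.id_apply, inner_add_left, inner_add_right, real_inner_smul_left,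
      real_inner_smul_right, ContinuousLinearMap.adjoint_inner_left,
      ContinuousLinearMap.adjoint_inner_right]
    ring
  · have hA : ⟪A h, h⟫ = ⟪B (J h), J h⟫ := by
      simp [A, ContinuousLinearMap.adjoint_inner_left]
    simp only [_root_.add_apply, _root_.smul_apply,
      ContinuousLinearMap.id_apply, inner_add_left, real_inner_smul_left,
      ContinuousLinearMap.adjoint_inner_left, real_inner_self_eq_norm_sq]
    rw [real_inner_comm (A h) h, hA]
    ring

/-- Upper bound of a quadratic form by its value at a nearby point. -/
theorem half_inner_le_add_sq {E : Type*} [NormedAddCommGroup E] [InnerProductSpace ℝ E]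
    {T : E →L[ℝ] E} (hT : ∀ x y, ⟪T x, y⟫ = ⟪x, T y⟫) {δ : ℝ} (hδ : 0 < δ) (z ξ : E) :
    1 / 2 * ⟪T z, z⟫ ≤ 1 / 2 * ⟪T ξ, ξ⟫ + δ * ‖ξ‖ ^ 2
      + (‖T‖ ^ 2 / (4 * δ) + ‖T‖ / 2) * ‖z - ξ‖ ^ 2 := by
  obtain ⟨h, rfl⟩ : ∃ h, z = ξ + h := ⟨z - ξ, by abel⟩
  rw [add_sub_cancel_left, map_add, inner_add_left, inner_add_right, inner_add_right, hT h ξ,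
    real_inner_comm (T ξ) h]
  have h1 : ⟪T ξ, h⟫ ≤ ‖T‖ * ‖ξ‖ * ‖h‖ :=
    (real_inner_le_norm _ _).trans (by gcongr; exact T.le_opNorm _)
  have h2 : ⟪T h, h⟫ ≤ ‖T‖ * ‖h‖ * ‖h‖ :=
    (real_inner_le_norm _ _).trans (by gcongr; exact T.le_opNorm _)
  have h3 : ‖T‖ * ‖ξ‖ * ‖h‖ ≤ δ * ‖ξ‖ ^ 2 + ‖T‖ ^ 2 / (4 * δ) * ‖h‖ ^ 2 := by
    have : δ * ‖ξ‖ ^ 2 + ‖T‖ ^ 2 / (4 * δ) * ‖h‖ ^ 2 - ‖T‖ * ‖ξ‖ * ‖h‖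
        = δ * (‖ξ‖ - ‖T‖ * ‖h‖ / (2 * δ)) ^ 2 := by field_simp; ring
    have h4 : 0 ≤ δ * (‖ξ‖ - ‖T‖ * ‖h‖ / (2 * δ)) ^ 2 := by positivity
    linarith
  nlinarith

/-- Quadratic support from below of a separated sum minus a quadratic form. -/
theorem quadratic_support_sub {E : Type*} [NormedAddCommGroup E] [InnerProductSpace ℝ E]
    {W : E → ℝ} {C : ℝ} {T : E →L[ℝ] E} (hT : ∀ x y, ⟪T x, y⟫ = ⟪x, T y⟫) {δ : ℝ} (a s : E)
    (hs : ∀ z, W a + ⟪s, z - a⟫ - C * ‖z - a‖ ^ 2 ≤ W z) (z : E) :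
    (W a - 1 / 2 * ⟪T a, a⟫ - 2 * δ * ‖a‖ ^ 2) + ⟪s - T a - (4 * δ) • a, z - a⟫
        - (C + ‖T‖ / 2 + 2 * δ) * ‖z - a‖ ^ 2
      ≤ W z - 1 / 2 * ⟪T z, z⟫ - 2 * δ * ‖z‖ ^ 2 := by
  have hz := hs z
  obtain ⟨h, rfl⟩ : ∃ h, z = a + h := ⟨z - a, by abel⟩
  rw [add_sub_cancel_left] at *
  have h2 : ⟪T h, h⟫ ≤ ‖T‖ * ‖h‖ * ‖h‖ :=
    (real_inner_le_norm _ _).trans (by gcongr; exact T.le_opNorm _)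
  rw [map_add, inner_add_left, inner_add_right, inner_add_right, hT h a,
    real_inner_comm (T a) h, norm_add_sq_real, inner_sub_left, inner_sub_left,
    real_inner_smul_left]
  nlinarith

/-- The theorem on sums for a quadratic penalization. -/
theorem theorem_on_sums [FiniteDimensional ℝ H] {U V : H → ℝ} {r : ℝ} (hr : 0 < r)
    (hU : ContinuousOn U (closedBall 0 r)) (hV : ContinuousOn V (closedBall 0 r))
    {T : WithLp 2 (H × H) →L[ℝ] WithLp 2 (H × H)} (hT : ∀ x y, ⟪T x, y⟫ = ⟪x, T y⟫)
    (h0 : U 0 + V 0 = 0)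
    (hUV : ∀ z : WithLp 2 (H × H), z.fst ∈ closedBall (0 : H) r → z.snd ∈ closedBall (0 : H) r →
      U z.fst + V z.snd ≤ 1 / 2 * ⟪T z, z⟫) {ε : ℝ} (hε : 0 < ε) :
    ∃ (x y p q : H) (X Y : H →L[ℝ] H), ‖x‖ < ε ∧ ‖y‖ < ε ∧ ‖p‖ < ε ∧ ‖q‖ < ε ∧
      (∀ h k, ⟪X h, k⟫ = ⟪h, X k⟫) ∧ (∀ h k, ⟪Y h, k⟫ = ⟪h, Y k⟫) ∧
      IsLocalMax (fun z => U z - (⟪p, z - x⟫ + 1 / 2 * ⟪X (z - x), z - x⟫)) x ∧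
      IsLocalMax (fun z => V z - (⟪q, z - y⟫ + 1 / 2 * ⟪Y (z - y), z - y⟫)) y ∧
      ∀ z : WithLp 2 (H × H),
        ⟪X z.fst, z.fst⟫ + ⟪Y z.snd, z.snd⟫ ≤ ⟪T z, z⟫ + ε * ‖z‖ ^ 2 := by
  set M := ‖T‖ with hM
  have hM0 : 0 ≤ M := norm_nonneg T
  set δ := ε / 6 with hδdef
  have hδ : 0 < δ := by positivity
  set C := M ^ 2 / (4 * δ) + M / 2 + 1 with hC
  have hC0 : 0 ≤ C := by positivity
  obtain ⟨Uhat, m₁, hm₁⟩ := exists_isSupConvolution_s1 hr.le hU C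
  obtain ⟨Vhat, m₂, hm₂⟩ := exists_isSupConvolution_s1 hr.le hV C
  let J₁ : H →L[ℝ] WithLp 2 (H × H) :=
    ((WithLp.prodContinuousLinearEquiv 2 ℝ H H).symm : H × H →L[ℝ] WithLp 2 (H × H)) ∘L
      ContinuousLinearMap.inl ℝ H H
  let J₂ : H →L[ℝ] WithLp 2 (H × H) :=
    ((WithLp.prodContinuousLinearEquiv 2 ℝ H H).symm : H × H →L[ℝ] WithLp 2 (H × H)) ∘L
      ContinuousLinearMap.inr ℝ H H
  have J₁_fst : ∀ h, (J₁ h).fst = h := fun h => rfl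
  have J₁_snd : ∀ h, (J₁ h).snd = 0 := fun h => rfl
  have J₂_fst : ∀ h, (J₂ h).fst = 0 := fun h => rfl
  have J₂_snd : ∀ h, (J₂ h).snd = h := fun h => rfl
  let W : WithLp 2 (H × H) → ℝ := fun z => Uhat z.fst + Vhat z.snd
  have hinner : ∀ a b : WithLp 2 (H × H), ⟪a, b⟫ = ⟪a.fst, b.fst⟫ + ⟪a.snd, b.snd⟫ :=
    fun a b => WithLp.prod_inner_apply a b
  have hnorm : ∀ a : WithLp 2 (H × H), ‖a‖ ^ 2 = ‖a.fst‖ ^ 2 + ‖a.snd‖ ^ 2 :=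
    fun a => WithLp.prod_norm_sq_eq_of_L2 a
  have hfst : ∀ a : WithLp 2 (H × H), ‖a.fst‖ ≤ ‖a‖ := fun a =>
    le_of_sq_le_sq (by rw [hnorm]; linarith [sq_nonneg ‖a.snd‖]) (norm_nonneg _)
  have hsnd : ∀ a : WithLp 2 (H × H), ‖a.snd‖ ≤ ‖a‖ := fun a =>
    le_of_sq_le_sq (by rw [hnorm]; linarith [sq_nonneg ‖a.fst‖]) (norm_nonneg _)
  let m : WithLp 2 (H × H) → WithLp 2 (H × H) := fun z => WithLp.toLp 2 (m₁ z.fst, m₂ z.snd)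
  have hWsupp : ∀ a z, W a + ⟪(2 * C) • (m a - a), z - a⟫ - C * ‖z - a‖ ^ 2 ≤ W z := by
    intro a z
    have h1 := hm₁.support a.fst z.fst
    have h2 := hm₂.support a.snd z.snd
    have h3 : ⟪(2 * C) • (m a - a), z - a⟫ = ⟪(2 * C) • (m₁ a.fst - a.fst), z.fst - a.fst⟫
        + ⟪(2 * C) • (m₂ a.snd - a.snd), z.snd - a.snd⟫ := hinner _ _
    have h4 : ‖z - a‖ ^ 2 = ‖z.fst - a.fst‖ ^ 2 + ‖z.snd - a.snd‖ ^ 2 := hnorm _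
    rw [h3, h4]
    simp only [W]
    linarith
  have hWle : ∀ z, W z ≤ 1 / 2 * ⟪T z, z⟫ + δ * ‖z‖ ^ 2 - ‖m z - z‖ ^ 2 := by
    intro z
    have h1 := hUV (m z) (hm₁.mem _) (hm₂.mem _)
    have h2 := half_inner_le_add_sq hT hδ (m z) z
    have h3 : W z = U (m z).fst + V (m z).snd - C * ‖m z - z‖ ^ 2 := by
      have h4 : ‖m z - z‖ ^ 2 = ‖m₁ z.fst - z.fst‖ ^ 2 + ‖m₂ z.snd - z.snd‖ ^ 2 := hnorm _
      have h5 : (m z).fst = m₁ z.fst := rfl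
      have h6 : (m z).snd = m₂ z.snd := rfl
      show Uhat z.fst + Vhat z.snd = _
      rw [hm₁.eq, hm₂.eq, h4, h5, h6]
      ring
    rw [h3, hC]
    linarith
  set g : WithLp 2 (H × H) → ℝ := fun z => W z - 1 / 2 * ⟪T z, z⟫ - 2 * δ * ‖z‖ ^ 2 with hg
  have hgle : ∀ z, g z ≤ -δ * ‖z‖ ^ 2 - ‖m z - z‖ ^ 2 := by
    intro z
    have := hWle z
    simp only [hg]
    linarith
  have hg0 : 0 ≤ g 0 := by
    have h1 := hm₁.le 0 0 (by simp [hr.le])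
    have h2 := hm₂.le 0 0 (by simp [hr.le])
    have h3 : W 0 = Uhat 0 + Vhat 0 := rfl
    simp only [hg, h3]
    simp at h1 h2 ⊢
    linarith
  set ε' := min (ε / (2 * (1 + M + 4 * δ))) (r / 4) with hε'
  have hε'0 : 0 < ε' := by positivity
  have hε'2 : ε' * (2 * (1 + M + 4 * δ)) ≤ ε := by
    rw [← le_div_iff₀ (by positivity)]
    exact min_le_left _ _
  have hε'1 : ε' * (1 + M + 4 * δ) < ε := by linarith
  have hε'3 : 2 * ε' < r := by linarith [min_le_right (ε / (2 * (1 + M + 4 * δ))) (r / 4)]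
  obtain ⟨ξ, p, D, hξ, hp, hup, hexp⟩ := exists_contact_with_second_order_expansion
    (g := g) (C := C + M / 2 + 2 * δ) (by positivity) hδ hg0
    (fun z => (hgle z).trans (by linarith [sq_nonneg ‖m z - z‖]))
    (fun a => ⟨_, quadratic_support_sub hT a _ (hWsupp a)⟩) hε'0
  have hmξ : ‖m ξ - ξ‖ ≤ ε' := by
    refine le_of_sq_le_sq ?_ hε'0.le
    have h1 := hup 0
    rw [zero_sub, inner_neg_right] at h1
    have h2 := (abs_le.1 (abs_real_inner_le_norm p ξ)).1
    have h3 := hgle ξ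
    have h4 : ‖p‖ * ‖ξ‖ ≤ ε' * ε' := by gcongr
    nlinarith [mul_nonneg hδ.le (sq_nonneg ‖ξ‖)]
  have hmξ2 : ‖m ξ‖ < 2 * ε' := by
    calc ‖m ξ‖ = ‖(m ξ - ξ) + ξ‖ := by rw [sub_add_cancel]
      _ ≤ _ := norm_add_le _ _
      _ < _ := by linarith
  have hε2 : ‖m ξ‖ < ε := hmξ2.trans_le (by nlinarith [mul_nonneg hε'0.le hM0, mul_pos hε'0 hδ])
  set P := p + T ξ + (4 * δ) • ξ with hP
  have hPn : ‖P‖ < ε := by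
    refine lt_of_le_of_lt ?_ hε'1
    have h1 : ‖T ξ‖ ≤ M * ε' := (T.le_opNorm _).trans (by gcongr)
    have h2 : ‖(4 * δ) • ξ‖ ≤ 4 * δ * ε' := by
      rw [norm_smul, Real.norm_of_nonneg (by positivity)]; gcongr
    calc ‖P‖ ≤ ‖p‖ + ‖T ξ‖ + ‖(4 * δ) • ξ‖ := norm_add₃_le
      _ ≤ ε' + M * ε' + 4 * δ * ε' := by gcongr
      _ = _ := by ring
  let B := D + T + (4 * δ) • ContinuousLinearMap.id ℝ (WithLp 2 (H × H))
  have hB : ∀ h, ⟪B h, h⟫ = ⟪D h, h⟫ + ⟪T h, h⟫ + 4 * δ * ‖h‖ ^ 2 := by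
    intro h
    simp only [B, _root_.add_apply, _root_.smul_apply,
      ContinuousLinearMap.id_apply, inner_add_left, real_inner_smul_left,
      real_inner_self_eq_norm_sq]
  have hW : ∀ η : ℝ, 0 < η → ∀ᶠ h in nhds (0 : WithLp 2 (H × H)),
      |W (ξ + h) - W ξ - ⟪P, h⟫ - 1 / 2 * ⟪B h, h⟫| ≤ η * ‖h‖ ^ 2 := by
    intro η hη
    filter_upwards [hexp η hη] with h hh
    convert hh using 2
    have hTexp : ⟪T (ξ + h), ξ + h⟫ = ⟪T ξ, ξ⟫ + 2 * ⟪T ξ, h⟫ + ⟪T h, h⟫ := by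
      rw [map_add, inner_add_left, inner_add_right, inner_add_right, hT h ξ,
        real_inner_comm (T ξ) h]
      ring
    simp only [hg]
    rw [hB, hTexp, norm_add_sq_real, hP, inner_add_left, inner_add_left, real_inner_smul_left]
    ring
  have hDneg : ∀ z, ⟪D z, z⟫ ≤ 0 := by
    refine nonpos_of_sq_homogeneous (fun t z => ?_) fun η hη => ?_
    · rw [map_smul, real_inner_smul_left, real_inner_smul_right]; ring
    · filter_upwards [hexp (η / 2) (half_pos hη)] with h hh
      have h1 := hup (ξ + h)
      rw [add_sub_cancel_left] at h1
      have h2 := (abs_le.1 hh).1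
      linarith
  have tJ₁ : Filter.Tendsto J₁ (nhds 0) (nhds 0) := by simpa using J₁.continuous.tendsto 0
  have tJ₂ : Filter.Tendsto J₂ (nhds 0) (nhds 0) := by simpa using J₂.continuous.tendsto 0
  have nJ₁ : ∀ h, ‖J₁ h‖ ^ 2 = ‖h‖ ^ 2 := fun h => by simp [hnorm, J₁_fst, J₁_snd]
  have nJ₂ : ∀ h, ‖J₂ h‖ ^ 2 = ‖h‖ ^ 2 := fun h => by simp [hnorm, J₂_fst, J₂_snd]
  have iJ₁ : ∀ h, ⟪P, J₁ h⟫ = ⟪P.fst, h⟫ := fun h => by simp [hinner, J₁_fst, J₁_snd]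
  have iJ₂ : ∀ h, ⟪P, J₂ h⟫ = ⟪P.snd, h⟫ := fun h => by simp [hinner, J₂_fst, J₂_snd]
  have wJ₁ : ∀ h, W (ξ + J₁ h) - W ξ = Uhat (ξ.fst + h) - Uhat ξ.fst := fun h => by
    have : W (ξ + J₁ h) = Uhat (ξ.fst + h) + Vhat (ξ.snd + 0) := rfl
    rw [this, add_zero]
    simp only [W]
    ring
  have wJ₂ : ∀ h, W (ξ + J₂ h) - W ξ = Vhat (ξ.snd + h) - Vhat ξ.snd := fun h => by
    have : W (ξ + J₂ h) = Uhat (ξ.fst + 0) + Vhat (ξ.snd + h) := rfl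
    rw [this, add_zero]
    simp only [W]
    ring
  have hblock : ∀ z : WithLp 2 (H × H), ⟪B (J₁ z.fst), J₁ z.fst⟫ + ⟪B (J₂ z.snd), J₂ z.snd⟫
      - ⟪B z, z⟫ ≤ 0 := by
    refine nonpos_of_sq_homogeneous (fun t z => ?_) fun η hη => ?_
    · rw [WithLp.smul_fst, WithLp.smul_snd]
      simp only [map_smul, real_inner_smul_left, real_inner_smul_right]
      ring
    · have t1 : Filter.Tendsto (fun z : WithLp 2 (H × H) => z.fst) (nhds 0) (nhds 0) :=
        squeeze_zero_norm hfst (by simpa using (continuous_norm.tendsto (0 : WithLp 2 (H × H))))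
      have t2 : Filter.Tendsto (fun z : WithLp 2 (H × H) => z.snd) (nhds 0) (nhds 0) :=
        squeeze_zero_norm hsnd (by simpa using (continuous_norm.tendsto (0 : WithLp 2 (H × H))))
      have hη4 : 0 < η / 4 := by positivity
      filter_upwards [hW _ hη4, (tJ₁.comp t1).eventually (hW _ hη4),
        (tJ₂.comp t2).eventually (hW _ hη4)] with z z0 z1 z2
      simp only [Function.comp_apply] at z1 z2
      rw [wJ₁, iJ₁, nJ₁] at z1
      rw [wJ₂, iJ₂, nJ₂] at z2
      have h1 : W (ξ + z) = Uhat (ξ.fst + z.fst) + Vhat (ξ.snd + z.snd) := rfl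
      have h2 : W ξ = Uhat ξ.fst + Vhat ξ.snd := rfl
      rw [h1, h2, hinner P z] at z0
      have h3 := hnorm z
      rw [h3] at z0 ⊢
      linarith [(abs_le.1 z0).2, (abs_le.1 z1).1, (abs_le.1 z2).1]
  obtain ⟨X, hXs, hX⟩ := exists_symmetric_pullback B J₁ (2 * δ)
  obtain ⟨Y, hYs, hY⟩ := exists_symmetric_pullback B J₂ (2 * δ)
  refine ⟨m₁ ξ.fst, m₂ ξ.snd, P.fst, P.snd, X, Y, (hfst (m ξ)).trans_lt hε2,
    (hsnd (m ξ)).trans_lt hε2, (hfst P).trans_lt hPn, (hsnd P).trans_lt hPn, hXs, hYs,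
    hm₁.isLocalMax (((hfst (m ξ)).trans_lt hmξ2).trans hε'3) ?_,
    hm₂.isLocalMax (((hsnd (m ξ)).trans_lt hmξ2).trans hε'3) ?_, fun z => ?_⟩
  · filter_upwards [tJ₁.eventually (hW δ hδ)] with h hh
    rw [wJ₁, iJ₁, nJ₁] at hh
    rw [hX]
    linarith [(abs_le.1 hh).2]
  · filter_upwards [tJ₂.eventually (hW δ hδ)] with h hh
    rw [wJ₂, iJ₂, nJ₂] at hh
    rw [hY]
    linarith [(abs_le.1 hh).2]
  · have h1 := hblock z
    have h2 := hDneg z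
    rw [hB z] at h1
    have h3 := hnorm z
    rw [hX, hY]
    have h4 : ε = 6 * δ := by rw [hδdef]; ring
    rw [h4]
    nlinarith

end TheoremOnSums

section PucciBound

open scoped MatrixOrder

theorem trace_mul_nonneg_of_posSemidef {n : ℕ} {A B : Matrix (Fin n) (Fin n) ℝ}
    (hA : A.PosSemidef) (hB : B.PosSemidef) : 0 ≤ (A * B).trace := by
  obtain ⟨C, rfl⟩ := CStarAlgebra.nonneg_iff_eq_star_mul_self.1 hA.nonneg
  have h := (hB.mul_mul_conjTranspose_same C).trace_nonneg
  rwa [Matrix.trace_mul_cycle] at h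

theorem pucciSup_le_s1 {n : ℕ} {lam Lam a b : ℝ} (hlam : 0 ≤ lam) (hlamLam : lam ≤ Lam) (ha : 0 ≤ a)
    {M : Matrix (Fin n) (Fin n) ℝ} (hM : M.IsSymm)
    (hMa : ∀ ξ : Fin n → ℝ, ξ ⬝ᵥ M *ᵥ ξ ≤ a * (ξ ⬝ᵥ ξ))
    {v : Fin n → ℝ} (hv : v ⬝ᵥ v = 1) (hMb : v ⬝ᵥ M *ᵥ v ≤ b) :
    pucciSup n lam Lam M ≤ n * Lam * a + lam * (b - a) := by
  have hself : ∀ ξ : Fin n → ℝ, 0 ≤ ξ ⬝ᵥ ξ := fun ξ => by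
    simpa using dotProduct_star_self_nonneg ξ
  refine csSup_le (Set.Nonempty.image _ ⟨lam • (1 : Matrix (Fin n) (Fin n) ℝ), ?_, fun ξ => ?_⟩) ?_
  · simp [Matrix.IsSymm]
  · simp only [smul_mulVec, one_mulVec, dotProduct_smul, smul_eq_mul, le_refl, true_and]
    exact mul_le_mul_of_nonneg_right hlamLam (hself ξ)
  rintro _ ⟨A, ⟨hA, hAξ⟩, rfl⟩
  have hN : (a • (1 : Matrix (Fin n) (Fin n) ℝ) - M).PosSemidef := by
    refine .of_dotProduct_mulVec_nonneg ?_ fun ξ => ?_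
    · rw [Matrix.IsHermitian, conjTranspose_eq_transpose_of_trivial]
      simp [hM.eq]
    · simp only [star_trivial, sub_mulVec, smul_mulVec, one_mulVec, dotProduct_sub, dotProduct_smul,
        smul_eq_mul]
      linarith [hMa ξ]
  have hP : (A - lam • vecMulVec v v).PosSemidef := by
    refine .of_dotProduct_mulVec_nonneg ?_ fun ξ => ?_
    · rw [Matrix.IsHermitian, conjTranspose_eq_transpose_of_trivial]
      simp [hA.eq, transpose_vecMulVec]
    · have h1 : ξ ⬝ᵥ vecMulVec v v *ᵥ ξ = (v ⬝ᵥ ξ) ^ 2 := by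
        rw [vecMulVec_mulVec]
        simp [dotProduct_comm ξ v]
        ring
      have h2 : (v ⬝ᵥ ξ) ^ 2 ≤ ξ ⬝ᵥ ξ := by
        have h3 := hself (ξ - (v ⬝ᵥ ξ) • v)
        simp only [sub_dotProduct, dotProduct_sub, smul_dotProduct, dotProduct_smul, smul_eq_mul,
          hv, dotProduct_comm ξ v] at h3
        linarith
      simp only [star_trivial, sub_mulVec, smul_mulVec, dotProduct_sub, dotProduct_smul,
        smul_eq_mul, h1]
      linarith [(hAξ ξ).1, mul_le_mul_of_nonneg_left h2 hlam]
  have htr : A.trace ≤ n * Lam := by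
    have h1 : ∀ i, A i i ≤ Lam := fun i => by
      have := (hAξ (Pi.single i 1)).2
      simpa using this
    calc A.trace = ∑ i, A i i := rfl
      _ ≤ ∑ _i : Fin n, Lam := Finset.sum_le_sum fun i _ => h1 i
      _ = _ := by simp
  have h1 := trace_mul_nonneg_of_posSemidef hP hN
  have h2 : (vecMulVec v v * M).trace = v ⬝ᵥ M *ᵥ v := by
    rw [Matrix.trace_mul_comm, mul_vecMulVec, trace_vecMulVec, dotProduct_comm]
  have h3 : (vecMulVec v v).trace = 1 := by rw [trace_vecMulVec, hv]
  simp only [Matrix.sub_mul, Matrix.mul_sub, Matrix.trace_sub, Matrix.smul_mul, Matrix.mul_smul,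
    Matrix.mul_one, Matrix.trace_smul, smul_eq_mul, h2, h3] at h1
  show (A * M).trace ≤ _
  nlinarith [mul_le_mul_of_nonneg_left htr ha, mul_le_mul_of_nonneg_left hMb hlam]

end PucciBound

section QuadraticTestFunction

variable {H : Type*} [NormedAddCommGroup H] [InnerProductSpace ℝ H]

theorem hasFDerivAt_quadratic (x p : H) {X : H →L[ℝ] H} (hX : ∀ h k, ⟪X h, k⟫ = ⟪h, X k⟫) (z : H) :
    HasFDerivAt (fun z => ⟪p, z - x⟫ + 1 / 2 * ⟪X (z - x), z - x⟫)
      (innerSL ℝ (p + X (z - x))) z := by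
  have h1 : HasFDerivAt (fun z => z - x) (ContinuousLinearMap.id ℝ H) z :=
    (hasFDerivAt_id z).sub_const x
  have h2 : HasFDerivAt (fun z => X (z - x)) X z := X.hasFDerivAt.comp z h1
  refine (((hasFDerivAt_const p z).inner ℝ h1).add
    ((h2.inner ℝ h1).const_mul (1 / 2))).congr_fderiv ?_
  ext k
  have h3 : ⟪X k, z - x⟫ = ⟪X (z - x), k⟫ := by rw [hX, real_inner_comm]
  simp [h3, -map_sub]
  ring

theorem contDiff_quadratic (x p : H) (X : H →L[ℝ] H) {m : ℕ∞} :
    ContDiff ℝ m (fun z => ⟪p, z - x⟫ + 1 / 2 * ⟪X (z - x), z - x⟫) := by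
  have h : ContDiff ℝ m (fun z => z - x) := contDiff_id.sub contDiff_const
  exact (contDiff_const.inner ℝ h).add
    (contDiff_const.mul ((X.contDiff.comp h).inner ℝ h))

theorem gradient_quadratic [CompleteSpace H] (x p : H) {X : H →L[ℝ] H}
    (hX : ∀ h k, ⟪X h, k⟫ = ⟪h, X k⟫) :
    gradient (fun z => ⟪p, z - x⟫ + 1 / 2 * ⟪X (z - x), z - x⟫) x = p := by
  refine HasGradientAt.gradient ?_
  have := hasFDerivAt_quadratic x p hX x
  rw [sub_self, map_zero, add_zero] at this
  exact this

theorem hess_quadratic {n : ℕ} (x p : Euc n) {X : Euc n →L[ℝ] Euc n}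
    (hX : ∀ h k, ⟪X h, k⟫ = ⟪h, X k⟫) (z : Euc n) (i j : Fin n) :
    hess (fun z => ⟪p, z - x⟫ + 1 / 2 * ⟪X (z - x), z - x⟫) z i j =
      ⟪X (EuclideanSpace.single i 1), EuclideanSpace.single j 1⟫ := by
  have h1 : fderiv ℝ (fun z => ⟪p, z - x⟫ + 1 / 2 * ⟪X (z - x), z - x⟫) =
      fun z => innerSL ℝ (p + X (z - x)) := funext fun z => (hasFDerivAt_quadratic x p hX z).fderiv
  have h2 : HasFDerivAt (fun z => innerSL ℝ (p + X (z - x))) ((innerSL ℝ).comp X) z :=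
    (innerSL ℝ).hasFDerivAt.comp z
      ((X.hasFDerivAt.comp z ((hasFDerivAt_id z).sub_const x)).const_add p)
  rw [hess, iteratedFDeriv_two_apply, h1, h2.fderiv]
  simp

/-- The Hessian matrix of a quadratic form on `ℝⁿ`. -/
def formMatrix {n : ℕ} (X : Euc n →L[ℝ] Euc n) : Matrix (Fin n) (Fin n) ℝ :=
  fun i j => ⟪X (EuclideanSpace.single i 1), EuclideanSpace.single j 1⟫

theorem formMatrix_isSymm {n : ℕ} {X : Euc n →L[ℝ] Euc n} (hX : ∀ h k, ⟪X h, k⟫ = ⟪h, X k⟫) :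
    (formMatrix X).IsSymm := by
  ext i j
  rw [transpose_apply, formMatrix, formMatrix, hX, real_inner_comm]

theorem dotProduct_formMatrix_mulVec {n : ℕ} (X : Euc n →L[ℝ] Euc n) (ξ : Fin n → ℝ) :
    ξ ⬝ᵥ formMatrix X *ᵥ ξ = ⟪X (WithLp.toLp 2 ξ), WithLp.toLp 2 ξ⟫ := by
  have h : (WithLp.toLp 2 ξ : Euc n) = ∑ i, ξ i • EuclideanSpace.single i (1 : ℝ) := by
    ext j
    simp [Finset.sum_apply, Pi.single_apply]
  rw [h, map_sum, sum_inner]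
  simp only [dotProduct, mulVec, formMatrix, inner_sum, map_smul, real_inner_smul_left,
    real_inner_smul_right, Finset.mul_sum]
  refine Finset.sum_congr rfl fun i _ => Finset.sum_congr rfl fun j _ => by ring

end QuadraticTestFunction

section RadialTaylor

theorem eventually_abs_taylor_two_le {ϕ ϕ' : ℝ → ℝ} {c r : ℝ}
    (hϕ : ∀ᶠ t in nhds r, HasDerivAt ϕ (ϕ' t) t) (hϕ' : HasDerivAt ϕ' c r) {η : ℝ} (hη : 0 < η) :
    ∀ᶠ s in nhds (0 : ℝ), |ϕ (r + s) - ϕ r - ϕ' r * s - c / 2 * s ^ 2| ≤ η * s ^ 2 := by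
  have h1 : ∀ᶠ s in nhds (0 : ℝ), |ϕ' (r + s) - ϕ' r - c * s| ≤ η * |s| := by
    have := (hasDerivAt_iff_isLittleO_nhds_zero.1 hϕ').def hη
    filter_upwards [this] with s hs
    simpa [mul_comm c s] using hs
  have ht : Filter.Tendsto (fun s => r + s) (nhds 0) (nhds r) := by
    simpa using (continuous_const_add r).tendsto 0
  obtain ⟨d, hd, h2⟩ := Metric.eventually_nhds_iff_ball.1 (h1.and (ht.eventually hϕ))
  filter_upwards [Metric.ball_mem_nhds (0 : ℝ) hd] with s hs
  have hsub : ∀ t ∈ closedBall (0 : ℝ) |s|, t ∈ ball (0 : ℝ) d := fun t hts => by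
    rw [mem_ball_zero_iff] at hs ⊢
    exact (mem_closedBall_zero_iff.1 hts).trans_lt hs
  have h3 := (convex_closedBall (0 : ℝ) |s|).norm_image_sub_le_of_norm_hasDerivWithin_le
    (f := fun s => ϕ (r + s) - ϕ r - ϕ' r * s - c / 2 * s ^ 2)
    (f' := fun s => ϕ' (r + s) - ϕ' r - c * s) (C := η * |s|) (x := 0) (y := s)
    (fun t hts => ?_) (fun t hts => ?_) (by simp) (by simp)
  · simpa [mul_assoc, ← sq] using h3
  · have h4 : HasDerivAt (fun s => ϕ (r + s)) (ϕ' (r + t)) t := by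
      simpa using (h2 t (hsub t hts)).2.comp_const_add r t
    refine (((h4.sub_const _).sub ((hasDerivAt_id t).const_mul (ϕ' r))).sub
      (((hasDerivAt_id t).pow 2).const_mul (c / 2))).hasDerivWithinAt.congr_deriv ?_
    simp
    ring
  · refine (h2 t (hsub t hts)).1.trans ?_
    have := mem_closedBall_zero_iff.1 hts
    rw [Real.norm_eq_abs] at this
    gcongr

variable {H : Type*} [NormedAddCommGroup H] [InnerProductSpace ℝ H]

theorem norm_add_sub_norm_eq {w : H} (hw : w ≠ 0) (h : H) :
    ‖w + h‖ - ‖w‖ = ⟪‖w‖⁻¹ • w, h⟫ + (‖h‖ ^ 2 - (‖w + h‖ - ‖w‖) ^ 2) / (2 * ‖w‖) := by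
  have h1 := norm_add_sq_real w h
  have h2 : ‖w‖ ≠ 0 := norm_ne_zero_iff.2 hw
  rw [real_inner_smul_left]
  field_simp
  linarith

theorem eventually_comp_norm_le {ϕ ϕ' : ℝ → ℝ} {c : ℝ} {w : H} (hw : w ≠ 0)
    (hϕ : ∀ᶠ t in nhds ‖w‖, HasDerivAt ϕ (ϕ' t) t) (hϕ' : HasDerivAt ϕ' c ‖w‖)
    {η : ℝ} (hη : 0 < η) :
    ∀ᶠ h in nhds (0 : H), ϕ ‖w + h‖ ≤ ϕ ‖w‖ + ϕ' ‖w‖ * ⟪‖w‖⁻¹ • w, h⟫ +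
      1 / 2 * (c * ⟪‖w‖⁻¹ • w, h⟫ ^ 2 + ϕ' ‖w‖ / ‖w‖ * (‖h‖ ^ 2 - ⟪‖w‖⁻¹ • w, h⟫ ^ 2)) +
      η * ‖h‖ ^ 2 := by
  have hr : 0 < ‖w‖ := norm_pos_iff.2 hw
  set r := ‖w‖ with hrdef
  set k := |c / 2 - ϕ' r / (2 * r)| with hk
  have h1 : Filter.Tendsto (fun h => ‖w + h‖ - r) (nhds 0) (nhds 0) := by
    have : Continuous (fun h => ‖w + h‖ - r) := by fun_prop
    simpa [hrdef] using this.tendsto 0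
  have h2 : Filter.Tendsto (fun h : H => k * (‖h‖ / r)) (nhds 0) (nhds 0) := by
    have : Continuous (fun h : H => k * (‖h‖ / r)) := by fun_prop
    simpa using this.tendsto 0
  filter_upwards [h1.eventually (eventually_abs_taylor_two_le hϕ hϕ' (half_pos hη)),
    h2.eventually (gt_mem_nhds (half_pos hη))] with h h3 h4
  have h5 := norm_add_sub_norm_eq hw h
  rw [← hrdef] at h5
  have hs : |‖w + h‖ - r| ≤ ‖h‖ := by
    simpa using abs_norm_sub_norm_le (w + h) w
  have ha : |⟪r⁻¹ • w, h⟫| ≤ ‖h‖ := by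
    refine (abs_real_inner_le_norm _ _).trans ?_
    rw [norm_smul, norm_inv, Real.norm_of_nonneg hr.le, inv_mul_cancel₀ hr.ne', one_mul]
  rw [add_sub_cancel] at h3
  set s := ‖w + h‖ - r
  set a := ⟪r⁻¹ • w, h⟫
  have hs2 : s ^ 2 ≤ ‖h‖ ^ 2 := sq_le_sq' (abs_le.1 hs).1 (abs_le.1 hs).2
  have h6 : |s - a| ≤ ‖h‖ ^ 2 / (2 * r) := by
    have h7 : s - a = (‖h‖ ^ 2 - s ^ 2) / (2 * r) := by linarith
    rw [h7, abs_of_nonneg (by apply div_nonneg <;> linarith)]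
    gcongr
    linarith [sq_nonneg s]
  have h7 : |s ^ 2 - a ^ 2| ≤ ‖h‖ / r * ‖h‖ ^ 2 := by
    calc |s ^ 2 - a ^ 2| = |s - a| * |s + a| := by rw [← abs_mul]; ring_nf
      _ ≤ ‖h‖ ^ 2 / (2 * r) * (‖h‖ + ‖h‖) := by
        gcongr
        exact (abs_add_le s a).trans (add_le_add hs ha)
      _ = _ := by field_simp; ring
  have h8 : (c / 2 - ϕ' r / (2 * r)) * (s ^ 2 - a ^ 2) ≤ η / 2 * ‖h‖ ^ 2 := by
    calc _ ≤ |(c / 2 - ϕ' r / (2 * r)) * (s ^ 2 - a ^ 2)| := le_abs_self _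
      _ = k * |s ^ 2 - a ^ 2| := abs_mul _ _
      _ ≤ k * (‖h‖ / r * ‖h‖ ^ 2) := by gcongr
      _ = k * (‖h‖ / r) * ‖h‖ ^ 2 := by ring
      _ ≤ _ := by gcongr
  have h9 : ϕ' r * s = ϕ' r * a + ϕ' r / (2 * r) * (‖h‖ ^ 2 - s ^ 2) := by
    have h10 := congrArg (ϕ' r * ·) h5
    rw [h10]
    ring
  have h10 : ϕ' r / r = 2 * (ϕ' r / (2 * r)) := by field_simp
  rw [h10]
  have h11 : η / 2 * s ^ 2 ≤ η / 2 * ‖h‖ ^ 2 := by gcongr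
  linarith [(abs_le.1 h3).2]

theorem hasGradientAt_radial_add_sq [CompleteSpace H] {ϕ : ℝ → ℝ} {d L K e : ℝ} {x y : H}
    (hxy : x ≠ y) (hϕ : HasDerivAt ϕ d ‖x - y‖) :
    HasGradientAt (fun x => L * ϕ ‖x - y‖ + K * (‖x‖ ^ 2 + e))
      ((L * d) • (‖x - y‖⁻¹ • (x - y)) + (2 * K) • x) x := by
  have hw : x - y ≠ 0 := sub_ne_zero.2 hxy
  have hr : ‖x - y‖ ≠ 0 := norm_ne_zero_iff.2 hw
  have h1 : HasFDerivAt (fun x => x - y) (ContinuousLinearMap.id ℝ H) x :=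
    (hasFDerivAt_id x).sub_const y
  have h2 := h1.norm_sq.sqrt (pow_ne_zero 2 hr)
  simp only [Real.sqrt_sq (norm_nonneg _)] at h2
  have h3 := ((hϕ.comp_hasFDerivAt x h2).const_mul L).add
    (((hasFDerivAt_id x).norm_sq.add_const e).const_mul K)
  rw [hasGradientAt_iff_hasFDerivAt]
  refine h3.congr_fderiv ?_
  ext k
  simp
  field_simp

end RadialTaylor

section SecondOrderJets

variable {H : Type*} [NormedAddCommGroup H] [InnerProductSpace ℝ H]

theorem isLocalMax_sub_quadratic_of_translate {u : H → ℝ} {a b p x : H} {X : H →L[ℝ] H}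
    (h : IsLocalMax (fun z => u (a + z) - u a - ⟪b, z⟫ -
      (⟪p, z - x⟫ + 1 / 2 * ⟪X (z - x), z - x⟫)) x) :
    IsLocalMax (fun z => u z -
      (⟪b + p, z - (a + x)⟫ + 1 / 2 * ⟪X (z - (a + x)), z - (a + x)⟫)) (a + x) := by
  have ht : Filter.Tendsto (fun z => z - a) (nhds (a + x)) (nhds x) := by
    have : Continuous (fun z : H => z - a) := by fun_prop
    simpa using this.tendsto (a + x)
  filter_upwards [ht.eventually h] with z hz
  have h1 : z - a - x = z - (a + x) := by abel
  have h2 : ⟪b, z - a⟫ = ⟪b, z - (a + x)⟫ + ⟪b, x⟫ := by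
    rw [← inner_add_right]; congr 1; abel
  rw [add_sub_cancel, h1, h2] at hz
  rw [inner_add_left]
  simp only [sub_self, inner_zero_right, map_zero] at hz ⊢
  linarith

/-- The maximum principle for semicontinuous functions, for continuous functions whose penalization
has a second-order upper expansion at the maximum. -/
theorem exists_quadratic_touching_of_isLocalMax [FiniteDimensional ℝ H] {u w : H → ℝ}
    {Φ : H → H → ℝ} {a b p₁ p₂ : H} {A : WithLp 2 (H × H) →L[ℝ] WithLp 2 (H × H)}
    (hu : ∀ᶠ x in nhds a, ContinuousAt u x) (hw : ∀ᶠ x in nhds b, ContinuousAt w x)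
    (hA : ∀ x y, ⟪A x, y⟫ = ⟪x, A y⟫)
    (hmax : IsLocalMax (fun z : H × H => u z.1 + w z.2 - Φ z.1 z.2) (a, b))
    (hΦ : ∀ η : ℝ, 0 < η → ∀ᶠ z in nhds (0 : WithLp 2 (H × H)), Φ (a + z.fst) (b + z.snd) ≤
      Φ a b + ⟪p₁, z.fst⟫ + ⟪p₂, z.snd⟫ + 1 / 2 * ⟪A z, z⟫ + η * ‖z‖ ^ 2)
    {ε : ℝ} (hε : 0 < ε) :
    ∃ (x y p q : H) (X Y : H →L[ℝ] H),
      ‖x - a‖ < ε ∧ ‖y - b‖ < ε ∧ ‖p - p₁‖ < ε ∧ ‖q - p₂‖ < ε ∧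
      (∀ h k, ⟪X h, k⟫ = ⟪h, X k⟫) ∧ (∀ h k, ⟪Y h, k⟫ = ⟪h, Y k⟫) ∧
      IsLocalMax (fun z => u z - (⟪p, z - x⟫ + 1 / 2 * ⟪X (z - x), z - x⟫)) x ∧
      IsLocalMax (fun z => w z - (⟪q, z - y⟫ + 1 / 2 * ⟪Y (z - y), z - y⟫)) y ∧
      ∀ z : WithLp 2 (H × H),
        ⟪X z.fst, z.fst⟫ + ⟪Y z.snd, z.snd⟫ ≤ ⟪A z, z⟫ + ε * ‖z‖ ^ 2 := by
  let T := A + (ε / 2) • ContinuousLinearMap.id ℝ (WithLp 2 (H × H))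
  have hT : ∀ x y, ⟪T x, y⟫ = ⟪A x, y⟫ + ε / 2 * ⟪x, y⟫ := fun x y => by
    simp only [T, _root_.add_apply, _root_.smul_apply, ContinuousLinearMap.id_apply,
      inner_add_left, real_inner_smul_left]
  have htr : Filter.Tendsto (fun z : WithLp 2 (H × H) => (a + z.fst, b + z.snd)) (nhds 0)
      (nhds (a, b)) := by
    have h : Continuous (fun z : WithLp 2 (H × H) => (a + z.fst, b + z.snd)) := by fun_prop
    simpa using h.tendsto 0
  obtain ⟨d, hd, hball⟩ := Metric.eventually_nhds_iff_ball.1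
    ((htr.eventually hmax).and (hΦ (ε / 4) (by positivity)))
  obtain ⟨d₁, hd₁, hball₁⟩ := Metric.eventually_nhds_iff_ball.1 hu
  obtain ⟨d₂, hd₂, hball₂⟩ := Metric.eventually_nhds_iff_ball.1 hw
  set r := min (d / 2) (min d₁ d₂) / 2 with hrdef
  have hr : 0 < r := by positivity
  have hrd : 2 * r ≤ d / 2 := by
    rw [hrdef]; linarith [min_le_left (d / 2) (min d₁ d₂)]
  have hrd₁ : r < d₁ := by
    have := (min_le_right (d / 2) (min d₁ d₂)).trans (min_le_left _ _)
    linarith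
  have hrd₂ : r < d₂ := by
    have := (min_le_right (d / 2) (min d₁ d₂)).trans (min_le_right _ _)
    linarith
  have hcont : ∀ {g : H → ℝ} {c p : H} {s : ℝ}, r < s → (∀ x ∈ ball c s, ContinuousAt g x) →
      ContinuousOn (fun h => g (c + h) - g c - ⟪p, h⟫) (closedBall 0 r) := by
    intro g c p s hs hg h hh
    have h1 : ContinuousAt g (c + h) := hg _ (by
      rw [mem_ball_iff_norm, add_sub_cancel_left]
      exact (mem_closedBall_zero_iff.1 hh).trans_lt hs)
    have h2 : ContinuousAt (fun h => g (c + h)) h :=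
      ContinuousAt.comp (f := fun h => c + h) h1 (continuous_const_add c).continuousAt
    exact ((h2.sub continuousAt_const).sub (by fun_prop)).continuousWithinAt
  obtain ⟨x, y, p, q, X, Y, hx, hy, hp, hq, hX, hY, hxm, hym, hXY⟩ := theorem_on_sums
    (U := fun h => u (a + h) - u a - ⟪p₁, h⟫) (V := fun h => w (b + h) - w b - ⟪p₂, h⟫) (T := T)
    hr (hcont hrd₁ hball₁) (hcont hrd₂ hball₂)
    (fun x y => by rw [hT, hA, real_inner_comm (T y) x, hT, real_inner_comm (A y) x,
      real_inner_comm y x])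
    (by simp) (fun z hz1 hz2 => by
      have h1 : ‖z‖ < d := by
        have h2 := WithLp.prod_norm_sq_eq_of_L2 z
        rw [mem_closedBall_zero_iff] at hz1 hz2
        have h3 : ‖z.fst‖ ^ 2 ≤ r ^ 2 := by gcongr
        have h4 : ‖z.snd‖ ^ 2 ≤ r ^ 2 := by gcongr
        refine lt_of_pow_lt_pow_left₀ 2 hd.le ?_
        nlinarith
      obtain ⟨h2, h3⟩ := hball z (mem_ball_zero_iff.2 h1)
      rw [hT, real_inner_self_eq_norm_sq]
      simp only at h2
      linarith) (half_pos hε)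
  refine ⟨a + x, b + y, p₁ + p, p₂ + q, X, Y, ?_, ?_, ?_, ?_, hX, hY,
    isLocalMax_sub_quadratic_of_translate hxm, isLocalMax_sub_quadratic_of_translate hym,
    fun z => ?_⟩
  · rw [add_sub_cancel_left]; linarith
  · rw [add_sub_cancel_left]; linarith
  · rw [add_sub_cancel_left]; linarith
  · rw [add_sub_cancel_left]; linarith
  · have := hXY z
    rw [hT, real_inner_self_eq_norm_sq] at this
    linarith

theorem exists_quadratic_touching_of_radial_penalization [FiniteDimensional ℝ H] {u w : H → ℝ}
    {ϕ ϕ' : ℝ → ℝ} {c L K : ℝ} {a b : H} (hL : 0 < L)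
    (hu : ∀ᶠ x in nhds a, ContinuousAt u x) (hw : ∀ᶠ x in nhds b, ContinuousAt w x)
    (hab : a ≠ b) (hϕ : ∀ᶠ t in nhds ‖a - b‖, HasDerivAt ϕ (ϕ' t) t)
    (hϕ' : HasDerivAt ϕ' c ‖a - b‖)
    (hmax : IsLocalMax (fun z : H × H => u z.1 + w z.2 -
      (L * ϕ ‖z.1 - z.2‖ + K * (‖z.1‖ ^ 2 + ‖z.2‖ ^ 2))) (a, b))
    {ε : ℝ} (hε : 0 < ε) :
    ∃ (x y p q : H) (X Y : H →L[ℝ] H), ‖x - a‖ < ε ∧ ‖y - b‖ < ε ∧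
      ‖p - ((L * ϕ' ‖a - b‖) • (‖a - b‖⁻¹ • (a - b)) + (2 * K) • a)‖ < ε ∧
      ‖q - (-((L * ϕ' ‖a - b‖) • (‖a - b‖⁻¹ • (a - b))) + (2 * K) • b)‖ < ε ∧
      (∀ h k, ⟪X h, k⟫ = ⟪h, X k⟫) ∧ (∀ h k, ⟪Y h, k⟫ = ⟪h, Y k⟫) ∧
      IsLocalMax (fun z => u z - (⟪p, z - x⟫ + 1 / 2 * ⟪X (z - x), z - x⟫)) x ∧
      IsLocalMax (fun z => w z - (⟪q, z - y⟫ + 1 / 2 * ⟪Y (z - y), z - y⟫)) y ∧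
      (∀ ξ, ⟪X ξ, ξ⟫ + ⟪Y ξ, ξ⟫ ≤ (4 * K + ε) * ‖ξ‖ ^ 2) ∧
      ∀ v, v = ‖a - b‖⁻¹ • (a - b) → ⟪X v, v⟫ + ⟪Y v, v⟫ ≤ 4 * L * c + 4 * K + ε := by
  have hne : a - b ≠ 0 := sub_ne_zero.2 hab
  set v := ‖a - b‖⁻¹ • (a - b) with hv
  have hv1 : ‖v‖ = 1 := norm_smul_inv_norm hne
  set d := ϕ' ‖a - b‖
  set e := d / ‖a - b‖
  let π : WithLp 2 (H × H) →L[ℝ] H := WithLp.fstL 2 ℝ H H - WithLp.sndL 2 ℝ H H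
  have hπ : ∀ z, π z = z.fst - z.snd := fun z => rfl
  let Z : H →L[ℝ] H := (L * (c - e)) • (innerSL ℝ v).smulRight v +
    (L * e) • ContinuousLinearMap.id ℝ H
  have hZ : ∀ h k, ⟪Z h, k⟫ = L * (c - e) * (⟪v, h⟫ * ⟪v, k⟫) + L * e * ⟪h, k⟫ := fun h k => by
    simp [Z, inner_add_left, real_inner_smul_left]
  let A := ContinuousLinearMap.adjoint π ∘L Z ∘L π +
    (2 * K) • ContinuousLinearMap.id ℝ (WithLp 2 (H × H))
  have hA : ∀ x y, ⟪A x, y⟫ = ⟪Z (π x), π y⟫ + 2 * K * ⟪x, y⟫ := fun x y => by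
    simp [A, inner_add_left, real_inner_smul_left, ContinuousLinearMap.adjoint_inner_left]
    ring
  have hnorm : ∀ z : WithLp 2 (H × H), ‖z‖ ^ 2 = ‖z.fst‖ ^ 2 + ‖z.snd‖ ^ 2 :=
    fun z => WithLp.prod_norm_sq_eq_of_L2 z
  obtain ⟨x, y, p, q, X, Y, hx, hy, hp, hq, hX, hY, hxm, hym, hXY⟩ :=
    exists_quadratic_touching_of_isLocalMax (u := u) (w := w)
      (Φ := fun x y => L * ϕ ‖x - y‖ + K * (‖x‖ ^ 2 + ‖y‖ ^ 2))
      (p₁ := (L * d) • v + (2 * K) • a) (p₂ := -((L * d) • v) + (2 * K) • b) (A := A)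
      hu hw (fun x y => by
        rw [hA, real_inner_comm (A y), hA, hZ, hZ, real_inner_comm (π y) (π x),
          real_inner_comm y x]
        ring)
      hmax (fun η hη => by
        have ht : Filter.Tendsto π (nhds 0) (nhds 0) := by simpa using π.continuous.tendsto 0
        filter_upwards [ht.eventually (eventually_comp_norm_le hne hϕ hϕ'
          (η := η / (2 * L)) (by positivity))] with z hz
        rw [hA, hZ, real_inner_self_eq_norm_sq, real_inner_self_eq_norm_sq, hnorm]
        rw [← hv] at hz
        have h1 : a + z.fst - (b + z.snd) = a - b + π z := by rw [hπ]; abel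
        have h2 : ⟪v, π z⟫ = ⟪v, z.fst⟫ - ⟪v, z.snd⟫ := by rw [hπ, inner_sub_right]
        have h3 : ‖π z‖ ^ 2 ≤ 2 * (‖z.fst‖ ^ 2 + ‖z.snd‖ ^ 2) := by
          rw [hπ]
          linarith [parallelogram_law_with_norm ℝ z.fst z.snd, sq_nonneg ‖z.fst + z.snd‖]
        have h4 := mul_le_mul_of_nonneg_left hz hL.le
        have h5 : L * (η / (2 * L) * ‖π z‖ ^ 2) ≤ η * (‖z.fst‖ ^ 2 + ‖z.snd‖ ^ 2) := by
          calc L * (η / (2 * L) * ‖π z‖ ^ 2) = η / 2 * ‖π z‖ ^ 2 := by field_simp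
            _ ≤ η / 2 * (2 * (‖z.fst‖ ^ 2 + ‖z.snd‖ ^ 2)) := by gcongr
            _ = _ := by ring
        simp only [h1, norm_add_sq_real a, norm_add_sq_real b, inner_add_left, inner_neg_left,
          real_inner_smul_left]
        have h6 : L * d * ⟪v, z.fst⟫ - L * d * ⟪v, z.snd⟫ = L * d * ⟪v, π z⟫ := by rw [h2]; ring
        nlinarith) (half_pos hε)
  have hpair : ∀ g k, ⟪X g, g⟫ + ⟪Y k, k⟫ ≤ ⟪Z (g - k), g - k⟫ +
      (2 * K + ε / 2) * (‖g‖ ^ 2 + ‖k‖ ^ 2) := fun g k => by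
    have h1 : ⟪X g, g⟫ + ⟪Y k, k⟫ ≤ _ := hXY (WithLp.toLp 2 (g, k))
    have h2 : ‖WithLp.toLp 2 (g, k)‖ ^ 2 = ‖g‖ ^ 2 + ‖k‖ ^ 2 := hnorm _
    have h3 : π (WithLp.toLp 2 (g, k)) = g - k := rfl
    rw [hA, real_inner_self_eq_norm_sq, h2, h3] at h1
    linarith
  refine ⟨x, y, p, q, X, Y, by linarith, by linarith, by linarith, by linarith, hX, hY, hxm, hym,
    fun ξ => ?_, ?_⟩
  · have h := hpair ξ ξ
    rw [sub_self, inner_zero_right] at h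
    linarith
  · rintro _ rfl
    have h := hpair v (-v)
    have h1 : ⟪v, v + v⟫ = 2 := by
      rw [inner_add_right, real_inner_self_eq_norm_sq, hv1]; norm_num
    have h2 : ⟪v + v, v + v⟫ = 4 := by rw [inner_add_left, h1]; norm_num
    rw [hZ, sub_neg_eq_add, h1, h2, norm_neg, map_neg, inner_neg_neg, hv1] at h
    linarith

end SecondOrderJets

section PointwiseBounds

/-- A subsolution touched from above by a quadratic function with a steep slope has a bound on the
operator from below. -/
theorem GradSubSol.neg_mul_rpow_le {n : ℕ} {κ q Mf P : ℝ} (hq : 0 ≤ q) (hMf : 0 ≤ Mf)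
    {F : Matrix (Fin n) (Fin n) ℝ → ℝ} {f u : Euc n → ℝ} {s : Set (Euc n)}
    (hsol : GradSubSol κ (mainG κ q F) f s u) {x p : Euc n} (hx : x ∈ s) (hfx : |f x| ≤ Mf)
    {X : Euc n →L[ℝ] Euc n} (hX : ∀ h k, ⟪X h, k⟫ = ⟪h, X k⟫)
    (hmax : IsLocalMax (fun z => u z - (⟪p, z - x⟫ + 1 / 2 * ⟪X (z - x), z - x⟫)) x)
    (hP : 0 < P) (hp : P ≤ ‖p‖ - κ) :
    -(Mf * P ^ (-q)) ≤ F (formMatrix X) := by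
  have h0 : 0 < ‖p‖ - κ := hP.trans_le hp
  have h1 := hsol x hx _ (contDiff_quadratic x p X (m := 2)) hmax
    (by rw [gradient_quadratic x p hX]; linarith)
  rw [gradient_quadratic x p hX, show hess _ x = formMatrix X from
    funext₂ (hess_quadratic x p hX x), mainG, max_eq_left h0.le] at h1
  have h2 : (‖p‖ - κ) ^ (-q) ≤ P ^ (-q) := Real.rpow_le_rpow_of_nonpos hP hp (neg_nonpos.2 hq)
  have h3 : 0 < (‖p‖ - κ) ^ q := Real.rpow_pos_of_pos h0 q
  have h4 : -Mf * (‖p‖ - κ) ^ (-q) ≤ F (formMatrix X) := by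
    rw [Real.rpow_neg h0.le, ← div_eq_mul_inv, div_le_iff₀ h3]
    linarith [(abs_le.1 hfx).1]
  linarith [mul_le_mul_of_nonneg_left h2 hMf]

theorem GradSupSol.le_mul_rpow {n : ℕ} {κ q Mf P : ℝ} (hq : 0 ≤ q) (hMf : 0 ≤ Mf)
    {F : Matrix (Fin n) (Fin n) ℝ → ℝ} {f u : Euc n → ℝ} {s : Set (Euc n)}
    (hsol : GradSupSol κ (mainG κ q F) f s u) {x p : Euc n} (hx : x ∈ s) (hfx : |f x| ≤ Mf)
    {X : Euc n →L[ℝ] Euc n} (hX : ∀ h k, ⟪X h, k⟫ = ⟪h, X k⟫)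
    (hmin : IsLocalMin (fun z => u z - (⟪p, z - x⟫ + 1 / 2 * ⟪X (z - x), z - x⟫)) x)
    (hP : 0 < P) (hp : P ≤ ‖p‖ - κ) :
    F (formMatrix X) ≤ Mf * P ^ (-q) := by
  have h0 : 0 < ‖p‖ - κ := hP.trans_le hp
  have h1 := hsol x hx _ (contDiff_quadratic x p X (m := 2)) hmin
    (by rw [gradient_quadratic x p hX]; linarith)
  rw [gradient_quadratic x p hX, show hess _ x = formMatrix X from
    funext₂ (hess_quadratic x p hX x), mainG, max_eq_left h0.le] at h1
  have h2 : (‖p‖ - κ) ^ (-q) ≤ P ^ (-q) := Real.rpow_le_rpow_of_nonpos hP hp (neg_nonpos.2 hq)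
  have h3 : 0 < (‖p‖ - κ) ^ q := Real.rpow_pos_of_pos h0 q
  have h4 : F (formMatrix X) ≤ Mf * (‖p‖ - κ) ^ (-q) := by
    rw [Real.rpow_neg h0.le, ← div_eq_mul_inv, le_div_iff₀ h3]
    linarith [(abs_le.1 hfx).2]
  linarith [mul_le_mul_of_nonneg_left h2 hMf]

theorem IsUniformlyElliptic.sub_le {n : ℕ} {lam Lam a b : ℝ} (hlam : 0 ≤ lam)
    (hlamLam : lam ≤ Lam) {F : Matrix (Fin n) (Fin n) ℝ → ℝ} (hF : IsUniformlyElliptic n lam Lam F)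
    {X Y : Euc n →L[ℝ] Euc n} (hX : ∀ h k, ⟪X h, k⟫ = ⟪h, X k⟫)
    (hY : ∀ h k, ⟪Y h, k⟫ = ⟪h, Y k⟫) (ha : 0 ≤ a)
    (hXY : ∀ ξ, ⟪X ξ, ξ⟫ + ⟪Y ξ, ξ⟫ ≤ a * ‖ξ‖ ^ 2)
    {v : Euc n} (hv : ‖v‖ = 1) (hXYv : ⟪X v, v⟫ + ⟪Y v, v⟫ ≤ b) :
    F (formMatrix X) - F (formMatrix (-Y)) ≤ n * Lam * a + lam * (b - a) := by
  have hY' : ∀ h k, ⟪(-Y) h, k⟫ = ⟪h, (-Y) k⟫ := fun h k => by simp [hY]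
  have hM : ∀ ξ : Fin n → ℝ, ξ ⬝ᵥ (formMatrix X - formMatrix (-Y)) *ᵥ ξ =
      ⟪X (WithLp.toLp 2 ξ), WithLp.toLp 2 ξ⟫ + ⟪Y (WithLp.toLp 2 ξ), WithLp.toLp 2 ξ⟫ := fun ξ => by
    rw [sub_mulVec, dotProduct_sub, dotProduct_formMatrix_mulVec, dotProduct_formMatrix_mulVec]
    simp
  have hdot : ∀ ξ : Fin n → ℝ, ξ ⬝ᵥ ξ = ‖(WithLp.toLp 2 ξ : Euc n)‖ ^ 2 := fun ξ => by
    rw [EuclideanSpace.real_norm_sq_eq]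
    simp [dotProduct, sq]
  refine (hF _ _ (formMatrix_isSymm hX) (formMatrix_isSymm hY')).2.trans
    (pucciSup_le_s1 hlam hlamLam ha ((formMatrix_isSymm hX).sub (formMatrix_isSymm hY'))
      (fun ξ => ?_) (v := WithLp.ofLp v) ?_ ?_)
  · rw [hM, hdot]
    exact hXY _
  · rw [hdot]
    simp [hv]
  · rw [hM]
    exact hXYv

end PointwiseBounds

/-- Lemma 3.2, Jensen–Ishii type estimate at an interior maximum of the
doubled variable function. -/
theorem jensen_ishii_estimate
    (n : ℕ) (hn : 1 ≤ n) (lam Lam κ q Mf : ℝ)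
    (hlam : 0 < lam) (hlamLam : lam ≤ Lam) (hκ : 0 ≤ κ) (hq : 0 ≤ q)
    (F : Matrix (Fin n) (Fin n) ℝ → ℝ) (hF : IsUniformlyElliptic n lam Lam F)
    (f u : Euc n → ℝ)
    (hf : ContinuousOn f (ball 0 1)) (hfb : ∀ x ∈ ball (0 : Euc n) 1, |f x| ≤ Mf)
    (hu : ContinuousOn u (ball 0 1))
    (hsol : GradSol κ (mainG κ q F) f (ball 0 1) u)
    (L K : ℝ) (hL : 0 < L) (hK : 0 < K)
    (ϕ ϕ' ϕ'' : ℝ → ℝ) (hϕ : ContDiffOn ℝ 2 ϕ (Ioi 0))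
    (hϕpos : ∀ t ∈ Ioi (0 : ℝ), 0 ≤ ϕ t)
    (hϕ' : ∀ t ∈ Ioi (0 : ℝ), HasDerivAt ϕ (ϕ' t) t)
    (hϕ'' : ∀ t ∈ Ioi (0 : ℝ), HasDerivAt ϕ' (ϕ'' t) t)
    (xb yb : Euc n) (hxb : xb ∈ ball (0 : Euc n) 1) (hyb : yb ∈ ball (0 : Euc n) 1)
    (hne : xb ≠ yb)
    (hmax : IsLocalMax (fun p : Euc n × Euc n =>
      u p.1 - u p.2 - (L * ϕ ‖p.1 - p.2‖ + K * (‖p.1‖ ^ 2 + ‖p.2‖ ^ 2))) (xb, yb))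
    (hDx : κ < ‖gradient (fun x : Euc n =>
      L * ϕ ‖x - yb‖ + K * (‖x‖ ^ 2 + ‖yb‖ ^ 2)) xb‖)
    (hDy : κ < ‖gradient (fun y : Euc n =>
      L * ϕ ‖xb - y‖ + K * (‖xb‖ ^ 2 + ‖y‖ ^ 2)) yb‖) :
    -4 * ϕ'' ‖xb - yb‖ * L ≤
      4 * n * (Lam / lam) * K + (1 / lam) * Mf *
        ((‖gradient (fun x : Euc n =>
            L * ϕ ‖x - yb‖ + K * (‖x‖ ^ 2 + ‖yb‖ ^ 2)) xb‖ - κ) ^ (-q) +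
         (‖gradient (fun y : Euc n =>
            L * ϕ ‖xb - y‖ + K * (‖xb‖ ^ 2 + ‖y‖ ^ 2)) yb‖ - κ) ^ (-q)) := by
  have hMf : 0 ≤ Mf := (abs_nonneg _).trans (hfb xb hxb)
  have hw : xb - yb ≠ 0 := sub_ne_zero.2 hne
  have hr : 0 < ‖xb - yb‖ := norm_pos_iff.2 hw
  have hgx : gradient (fun x : Euc n => L * ϕ ‖x - yb‖ + K * (‖x‖ ^ 2 + ‖yb‖ ^ 2)) xb =
      (L * ϕ' ‖xb - yb‖) • (‖xb - yb‖⁻¹ • (xb - yb)) + (2 * K) • xb :=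
    (hasGradientAt_radial_add_sq hne (hϕ' _ hr)).gradient
  have hgy : gradient (fun y : Euc n => L * ϕ ‖xb - y‖ + K * (‖xb‖ ^ 2 + ‖y‖ ^ 2)) yb =
      -((L * ϕ' ‖xb - yb‖) • (‖xb - yb‖⁻¹ • (xb - yb))) + (2 * K) • yb := by
    have h := (hasGradientAt_radial_add_sq (L := L) (K := K) (e := ‖xb‖ ^ 2) hne.symm
      (norm_sub_rev xb yb ▸ hϕ' _ hr)).gradient
    simp only [norm_sub_rev _ xb, add_comm _ (‖xb‖ ^ 2)] at h
    rw [h, ← neg_sub xb yb, smul_neg, smul_neg]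
  rw [hgx] at hDx ⊢
  rw [hgy] at hDy ⊢
  set p₁ := (L * ϕ' ‖xb - yb‖) • (‖xb - yb‖⁻¹ • (xb - yb)) + (2 * K) • xb
  set p₂ := -((L * ϕ' ‖xb - yb‖) • (‖xb - yb‖⁻¹ • (xb - yb))) + (2 * K) • yb
  set c := ϕ'' ‖xb - yb‖
  have hcont : ∀ x ∈ ball (0 : Euc n) 1, ∀ᶠ z in nhds x, ContinuousAt u z := fun x hx => by
    filter_upwards [isOpen_ball.mem_nhds hx] with z hz
    exact hu.continuousAt (isOpen_ball.mem_nhds hz)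
  have hball : ∀ x ∈ ball (0 : Euc n) 1, ∀ z, ‖z - x‖ < 1 - ‖x‖ → z ∈ ball (0 : Euc n) 1 :=
    fun x _ z hz => by
      rw [mem_ball_zero_iff]
      linarith [norm_le_norm_add_norm_sub' z x]
  have key : ∀ᶠ ε in nhdsWithin (0 : ℝ) (Ioi 0), -(Mf * (‖p₁‖ - κ - ε) ^ (-q)) -
      Mf * (‖p₂‖ - κ - ε) ^ (-q) ≤ n * Lam * (4 * K + ε) + lam * (4 * L * c) := by
    have hpos : ∀ t : ℝ, 0 < t → ∀ᶠ ε in nhdsWithin (0 : ℝ) (Ioi 0), ε < t := fun t ht =>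
      nhdsWithin_le_nhds (gt_mem_nhds ht)
    filter_upwards [self_mem_nhdsWithin, hpos _ (sub_pos.2 hDx), hpos _ (sub_pos.2 hDy),
      hpos _ (sub_pos.2 (mem_ball_zero_iff.1 hxb)), hpos _ (sub_pos.2 (mem_ball_zero_iff.1 hyb))]
      with ε hε hε₁ hε₂ hεx hεy
    obtain ⟨x, y, p, q', X, Y, hx, hy, hp, hq', hX, hY, hxm, hym, hXY, hXYv⟩ :=
      exists_quadratic_touching_of_radial_penalization (u := u) (w := fun y => -u y) (ϕ := ϕ)
        (ϕ' := ϕ') hL (hcont xb hxb) ((hcont yb hyb).mono fun z hz => hz.neg) hne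
        ((lt_mem_nhds hr).mono fun t ht => hϕ' t ht) (hϕ'' _ hr)
        (by simpa only [sub_eq_add_neg] using hmax) hε
    have hY' : ∀ h k, ⟪(-Y) h, k⟫ = ⟪h, (-Y) k⟫ := fun h k => by simp [hY]
    have hx1 := hball xb hxb x (hx.trans hεx)
    have hy1 := hball yb hyb y (hy.trans hεy)
    have h1 := hsol.1.neg_mul_rpow_le hq hMf hx1 (hfb x hx1) hX hxm (sub_pos.2 hε₁)
      (by linarith [norm_le_norm_add_norm_sub p p₁])
    have h2 := hsol.2.le_mul_rpow hq hMf hy1 (hfb y hy1) hY' (p := -q')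
      (by
        filter_upwards [hym] with z hz
        simp only [inner_neg_left, _root_.neg_apply] at hz ⊢
        linarith) (sub_pos.2 hε₂)
      (by rw [norm_neg]; linarith [norm_le_norm_add_norm_sub q' p₂])
    have h3 := hF.sub_le hlam.le hlamLam hX hY (by have := mem_Ioi.1 hε; positivity) hXY
      (norm_smul_inv_norm hw) (hXYv _ rfl)
    linarith
  have hlim : ∀ P : ℝ, 0 < P → Filter.Tendsto (fun ε : ℝ => (P - ε) ^ (-q))
      (nhdsWithin 0 (Ioi 0)) (nhds (P ^ (-q))) := fun P hP => by
    have h1 : ContinuousAt (fun ε : ℝ => (P - ε) ^ (-q)) 0 :=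
      (continuousAt_const.sub continuousAt_id).rpow_const (Or.inl (by simpa using hP.ne'))
    simpa using h1.tendsto.mono_left nhdsWithin_le_nhds
  have h1 := le_of_tendsto_of_tendsto
    (((hlim _ (sub_pos.2 hDx)).const_mul Mf).neg.sub ((hlim _ (sub_pos.2 hDy)).const_mul Mf))
    ((((tendsto_const_nhds (x := 4 * K)).add
      (Filter.tendsto_id.mono_left nhdsWithin_le_nhds)).const_mul (n * Lam)).add_const
      (lam * (4 * L * c))) key
  have h2 : 4 * n * (Lam / lam) * K + (1 / lam) * Mf *
      ((‖p₁‖ - κ) ^ (-q) + (‖p₂‖ - κ) ^ (-q)) =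
      (4 * n * Lam * K + Mf * ((‖p₁‖ - κ) ^ (-q) + (‖p₂‖ - κ) ^ (-q))) / lam := by
    field_simp
  rw [h2, le_div_iff₀ hlam]
  linarith

end
end
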